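/- Let c ∈ [1, 16/15), h ∈ F_c, φ its inverse function, and γ = 1/c. Let q ∈ ℕ and 0 ≤ a ≤ q − 1 with gcd(a, q) = 1. If χ > 0 satisfies 16(1 − γ) + 28χ < 1, then there exists χ' > 0 such that for every N ∈ ℕ and every ξ ∈ [0, 1]: Σ_{p ∈ P_{h,N}, p ≡ a (mod q)} φ'(p)^{−1} log p · e^{2πiξp} = Σ_{p ∈ P_N, p ≡ a (mod q)} log p · e^{2πiξp} + O(N^{1−χ−χ'}), where the implied constant is independent of ξ and N. -/

import Mathlib

open Filter Real Set
open scoped Classical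

structure Fc (c : ℝ) where
  x₀ : ℝ
  one_le_x₀ : 1 ≤ x₀
  toFun : ℝ → ℝ
  vth : ℝ → ℝ
  Ch : ℝ
  Ch_pos : 0 < Ch
  one_le : ∀ x ≥ x₀, 1 ≤ toFun x
  contDiffOn : ContDiffOn ℝ 3 toFun (Set.Ici x₀)
  deriv_pos : ∀ x ≥ x₀, 0 < deriv toFun x
  deriv2_pos : ∀ x ≥ x₀, 0 < iteratedDeriv 2 toFun x
  vth_contDiffOn : ContDiffOn ℝ 2 vth (Set.Ici x₀)
  eqn : ∀ x ≥ x₀, toFun x = Ch * x ^ c * Real.exp (∫ t in x₀..x, vth t / t)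
  cond_gt : 1 < c →
    Filter.Tendsto vth Filter.atTop (nhds 0) ∧
    Filter.Tendsto (fun x => x * deriv vth x) Filter.atTop (nhds 0) ∧
    Filter.Tendsto (fun x => x ^ 2 * deriv (deriv vth) x) Filter.atTop (nhds 0)
  cond_eq : c = 1 →
    (∀ x ≥ x₀, 0 < vth x) ∧
    (∀ x y, x₀ ≤ x → x ≤ y → vth y ≤ vth x) ∧
    (∀ ε : ℝ, 0 < ε → ∃ C > 0, ∀ x ≥ x₀, 1 / vth x ≤ C * x ^ ε) ∧
    Filter.Tendsto (fun x => x / toFun x) Filter.atTop (nhds 0) ∧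
    Filter.Tendsto vth Filter.atTop (nhds 0) ∧
    Filter.Tendsto (fun x => x * deriv vth x / vth x) Filter.atTop (nhds 0) ∧
    Filter.Tendsto (fun x => x ^ 2 * deriv (deriv vth) x / vth x) Filter.atTop (nhds 0)

def Ph {c : ℝ} (F : Fc c) : Set ℕ :=
  {p : ℕ | p.Prime ∧ ∃ n : ℕ, F.x₀ ≤ (n : ℝ) ∧ (p : ℤ) = ⌊F.toFun n⌋}

noncomputable def e (t : ℝ) : ℂ := Complex.exp (2 * Real.pi * Complex.I * t)

lemma e_add (x y : ℝ) : e (x + y) = e x * e y := by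
  unfold e; rw [← Complex.exp_add]; congr 1; push_cast; ring

lemma norm_e (x : ℝ) : ‖e x‖ = 1 := by
  unfold e
  rw [Complex.norm_exp]
  simp

lemma e_zero : e 0 = 1 := by simp [e]

lemma e_int (n : ℤ) : e n = 1 := by
  unfold e
  rw [Complex.exp_eq_one_iff]
  exact ⟨n, by push_cast; ring⟩

lemma e_add_int (x : ℝ) (n : ℤ) : e (x + n) = e x := by rw [e_add, e_int, mul_one]

lemma e_neg (x : ℝ) : e (-x) = (starRingEnd ℂ) (e x) := by
  unfold e
  rw [← Complex.exp_conj]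
  congr 1
  simp [map_ofNat]

lemma e_mul_conj (x : ℝ) : e x * (starRingEnd ℂ) (e x) = 1 := by
  rw [← e_neg, ← e_add]; simp [e_zero]

lemma e_sub (x y : ℝ) : e (x - y) = e x * (starRingEnd ℂ) (e y) := by
  rw [sub_eq_add_neg, e_add, e_neg]

lemma norm_e_sub_one_le (x : ℝ) : ‖e x - 1‖ ≤ 2 * π * |x| := by
  have h := Real.norm_exp_I_mul_ofReal_sub_one_le (x := 2 * π * x)
  have h2 : e x = Complex.exp (Complex.I * ((2 * π * x : ℝ) : ℂ)) := by
    unfold e; congr 1; push_cast; ring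
  rw [h2]
  refine h.trans ?_
  rw [Real.norm_eq_abs, abs_mul, abs_of_pos (by positivity : 0 < 2 * π)]

lemma norm_e_sub_e_le (x y : ℝ) : ‖e x - e y‖ ≤ 2 * π * |x - y| := by
  have : e x - e y = e y * (e (x - y) - 1) := by
    rw [mul_sub, ← e_add]; simp
  rw [this, norm_mul, norm_e, one_mul]
  exact norm_e_sub_one_le _

lemma e_eq_cos_sin (x : ℝ) : e x = (Real.cos (2 * π * x) : ℂ) + (Real.sin (2 * π * x) : ℂ) * Complex.I := by
  unfold e
  rw [show (2 * (π : ℂ) * Complex.I * x) = ((2 * π * x : ℝ) : ℂ) * Complex.I by push_cast; ring]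
  rw [Complex.exp_mul_I]
  push_cast; rfl

/-- The cotangent kernel. -/
noncomputable def kc (x : ℝ) : ℂ := 1 / 2 + (Complex.I / 2) * ((Real.cos (π * x) / Real.sin (π * x) : ℝ) : ℂ)

lemma kc_mul (x : ℝ) (hx : Real.sin (π * x) ≠ 0) : kc x * (1 - e x) = 1 := by
  have h1 : Real.cos (2 * π * x) = 1 - 2 * Real.sin (π * x) ^ 2 := by
    rw [show 2 * π * x = 2 * (π * x) by ring, Real.cos_two_mul, Real.cos_sq']; ring
  have h2 : Real.sin (2 * π * x) = 2 * Real.sin (π * x) * Real.cos (π * x) := by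
    rw [show 2 * π * x = 2 * (π * x) by ring, Real.sin_two_mul]
  have h3 := Real.sin_sq_add_cos_sq (π * x)
  rw [e_eq_cos_sin, h1, h2]
  unfold kc
  set s := Real.sin (π * x)
  set c := Real.cos (π * x)
  have hs : (s : ℂ) ≠ 0 := by exact_mod_cast hx
  have h3' : (s : ℂ) ^ 2 + (c : ℂ) ^ 2 = 1 := by exact_mod_cast h3
  push_cast
  have h5 : (1 / 2 + Complex.I / 2 * ((c : ℂ) / s)) = (s + Complex.I * c) / (2 * s) := by
    field_simp
  rw [h5, div_mul_eq_mul_div, div_eq_iff (by simpa using hs)]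
  linear_combination (2 * (s : ℂ)) * h3' - 2 * (s : ℂ) * c ^ 2 * Complex.I_sq

lemma sin_lower {θ : ℝ} (h0 : 0 ≤ θ) (h1 : θ ≤ 1 / 2) {x : ℝ} (hx : θ ≤ x) (hx' : x ≤ 1 - θ) :
    2 * θ ≤ Real.sin (π * x) := by
  have key : ∀ y : ℝ, θ ≤ y → y ≤ 1/2 → 2 * θ ≤ Real.sin (π * y) := by
    intro y hy hy'
    have := Real.mul_le_sin (x := π * y) (mul_nonneg Real.pi_pos.le (by linarith)) (by nlinarith [Real.pi_pos])
    have h3 : 2 / π * (π * y) = 2 * y := by field_simp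
    linarith
  rcases le_total x (1/2) with h | h
  · exact key x hx h
  · have := key (1 - x) (by linarith) (by linarith)
    rwa [show π * (1 - x) = π - π * x by ring, Real.sin_pi_sub] at this

lemma cot_anti {θ x y : ℝ} (h0 : 0 < θ) (hx : θ ≤ x) (hxy : x ≤ y) (hy : y ≤ 1 - θ) :
    Real.cos (π * y) / Real.sin (π * y) ≤ Real.cos (π * x) / Real.sin (π * x) := by
  have hθ : θ ≤ 1/2 := by linarith
  have sx := sin_lower h0.le hθ hx (hxy.trans hy)
  have sy := sin_lower h0.le hθ (hx.trans hxy) hy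
  rw [div_le_div_iff₀ (by linarith) (by linarith)]
  have : 0 ≤ Real.sin (π * y - π * x) := by
    apply Real.sin_nonneg_of_nonneg_of_le_pi
    · nlinarith [Real.pi_pos]
    · nlinarith [Real.pi_pos]
  rw [Real.sin_sub] at this
  linarith

lemma cot_bound {θ x : ℝ} (h0 : 0 < θ) (hx : θ ≤ x) (hx' : x ≤ 1 - θ) :
    |Real.cos (π * x) / Real.sin (π * x)| ≤ 1 / (2 * θ) := by
  have sx := sin_lower h0.le (by linarith) hx hx'
  rw [abs_div, abs_of_pos (by linarith : 0 < Real.sin (π * x))]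
  exact div_le_div₀ (by norm_num) (Real.abs_cos_le_one _) (by positivity) sx

lemma kc_sub (x y : ℝ) : ‖kc x - kc y‖ = |Real.cos (π * x) / Real.sin (π * x) - Real.cos (π * y) / Real.sin (π * y)| / 2 := by
  unfold kc
  rw [show ∀ a b : ℂ, (1 / 2 + Complex.I / 2 * a) - (1 / 2 + Complex.I / 2 * b) = Complex.I / 2 * (a - b) by intros; ring]
  rw [← Complex.ofReal_sub, norm_mul, Complex.norm_real, Real.norm_eq_abs]
  simp
  ring

lemma kc_norm {θ x : ℝ} (h0 : 0 < θ) (hx : θ ≤ x) (hx' : x ≤ 1 - θ) : ‖kc x‖ ≤ 1 / 2 + 1 / (4 * θ) := by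
  unfold kc
  refine (norm_add_le _ _).trans ?_
  rw [norm_mul, Complex.norm_real, Real.norm_eq_abs]
  have := cot_bound h0 hx hx'
  have h4 : 1 / (4 * θ) = 1/2 * (1 / (2 * θ)) := by field_simp; norm_num
  simp only [norm_div, Complex.norm_I, Complex.norm_ofNat, norm_one]
  rw [h4]
  gcongr

lemma kusmin_landau (f : ℕ → ℝ) (a b : ℕ) (hab : a ≤ b) (j : ℤ) (θ : ℝ) (h0 : 0 < θ)
    (hg : ∀ n, a ≤ n → n ≤ b → j + θ ≤ f (n+1) - f n ∧ f (n+1) - f n ≤ j + 1 - θ)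
    (hm : ∀ n, a ≤ n → n < b → f (n+1) - f n ≤ f (n+2) - f (n+1)) :
    ‖∑ n ∈ Finset.Ico a b, e (f n)‖ ≤ 2 / θ := by
  set g : ℕ → ℝ := fun n => f (n+1) - f n - j with hgdef
  have hθ : θ ≤ 1 / 2 := by
    have := hg a le_rfl hab; linarith
  have hgb : ∀ n, a ≤ n → n ≤ b → θ ≤ g n ∧ g n ≤ 1 - θ := by
    intro n h1 h2
    have := hg n h1 h2
    simp only [hgdef]
    constructor <;> linarith
  set ct : ℕ → ℝ := fun n => Real.cos (π * g n) / Real.sin (π * g n) with hct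
  have main : ∀ c, a ≤ c → c ≤ b →
      ‖∑ n ∈ Finset.Ico a c, e (f n) - kc (g a) * e (f a) + kc (g c) * e (f c)‖ ≤ (ct a - ct c) / 2 := by
    intro c hac
    induction c, hac using Nat.le_induction with
    | base => intro _; simp
    | succ c hc ih =>
      intro hcb
      have ih := ih (by omega)
      rw [Finset.sum_Ico_succ_top hc]
      have hs : Real.sin (π * g c) ≠ 0 := by
        have := sin_lower h0.le hθ (hgb c hc (by omega)).1 (hgb c hc (by omega)).2
        linarith [this]
      have h1 := kc_mul (g c) hs
      have h2 : e (f (c+1)) = e (f c) * e (g c) := by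
        rw [← e_add]
        have : f c + g c = f (c+1) + ((-j : ℤ) : ℝ) := by simp only [hgdef]; push_cast; ring
        rw [this, e_add_int]
      have h3 : e (f c) = kc (g c) * e (f c) - kc (g c) * e (f (c+1)) := by
        rw [h2]; linear_combination (-e (f c)) * h1
      have h4 : ∑ n ∈ Finset.Ico a c, e (f n) + e (f c) - kc (g a) * e (f a) + kc (g (c+1)) * e (f (c+1))
          = (∑ n ∈ Finset.Ico a c, e (f n) - kc (g a) * e (f a) + kc (g c) * e (f c))
            + (kc (g (c+1)) - kc (g c)) * e (f (c+1)) := by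
        linear_combination h3
      rw [h4]
      refine (norm_add_le _ _).trans ?_
      rw [norm_mul, norm_e, mul_one, kc_sub]
      have h5 : ct (c+1) ≤ ct c := by
        apply cot_anti h0 (hgb c hc (by omega)).1 _ (hgb (c+1) (by omega) hcb).2
        have := hm c hc (by omega)
        simp only [hgdef]
        linarith
      rw [abs_sub_comm, abs_of_nonneg (by simpa [hct] using h5)]
      simp only [hct] at *
      linarith
  have hfin := main b hab le_rfl
  have ka := kc_norm h0 (hgb a le_rfl hab).1 (hgb a le_rfl hab).2
  have kb := kc_norm h0 (hgb b hab le_rfl).1 (hgb b hab le_rfl).2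
  have ca := abs_le.1 (cot_bound h0 (hgb a le_rfl hab).1 (hgb a le_rfl hab).2)
  have cb := abs_le.1 (cot_bound h0 (hgb b hab le_rfl).1 (hgb b hab le_rfl).2)
  have hS : ∑ n ∈ Finset.Ico a b, e (f n) =
     (∑ n ∈ Finset.Ico a b, e (f n) - kc (g a) * e (f a) + kc (g b) * e (f b)) + kc (g a) * e (f a) - kc (g b) * e (f b) := by ring
  rw [hS]
  refine (norm_sub_le _ _).trans ?_
  refine (add_le_add_left (norm_add_le _ _) _).trans ?_
  rw [norm_mul, norm_mul, norm_e, norm_e, mul_one, mul_one]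
  have e1 : 1 / (2 * θ) = (1/2) * (1/θ) := by field_simp
  have e2 : 1 / (4 * θ) = (1/4) * (1/θ) := by field_simp
  have e3 : 2 / θ = 2 * (1/θ) := by field_simp
  have e4 : 2 ≤ 1 / θ := by rw [le_div_iff₀ h0]; linarith
  simp only [hct] at hfin
  rw [e1] at ca cb
  rw [e2] at ka kb
  rw [e3]
  linarith [ca.1, ca.2, cb.1, cb.2]

lemma norm_sum_e_le_card (S : Finset ℕ) (f : ℕ → ℝ) : ‖∑ n ∈ S, e (f n)‖ ≤ S.card := by
  refine (norm_sum_le _ _).trans ?_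
  simp [norm_e]

lemma card_le_of_gap (S : Finset ℕ) (lam θ : ℝ) (h0 : 0 < lam) (hθ : 0 ≤ θ)
    (h : ∀ m ∈ S, ∀ n ∈ S, m ≤ n → ((n : ℝ) - m) * lam ≤ θ) : (S.card : ℝ) ≤ θ / lam + 1 := by
  rcases S.eq_empty_or_nonempty with rfl | hS
  · simp; positivity
  · have h1 := h _ (S.min'_mem hS) _ (S.max'_mem hS) (S.min'_le_max' hS)
    have h2 : S ⊆ Finset.Icc (S.min' hS) (S.max' hS) := fun x hx =>
      Finset.mem_Icc.2 ⟨S.min'_le x hx, S.le_max' x hx⟩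
    have h3 := Finset.card_le_card h2
    rw [Nat.card_Icc] at h3
    have h4 := S.min'_le_max' hS
    have h5 : (S.card : ℝ) ≤ (S.max' hS : ℝ) + 1 - S.min' hS := by
      have : S.card + S.min' hS ≤ S.max' hS + 1 := by omega
      have : ((S.card + S.min' hS : ℕ) : ℝ) ≤ ((S.max' hS + 1 : ℕ) : ℝ) := by exact_mod_cast this
      push_cast at this; linarith
    have h6 : (S.max' hS : ℝ) - S.min' hS ≤ θ / lam := by
      rw [le_div_iff₀ h0]; exact h1
    linarith

lemma vdc (f : ℕ → ℝ) (a b : ℕ) (hab : a ≤ b) (lam Lam : ℝ) (h0 : 0 < lam) (hle : lam ≤ Lam)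
    (h : ∀ n, a ≤ n → n < b → lam ≤ f (n+2) - 2 * f (n+1) + f n ∧ f (n+2) - 2 * f (n+1) + f n ≤ Lam) :
    ‖∑ n ∈ Finset.Ico a b, e (f n)‖ ≤ 12 * (Lam * ((b : ℝ) - a) + 1) / √lam := by
  have hsq := Real.sqrt_pos.2 h0
  have hss := Real.mul_self_sqrt h0.le
  have hba : (0 : ℝ) ≤ (b : ℝ) - a := by
    have : (a : ℝ) ≤ b := by exact_mod_cast hab
    linarith
  rcases le_or_gt (1/4) lam with hl | hl
  · have h1 := norm_sum_e_le_card (Finset.Ico a b) f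
    rw [Nat.card_Ico, Nat.cast_sub hab] at h1
    refine h1.trans ?_
    rw [le_div_iff₀ hsq]
    have h2 : 1/2 ≤ √lam := by
      rw [show (1/2 : ℝ) = √(1/4) by rw [show (1/4 : ℝ) = (1/2)^2 by norm_num, Real.sqrt_sq (by norm_num)]]
      exact Real.sqrt_le_sqrt hl
    have h3 : √lam ≤ 2 * lam := by nlinarith
    nlinarith
  rcases Nat.eq_or_lt_of_le hab with rfl | hab'
  · simp; positivity
  set θ := √lam with hθ
  have hθ2 : θ < 1/2 := by
    rw [hθ, show (1/2 : ℝ) = √(1/4) by rw [show (1/4 : ℝ) = (1/2)^2 by norm_num, Real.sqrt_sq (by norm_num)]]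
    exact Real.sqrt_lt_sqrt h0.le hl
  set g : ℕ → ℝ := fun n => f (n+1) - f n with hg
  have hgap : ∀ n, a ≤ n → ∀ m, n ≤ m → m ≤ b →
      ((m : ℝ) - n) * lam ≤ g m - g n ∧ g m - g n ≤ ((m : ℝ) - n) * Lam := by
    intro n hn m hm
    induction m, hm using Nat.le_induction with
    | base => intro _; simp
    | succ m hm ih =>
      intro hmb
      have i1 := ih (by omega)
      have i2 := h m (by omega) (by omega)
      have : g (m+1) = g m + (f (m+2) - 2 * f (m+1) + f m) := by simp only [hg]; ring
      rw [this]; push_cast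
      constructor <;> linarith [i1.1, i1.2, i2.1, i2.2]
  have hmono : ∀ n, a ≤ n → ∀ m, n ≤ m → m ≤ b → g n ≤ g m := by
    intro n hn m hm hmb
    have h1 := (hgap n hn m hm hmb).1
    have h2 : (n : ℝ) ≤ m := by exact_mod_cast hm
    nlinarith
  have hj : ∀ j : ℤ, ‖∑ n ∈ (Finset.Ico a b).filter (fun n => ⌊g n⌋ = j), e (f n)‖ ≤ 6 / θ := by
    intro j
    set T := (Finset.Ico a b).filter (fun n => ⌊g n⌋ = j) with hT
    have hTm : ∀ n ∈ T, (a ≤ n ∧ n < b) ∧ (j : ℝ) ≤ g n ∧ g n < j + 1 := by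
      intro n hn
      rw [hT, Finset.mem_filter, Finset.mem_Ico, Int.floor_eq_iff] at hn
      exact hn
    rw [← Finset.sum_filter_add_sum_filter_not T (fun n => g n < j + θ)]
    rw [← Finset.sum_filter_add_sum_filter_not (T.filter (fun n => ¬ (g n < j + θ))) (fun n => j + 1 - θ < g n)]
    have c1 : ‖∑ n ∈ T.filter (fun n => g n < j + θ), e (f n)‖ ≤ θ / lam + 1 := by
      refine (norm_sum_e_le_card _ _).trans (card_le_of_gap _ _ _ h0 hsq.le ?_)
      intro m hm n hn hmn
      rw [Finset.mem_filter] at hm hn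
      have q1 := hTm m hm.1
      have q2 := hTm n hn.1
      have := (hgap m q1.1.1 n hmn q2.1.2.le).1
      linarith [q1.2.1, hn.2]
    have c2 : ‖∑ n ∈ (T.filter (fun n => ¬ (g n < j + θ))).filter (fun n => j + 1 - θ < g n), e (f n)‖ ≤ θ / lam + 1 := by
      refine (norm_sum_e_le_card _ _).trans (card_le_of_gap _ _ _ h0 hsq.le ?_)
      intro m hm n hn hmn
      rw [Finset.mem_filter, Finset.mem_filter] at hm hn
      have q1 := hTm m hm.1.1
      have q2 := hTm n hn.1.1
      have := (hgap m q1.1.1 n hmn q2.1.2.le).1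
      linarith [q2.2.2, hm.2]
    have c3 : ‖∑ n ∈ (T.filter (fun n => ¬ (g n < j + θ))).filter (fun n => ¬ (j + 1 - θ < g n)), e (f n)‖ ≤ 2 / θ + 1 := by
      set R := (T.filter (fun n => ¬ (g n < j + θ))).filter (fun n => ¬ (j + 1 - θ < g n)) with hR
      have hRm : ∀ n, n ∈ R ↔ (a ≤ n ∧ n < b) ∧ j + θ ≤ g n ∧ g n ≤ j + 1 - θ := by
        intro n
        rw [hR, Finset.mem_filter, Finset.mem_filter, hT, Finset.mem_filter, Finset.mem_Ico, Int.floor_eq_iff]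
        push Not
        constructor
        · rintro ⟨⟨⟨h1, h2⟩, h3⟩, h4⟩
          exact ⟨h1, h3, h4⟩
        · rintro ⟨h1, h2, h3⟩
          exact ⟨⟨⟨h1, by linarith, by linarith⟩, h2⟩, h3⟩
      rcases R.eq_empty_or_nonempty with hE | hS
      · rw [hE]; simp; positivity
      · have m1 := (hRm _).1 (R.min'_mem hS)
        have m2 := (hRm _).1 (R.max'_mem hS)
        have m3 := R.min'_le_max' hS
        set n1 := R.min' hS
        set n2 := R.max' hS
        have hin : ∀ n, n1 ≤ n → n ≤ n2 → j + θ ≤ g n ∧ g n ≤ j + 1 - θ := by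
          intro n h1 h2
          have := hmono n1 m1.1.1 n h1 (by omega)
          have := hmono n (by omega) n2 h2 (by omega)
          constructor <;> linarith [m1.2.1, m2.2.2]
        have hRe : R = insert n2 (Finset.Ico n1 n2) := by
          ext n
          rw [hRm, Finset.mem_insert, Finset.mem_Ico]
          constructor
          · intro hn
            have k1 := R.min'_le n ((hRm n).2 hn)
            have k2 := R.le_max' n ((hRm n).2 hn)
            change n1 ≤ n at k1
            change n ≤ n2 at k2
            omega
          · intro hn
            refine ⟨by omega, hin n (by omega) (by omega)⟩
        rw [hRe, Finset.sum_insert (by simp)]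
        refine (norm_add_le _ _).trans ?_
        rw [norm_e]
        have := kusmin_landau f n1 n2 m3 j θ hsq (fun n k1 k2 => hin n k1 k2)
          (fun n k1 k2 => by
            have := hmono n (by omega) (n+1) (by omega) (by omega)
            exact this)
        linarith
    have hdiv : θ / lam = 1 / θ := by
      rw [div_eq_div_iff h0.ne' hsq.ne']; linarith
    have hinv : 2 ≤ 1 / θ := by rw [le_div_iff₀ hsq]; linarith
    rw [hdiv] at c1 c2
    have e3 : 2 / θ = 2 * (1/θ) := by field_simp
    have e4 : 6 / θ = 6 * (1/θ) := by field_simp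
    rw [e3] at c3
    rw [e4]
    refine (norm_add_le _ _).trans ?_
    refine (add_le_add_right (norm_add_le _ _) _).trans ?_
    linarith
  have hmap : ∀ n ∈ Finset.Ico a b, ⌊g n⌋ ∈ Finset.Icc ⌊g a⌋ ⌊g b⌋ := by
    intro n hn
    rw [Finset.mem_Ico] at hn
    rw [Finset.mem_Icc]
    exact ⟨Int.floor_le_floor (hmono a le_rfl n hn.1 hn.2.le), Int.floor_le_floor (hmono n hn.1 b hn.2.le le_rfl)⟩
  rw [← Finset.sum_fiberwise_of_maps_to hmap]
  refine (norm_sum_le _ _).trans ?_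
  refine (Finset.sum_le_sum (fun j _ => hj j)).trans ?_
  rw [Finset.sum_const, nsmul_eq_mul, Int.card_Icc]
  have hfl : ⌊g a⌋ ≤ ⌊g b⌋ := Int.floor_le_floor (hmono a le_rfl b hab le_rfl)
  have hcard : (((⌊g b⌋ + 1 - ⌊g a⌋).toNat : ℕ) : ℝ) ≤ Lam * ((b : ℝ) - a) + 2 := by
    have : (((⌊g b⌋ + 1 - ⌊g a⌋).toNat : ℤ) : ℝ) = ((⌊g b⌋ + 1 - ⌊g a⌋ : ℤ) : ℝ) := by
      rw [Int.toNat_of_nonneg (by omega)]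
    have h2 : (((⌊g b⌋ + 1 - ⌊g a⌋).toNat : ℕ) : ℝ) = ((⌊g b⌋ + 1 - ⌊g a⌋ : ℤ) : ℝ) := by
      rw [← this]; norm_cast
    rw [h2]; push_cast
    have := (hgap a le_rfl b hab le_rfl).2
    have := Int.floor_le (g b)
    have := Int.lt_floor_add_one (g a)
    nlinarith
  have hpos : 0 ≤ Lam * ((b : ℝ) - a) := mul_nonneg (h0.le.trans hle) hba
  calc _ ≤ (Lam * ((b : ℝ) - a) + 2) * (6 / θ) := by gcongr
    _ ≤ _ := by
      rw [mul_div_assoc', div_le_div_iff_of_pos_right hsq]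
      nlinarith

lemma second_diff (G G1 G2 : ℝ → ℝ) (k lam Lam : ℝ)
    (h1 : ∀ x ∈ Icc k (k+2), HasDerivAt G (G1 x) x)
    (h2 : ∀ x ∈ Icc k (k+2), HasDerivAt G1 (G2 x) x)
    (hb : ∀ x ∈ Icc k (k+2), lam ≤ G2 x ∧ G2 x ≤ Lam) :
    lam ≤ G (k+2) - 2 * G (k+1) + G k ∧ G (k+2) - 2 * G (k+1) + G k ≤ Lam := by
  have hD : ∀ x ∈ Icc k (k+1), HasDerivAt (fun x => G (x+1) - G x) (G1 (x+1) - G1 x) x := by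
    intro x hx
    have := (h1 (x+1) ⟨by linarith [hx.1], by linarith [hx.2]⟩).comp_add_const x 1
    exact this.sub (h1 x ⟨hx.1, by linarith [hx.2]⟩)
  obtain ⟨x, hx, hxe⟩ := exists_hasDerivAt_eq_slope (fun x => G (x+1) - G x) (fun x => G1 (x+1) - G1 x)
    (show k < k + 1 by linarith) (fun x hx => (hD x hx).continuousAt.continuousWithinAt)
    (fun x hx => hD x ⟨hx.1.le, hx.2.le⟩)
  obtain ⟨y, hy, hye⟩ := exists_hasDerivAt_eq_slope G1 G2
    (show x < x + 1 by linarith) (fun z hz => (h2 z ⟨by linarith [hx.1, hz.1], by linarith [hx.2, hz.2]⟩).continuousAt.continuousWithinAt)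
    (fun z hz => h2 z ⟨by linarith [hx.1, hz.1], by linarith [hx.2, hz.2]⟩)
  have hb' := hb y ⟨by linarith [hx.1, hy.1], by linarith [hx.2, hy.2]⟩
  have e1 : G (k+2) - 2 * G (k+1) + G k = G2 y := by
    rw [hye, add_sub_cancel_left, div_one, hxe, add_sub_cancel_left, div_one]
    rw [show k + 1 + 1 = k + 2 by ring]; ring
  rw [e1]; exact hb'

lemma vdc_real (G G1 G2 : ℝ → ℝ) (a b : ℕ) (hab : a ≤ b) (lam Lam : ℝ) (h0 : 0 < lam) (hle : lam ≤ Lam)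
    (h1 : ∀ x ∈ Icc (a : ℝ) (b + 1), HasDerivAt G (G1 x) x)
    (h2 : ∀ x ∈ Icc (a : ℝ) (b + 1), HasDerivAt G1 (G2 x) x)
    (hb : ∀ x ∈ Icc (a : ℝ) (b + 1), lam ≤ G2 x ∧ G2 x ≤ Lam) :
    ‖∑ n ∈ Finset.Ico a b, e (G n)‖ ≤ 12 * (Lam * ((b : ℝ) - a) + 1) / √lam := by
  refine vdc (fun n => G n) a b hab lam Lam h0 hle ?_
  intro n hn hnb
  have hn' : (a : ℝ) ≤ n := by exact_mod_cast hn
  have hnb' : (n : ℝ) + 1 ≤ b := by exact_mod_cast hnb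
  have hs : ∀ x ∈ Icc (n : ℝ) (n + 2), x ∈ Icc (a : ℝ) (b + 1) :=
    fun x hx => ⟨by linarith [hx.1], by linarith [hx.2]⟩
  have := second_diff G G1 G2 n lam Lam (fun x hx => h1 x (hs x hx)) (fun x hx => h2 x (hs x hx))
    (fun x hx => hb x (hs x hx))
  push_cast
  exact this

lemma abel_bound (u a : ℕ → ℂ) (P Q : ℕ) (hPQ : P ≤ Q) (A V : ℝ) (hA0 : 0 ≤ A) (hV : 0 ≤ V)
    (hA : ∀ n, P < n → n ≤ Q → ‖∑ i ∈ Finset.Ioc P n, a i‖ ≤ A)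
    (hu : ‖u Q‖ + ∑ n ∈ Finset.Ico (P+1) Q, ‖u (n+1) - u n‖ ≤ V) :
    ‖∑ n ∈ Finset.Ioc P Q, u n * a n‖ ≤ A * V := by
  rcases Nat.eq_or_lt_of_le hPQ with rfl | hlt
  · simp; positivity
  have key : ∀ R, P + 1 ≤ R → ∑ n ∈ Finset.Ioc P R, u n * a n =
      u R * (∑ i ∈ Finset.Ioc P R, a i) - ∑ n ∈ Finset.Ico (P+1) R, (u (n+1) - u n) * ∑ i ∈ Finset.Ioc P n, a i := by
    intro R hR
    induction R, hR using Nat.le_induction with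
    | base => simp
    | succ R hR ih =>
      have hPR : P ≤ R := by omega
      rw [Finset.sum_Ioc_succ_top hPR, ih, Finset.sum_Ico_succ_top hR, Finset.sum_Ioc_succ_top hPR]
      ring
  rw [key Q hlt]
  refine (norm_sub_le _ _).trans ?_
  have s1 : ‖∑ n ∈ Finset.Ico (P+1) Q, (u (n+1) - u n) * ∑ i ∈ Finset.Ioc P n, a i‖ ≤
      (∑ n ∈ Finset.Ico (P+1) Q, ‖u (n+1) - u n‖) * A := by
    rw [Finset.sum_mul]
    refine (norm_sum_le _ _).trans (Finset.sum_le_sum fun n hn => ?_)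
    rw [Finset.mem_Ico] at hn
    rw [norm_mul]
    exact mul_le_mul_of_nonneg_left (hA n (by omega) (by omega)) (norm_nonneg _)
  have s2 : ‖u Q * ∑ i ∈ Finset.Ioc P Q, a i‖ ≤ ‖u Q‖ * A := by
    rw [norm_mul]
    exact mul_le_mul_of_nonneg_left (hA Q hlt le_rfl) (norm_nonneg _)
  calc _ ≤ ‖u Q‖ * A + (∑ n ∈ Finset.Ico (P+1) Q, ‖u (n+1) - u n‖) * A := add_le_add s2 s1
    _ = A * (‖u Q‖ + ∑ n ∈ Finset.Ico (P+1) Q, ‖u (n+1) - u n‖) := by ring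
    _ ≤ A * V := mul_le_mul_of_nonneg_left hu hA0

lemma abel_mono (w : ℕ → ℝ) (a : ℕ → ℂ) (P Q : ℕ) (hPQ : P ≤ Q) (A W : ℝ) (hA0 : 0 ≤ A) (hW0 : 0 ≤ W)
    (hA : ∀ n, P < n → n ≤ Q → ‖∑ i ∈ Finset.Ioc P n, a i‖ ≤ A)
    (hw0 : ∀ n, P < n → n ≤ Q → 0 ≤ w n) (hwW : ∀ n, P < n → n ≤ Q → w n ≤ W)
    (hm : ∀ n, P < n → n < Q → w n ≤ w (n+1)) :
    ‖∑ n ∈ Finset.Ioc P Q, (w n : ℂ) * a n‖ ≤ A * (2 * W) := by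
  rcases Nat.eq_or_lt_of_le hPQ with rfl | hlt
  · simp; positivity
  refine abel_bound (fun n => (w n : ℂ)) a P Q hPQ A (2 * W) hA0 (by positivity) hA ?_
  have h1 : ∑ n ∈ Finset.Ico (P+1) Q, ‖(w (n+1) : ℂ) - (w n : ℂ)‖ = ∑ n ∈ Finset.Ico (P+1) Q, (w (n+1) - w n) := by
    refine Finset.sum_congr rfl fun n hn => ?_
    rw [Finset.mem_Ico] at hn
    rw [← Complex.ofReal_sub, Complex.norm_real, Real.norm_eq_abs, abs_of_nonneg]
    linarith [hm n (by omega) (by omega)]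
  rw [h1, Finset.sum_Ico_sub (fun n => w n) (by omega)]
  rw [Complex.norm_real, Real.norm_eq_abs, abs_of_nonneg (hw0 Q hlt le_rfl)]
  linarith [hwW Q hlt le_rfl, hw0 (P+1) (by omega) (by omega)]

/-! Arithmetic -/

open ArithmeticFunction in
/-- truncation -/
def trunc (f : ArithmeticFunction ℝ) (H : ℕ) : ArithmeticFunction ℝ :=
  ⟨fun n => if n ≤ H then f n else 0, by simp⟩

open ArithmeticFunction in
lemma trunc_apply (f : ArithmeticFunction ℝ) (H n : ℕ) : trunc f H n = if n ≤ H then f n else 0 := rfl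

/-- real Moebius -/
noncomputable def muR : ArithmeticFunction ℝ := (ArithmeticFunction.moebius : ArithmeticFunction ℝ)

/-- real zeta -/
noncomputable def zeR : ArithmeticFunction ℝ := (ArithmeticFunction.zeta : ArithmeticFunction ℝ)

/-- von Mangoldt -/
noncomputable abbrev vM : ArithmeticFunction ℝ := ArithmeticFunction.vonMangoldt

lemma vaughan (H : ℕ) : vM = trunc vM H + trunc muR H * ArithmeticFunction.log
    - (trunc muR H * trunc vM H) * zeR + (vM - trunc vM H) * ((muR - trunc muR H) * zeR) := by
  have h1 : muR * zeR = 1 := ArithmeticFunction.coe_moebius_mul_coe_zeta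
  have h2 : vM * zeR = ArithmeticFunction.log := ArithmeticFunction.vonMangoldt_mul_zeta
  rw [← h2]
  linear_combination (trunc vM H - vM) * h1

lemma sum_conv (f g : ArithmeticFunction ℝ) (F : ℕ → ℂ) (P Q : ℕ) :
    ∑ n ∈ Finset.Ioc P Q, (((f * g) n : ℝ) : ℂ) * F n =
    ∑ k ∈ Finset.Icc 1 Q, ∑ l ∈ Finset.Icc 1 Q,
      if P < k * l ∧ k * l ≤ Q then (f k : ℂ) * (g l : ℂ) * F (k * l) else 0 := by
  have h1 : ∀ n ∈ Finset.Ioc P Q, (((f * g) n : ℝ) : ℂ) * F n =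
      ∑ k ∈ Finset.Icc 1 Q, ∑ l ∈ Finset.Icc 1 Q, if k * l = n then (f k : ℂ) * (g l : ℂ) * F (k * l) else 0 := by
    intro n hn
    rw [Finset.mem_Ioc] at hn
    rw [ArithmeticFunction.mul_apply, ← Finset.sum_product', ← Finset.sum_filter]
    push_cast
    rw [Finset.sum_mul]
    have : n.divisorsAntidiagonal = (Finset.Icc 1 Q ×ˢ Finset.Icc 1 Q).filter (fun x => x.1 * x.2 = n) := by
      ext ⟨x, y⟩
      simp only [Nat.mem_divisorsAntidiagonal, Finset.mem_filter, Finset.mem_product, Finset.mem_Icc]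
      constructor
      · rintro ⟨h, h0⟩
        have hx : x ≠ 0 := by rintro rfl; simp at h; omega
        have hy : y ≠ 0 := by rintro rfl; simp at h; omega
        have : x ≤ n := Nat.le_of_dvd (by omega) ⟨y, h.symm⟩
        have : y ≤ n := Nat.le_of_dvd (by omega) ⟨x, by rw [mul_comm]; exact h.symm⟩
        exact ⟨by omega, h⟩
      · rintro ⟨h, h0⟩
        exact ⟨h0, by omega⟩
    rw [this]
    refine Finset.sum_congr rfl fun x hx => ?_
    rw [Finset.mem_filter] at hx
    rw [hx.2]
  rw [Finset.sum_congr rfl h1, Finset.sum_comm]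
  refine Finset.sum_congr rfl fun k _ => ?_
  rw [Finset.sum_comm]
  refine Finset.sum_congr rfl fun l _ => ?_
  rw [Finset.sum_ite_eq]
  simp only [Finset.mem_Ioc]

lemma sum_conv' (f g : ArithmeticFunction ℝ) (F : ℕ → ℂ) (P Q : ℕ) :
    ∑ n ∈ Finset.Ioc P Q, (((f * g) n : ℝ) : ℂ) * F n =
    ∑ k ∈ Finset.Icc 1 Q, (f k : ℂ) * ∑ l ∈ Finset.Ioc (P / k) (Q / k), (g l : ℂ) * F (k * l) := by
  rw [sum_conv]
  refine Finset.sum_congr rfl fun k hk => ?_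
  rw [Finset.mem_Icc] at hk
  rw [← Finset.sum_filter, Finset.mul_sum]
  refine Finset.sum_congr ?_ fun l _ => by ring
  ext l
  have hk0 : 0 < k := by omega
  simp only [Finset.mem_filter, Finset.mem_Icc, Finset.mem_Ioc]
  rw [Nat.div_lt_iff_lt_mul hk0, Nat.le_div_iff_mul_le hk0, mul_comm l k]
  constructor
  · rintro ⟨_, h⟩; exact h
  · intro h
    refine ⟨⟨?_, ?_⟩, h⟩
    · rcases Nat.eq_zero_or_pos l with rfl | h'
      · simp at h
      · exact h'
    · nlinarith

lemma divisor_bound (ε : ℝ) (hε : 0 < ε) : ∃ C : ℝ, 1 ≤ C ∧ ∀ n : ℕ, n ≠ 0 →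
    ((n.divisors.card : ℕ) : ℝ) ≤ C * (n : ℝ) ^ ε := by
  set K : ℝ := max 1 (1 / (ε * Real.log 2)) with hK
  have hK1 : 1 ≤ K := le_max_left _ _
  have hlog2 : 0 < Real.log 2 := Real.log_pos (by norm_num)
  set X : ℕ := ⌈(2 : ℝ) ^ (1 / ε)⌉₊ with hX
  refine ⟨K ^ X, one_le_pow₀ hK1, ?_⟩
  intro n hn
  rw [Nat.card_divisors hn]
  have hterm : ∀ p ∈ n.primeFactors, ((n.factorization p + 1 : ℕ) : ℝ) ≤
      (if p < X then K else 1) * (((p ^ n.factorization p : ℕ)) : ℝ) ^ ε := by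
    intro p hp
    have hp2 : 2 ≤ p := (Nat.prime_of_mem_primeFactors hp).two_le
    have hp2' : (2 : ℝ) ≤ p := by exact_mod_cast hp2
    set v := n.factorization p
    push_cast
    split_ifs with hpx
    · have h1 : (2 : ℝ) ^ (ε * v) ≤ ((p : ℝ) ^ v) ^ ε := by
        rw [← Real.rpow_natCast, ← Real.rpow_mul (by positivity), mul_comm]
        exact Real.rpow_le_rpow (by norm_num) hp2' (by positivity)
      have h2 : 1 + ε * v * Real.log 2 ≤ (2 : ℝ) ^ (ε * v) := by
        rw [Real.rpow_def_of_pos (by norm_num)]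
        have := Real.add_one_le_exp (Real.log 2 * (ε * v))
        linarith
      have h3 : (v : ℝ) + 1 ≤ K * (1 + ε * v * Real.log 2) := by
        have k1 : 1 ≤ K * (ε * Real.log 2) := by
          have : 1 / (ε * Real.log 2) ≤ K := le_max_right _ _
          rwa [div_le_iff₀ (by positivity)] at this
        have : (0:ℝ) ≤ v := by positivity
        nlinarith
      calc (v : ℝ) + 1 ≤ K * (1 + ε * v * Real.log 2) := h3
        _ ≤ K * ((p : ℝ) ^ v) ^ ε := by gcongr; exact h2.trans h1
    · have hXp : (2 : ℝ) ^ (1/ε) ≤ p := by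
        have : (2 : ℝ) ^ (1/ε) ≤ X := Nat.le_ceil _
        have : (X : ℝ) ≤ p := by exact_mod_cast (not_lt.1 hpx)
        linarith
      have h1 : (2 : ℝ) ≤ (p : ℝ) ^ ε := by
        have := Real.rpow_le_rpow (by positivity) hXp hε.le
        rwa [← Real.rpow_mul (by norm_num), one_div_mul_cancel hε.ne', Real.rpow_one] at this
      have h2 : ((p : ℝ) ^ v) ^ ε = ((p : ℝ) ^ ε) ^ v := by
        rw [← Real.rpow_natCast, ← Real.rpow_mul (by positivity), mul_comm, Real.rpow_mul (by positivity), Real.rpow_natCast]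
      rw [h2, one_mul]
      calc (v : ℝ) + 1 ≤ 2 ^ v := by exact_mod_cast Nat.lt_two_pow_self
        _ ≤ _ := by gcongr
  have hprod : (n : ℝ) = ∏ p ∈ n.primeFactors, (((p ^ n.factorization p : ℕ)) : ℝ) := by
    conv_lhs => rw [← Nat.prod_factorization_pow_eq_self hn]
    rw [Finsupp.prod]; push_cast; rfl
  push_cast at hterm ⊢
  calc ∏ p ∈ n.primeFactors, ((n.factorization p : ℝ) + 1) ≤
      ∏ p ∈ n.primeFactors, ((if p < X then K else 1) * ((p : ℝ) ^ n.factorization p) ^ ε) := by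
        refine Finset.prod_le_prod (fun p _ => by positivity) hterm
    _ = (∏ p ∈ n.primeFactors, (if p < X then K else 1)) * (n : ℝ) ^ ε := by
        rw [Finset.prod_mul_distrib, Real.finsetProd_rpow _ _ (fun i _ => by positivity)]
        rw [hprod]; push_cast; rfl
    _ ≤ _ := by
        gcongr
        rw [← Finset.prod_filter, Finset.prod_const]
        refine pow_le_pow_right₀ hK1 ?_
        have : n.primeFactors.filter (fun p => p < X) ⊆ Finset.range X := by
          intro p hp; rw [Finset.mem_filter] at hp; exact Finset.mem_range.2 hp.2
        simpa using Finset.card_le_card this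

/-- Local data of the phase function at scale `P`. -/
structure Loc (φ φ1 B B1 : ℝ → ℝ) (P β : ℝ) : Prop where
  hP : 1 ≤ P
  hβ : 0 < β
  d1 : ∀ x ∈ Icc P (10 * P), HasDerivAt φ (φ1 x) x
  d2 : ∀ x ∈ Icc P (10 * P), HasDerivAt φ1 (-(B x) / x ^ 2) x
  d3 : ∀ x ∈ Icc P (10 * P), HasDerivAt B (B1 x) x
  b : ∀ x ∈ Icc P (10 * P), β ≤ B x ∧ B x ≤ 100 * β
  b1 : ∀ x ∈ Icc P (10 * P), β / (20 * P) ≤ B1 x ∧ B1 x ≤ 200 * β / P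

/-- The phase. -/
noncomputable def ph (φ : ℝ → ℝ) (ξ m x : ℝ) : ℝ := ξ * x - m * φ x

lemma sum_Ioc_eq_Ico (a b : ℕ) (F : ℕ → ℂ) : ∑ n ∈ Finset.Ioc a b, F n = ∑ n ∈ Finset.Ico (a+1) (b+1), F n := by
  refine Finset.sum_congr ?_ fun _ _ => rfl
  ext n; simp only [Finset.mem_Ioc, Finset.mem_Ico]; omega

lemma ph_deriv {φ φ1 B B1 : ℝ → ℝ} {P β : ℝ} (L : Loc φ φ1 B B1 P β) (ξ m d x : ℝ) (hd : 0 < d)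
    (hx : d * x ∈ Icc P (10 * P)) :
    HasDerivAt (fun x => ph φ ξ m (d * x)) (ξ * d - m * (φ1 (d * x) * d)) x ∧
    HasDerivAt (fun x => ξ * d - m * (φ1 (d * x) * d)) (m * B (d * x) / x ^ 2) x := by
  have hP := L.hP
  have hx0 : 0 < x := by
    have : 0 < d * x := by linarith [hx.1]
    exact (pos_iff_pos_of_mul_pos this).1 hd
  have hlin : HasDerivAt (fun x : ℝ => d * x) d x := by
    simpa using (hasDerivAt_id x).const_mul d
  constructor
  · have h1 := (L.d1 _ hx).comp x hlin
    have h2 := (hlin.const_mul ξ).sub (h1.const_mul m)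
    exact h2
  · have h1 := (L.d2 _ hx).comp x hlin
    have h2 := ((h1.mul_const d).const_mul m).const_sub (ξ * d)
    refine HasDerivAt.congr_deriv (f := fun x => ξ * d - m * (φ1 (d * x) * d)) h2 ?_
    field_simp
    try ring

lemma typeI_inner {φ φ1 B B1 : ℝ → ℝ} {P : ℕ} {β : ℝ} (L : Loc φ φ1 B B1 P β) (ξ m : ℝ) (hm : 0 < m)
    (d : ℕ) (hd1 : 1 ≤ d) (hd : d ≤ P) (R : ℕ) (hPR : P ≤ R) (hR : R ≤ 3 * P) :
    ‖∑ l ∈ Finset.Ioc (P / d) (R / d), e (ph φ ξ m ((d * l : ℕ) : ℝ))‖ ≤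
      18000 * (√(m * β) + P / (d * √(m * β))) := by
  have hP1 : (1 : ℝ) ≤ P := L.hP
  have hβ := L.hβ
  have hd1' : (1 : ℝ) ≤ d := by exact_mod_cast hd1
  have hd' : (d : ℝ) ≤ P := by exact_mod_cast hd
  have hd0 : (0 : ℝ) < d := by linarith
  have hR' : (R : ℝ) ≤ 3 * P := by exact_mod_cast hR
  rw [sum_Ioc_eq_Ico]
  have hlo : (P : ℝ) ≤ d * ((P / d : ℕ) + 1) := by
    have := Nat.lt_mul_div_succ P (show 0 < d by omega)
    have : ((P : ℕ) : ℝ) ≤ ((d * (P / d + 1) : ℕ) : ℝ) := by exact_mod_cast this.le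
    push_cast at this; exact this
  have hhi : d * ((R / d : ℕ) : ℝ) ≤ R := by exact_mod_cast Nat.mul_div_le R d
  have hmb : 0 < m * β := by positivity
  have hsq := Real.sqrt_pos.2 hmb
  have hss := Real.mul_self_sqrt hmb.le
  set lam : ℝ := m * β * d ^ 2 / (25 * P ^ 2) with hlam
  set Lam : ℝ := 100 * m * β * d ^ 2 / P ^ 2 with hLam
  have hin : ∀ x ∈ Icc (((P / d + 1 : ℕ) : ℝ)) (((R / d + 1 : ℕ) : ℝ) + 1), P ≤ d * x ∧ d * x ≤ 5 * P := by
    intro x hx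
    have h1 := hx.1
    have h2 := hx.2
    push_cast at h1 h2
    constructor
    · nlinarith
    · nlinarith
  have key := vdc_real (fun x => ph φ ξ m (d * x)) (fun x => ξ * d - m * (φ1 (d * x) * d)) (fun x => m * B (d * x) / x ^ 2)
    (P / d + 1) (R / d + 1) (by have := Nat.div_le_div_right (c := d) hPR; omega) lam Lam (by positivity)
    (by rw [hlam, hLam, div_le_div_iff₀ (by positivity) (by positivity)]
        have : 0 ≤ m * β * d ^ 2 * P ^ 2 := by positivity
        nlinarith)
    (fun x hx => (ph_deriv L ξ m d x hd0 ⟨(hin x hx).1, by linarith [(hin x hx).2]⟩).1)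
    (fun x hx => (ph_deriv L ξ m d x hd0 ⟨(hin x hx).1, by linarith [(hin x hx).2]⟩).2)
    (by
      intro x hx
      have hx' := hin x hx
      have hb := L.b (d * x) ⟨hx'.1, by linarith⟩
      have hx0 : 0 < x := by
        have : 0 < d * x := by linarith
        exact (pos_iff_pos_of_mul_pos this).1 hd0
      have q1 : (d * x) ^ 2 ≤ 25 * P ^ 2 := by
        have := pow_le_pow_left₀ (by positivity) hx'.2 2
        linarith [show (5 * (P:ℝ)) ^ 2 = 25 * P ^ 2 by ring]
      have q2 : (P:ℝ) ^ 2 ≤ (d * x) ^ 2 := pow_le_pow_left₀ (by positivity) hx'.1 2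
      constructor
      · rw [hlam, div_le_div_iff₀ (by positivity) (by positivity)]
        calc m * β * d ^ 2 * x ^ 2 = m * β * (d * x) ^ 2 := by ring
          _ ≤ m * B (d * x) * (25 * P ^ 2) := by
            have : 0 ≤ B (d * x) := hβ.le.trans hb.1
            gcongr; exact hb.1
      · rw [hLam, div_le_div_iff₀ (by positivity) (by positivity)]
        calc m * B (d * x) * P ^ 2 ≤ m * (100 * β) * (d * x) ^ 2 := by gcongr; exact hb.2
          _ = _ := by ring)
  have hsl : √lam = √(m * β) * d / (5 * P) := by
    rw [hlam, show m * β * d ^ 2 / (25 * (P:ℝ) ^ 2) = m * β * (d / (5 * P)) ^ 2 by field_simp; norm_num]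
    rw [Real.sqrt_mul hmb.le, Real.sqrt_sq (by positivity)]; ring
  have hcong : ∑ n ∈ Finset.Ico (P / d + 1) (R / d + 1), e (ph φ ξ m ((d * n : ℕ) : ℝ)) =
      ∑ n ∈ Finset.Ico (P / d + 1) (R / d + 1), e (ph φ ξ m (d * n)) := by
    refine Finset.sum_congr rfl fun n _ => by push_cast; rfl
  rw [hcong]
  refine key.trans ?_
  rw [hsl, hLam]
  have hlen : ((R / d + 1 : ℕ) : ℝ) - ((P / d + 1 : ℕ) : ℝ) ≤ 3 * P / d := by
    rw [le_div_iff₀ hd0]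
    push_cast
    have : (0 : ℝ) ≤ ((P / d : ℕ) : ℝ) := by positivity
    nlinarith
  calc 12 * (100 * m * β * d ^ 2 / P ^ 2 * (((R / d + 1 : ℕ) : ℝ) - ((P / d + 1 : ℕ) : ℝ)) + 1) / (√(m * β) * d / (5 * P))
      ≤ 12 * (100 * m * β * d ^ 2 / P ^ 2 * (3 * P / d) + 1) / (√(m * β) * d / (5 * P)) := by gcongr
    _ = 18000 * ((m * β) / √(m * β)) + 60 * (P / (d * √(m * β))) := by field_simp; ring
    _ = 18000 * √(m * β) + 60 * (P / (d * √(m * β))) := by rw [Real.div_sqrt]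
    _ ≤ _ := by
      have : 0 ≤ (P : ℝ) / (d * √(m * β)) := by positivity
      linarith

lemma sum_inv_le (D : ℕ) : ∑ k ∈ Finset.Icc 1 D, (1 : ℝ) / k ≤ 1 + Real.log D := by
  have := harmonic_le_one_add_log D
  rw [harmonic_eq_sum_Icc] at this
  push_cast at this
  simpa using this

lemma typeI_sum (c : ℕ → ℝ) (I : ℕ → ℂ) (A X Y : ℝ) (D Q : ℕ) (hD1 : 1 ≤ D) (hDQ : D ≤ Q) (hA : 0 ≤ A)
    (hY : 0 ≤ Y)
    (hc : ∀ k, 1 ≤ k → k ≤ D → |c k| ≤ A) (hc0 : ∀ k, D < k → c k = 0)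
    (hI : ∀ k, 1 ≤ k → k ≤ D → ‖I k‖ ≤ X + Y / k) :
    ‖∑ k ∈ Finset.Icc 1 Q, (c k : ℂ) * I k‖ ≤ A * (D * X + Y * (1 + Real.log Q)) := by
  have hsub : ∑ k ∈ Finset.Icc 1 Q, (c k : ℂ) * I k = ∑ k ∈ Finset.Icc 1 D, (c k : ℂ) * I k := by
    symm
    refine Finset.sum_subset (Finset.Icc_subset_Icc_right hDQ) ?_
    intro k hk hk'
    rw [Finset.mem_Icc] at hk hk'
    rw [hc0 k (by omega)]; simp
  rw [hsub]
  refine (norm_sum_le _ _).trans ?_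
  have : ∀ k ∈ Finset.Icc 1 D, ‖(c k : ℂ) * I k‖ ≤ A * (X + Y * (1 / k)) := by
    intro k hk
    rw [Finset.mem_Icc] at hk
    rw [norm_mul, Complex.norm_real, Real.norm_eq_abs, mul_one_div]
    exact mul_le_mul (hc k hk.1 hk.2) (hI k hk.1 hk.2) (norm_nonneg _) hA
  refine (Finset.sum_le_sum this).trans ?_
  rw [← Finset.mul_sum, Finset.sum_add_distrib, ← Finset.mul_sum]
  gcongr
  · simp
  · refine (sum_inv_le D).trans ?_
    gcongr

set_option maxHeartbeats 1000000 in
lemma typeII_off {φ φ1 B B1 : ℝ → ℝ} {P : ℕ} {β : ℝ} (L : Loc φ φ1 B B1 P β) (ξ m : ℝ) (hm : 0 < m)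
    (l l' Lz H : ℕ) (hl : l' < l) (h1 : Lz < l') (h2 : l ≤ Lz + H) (hH : H ≤ Lz) (hH1 : 1 ≤ H) (a b : ℕ)
    (hk : ∀ k ∈ Finset.Ico a b, P < k * l' ∧ k * l ≤ 3 * P) :
    ‖∑ k ∈ Finset.Ico a b, e (ph φ ξ m ((k * l : ℕ) : ℝ) - ph φ ξ m ((k * l' : ℕ) : ℝ))‖ ≤
      201600 * (√(m * β * H) + P / √(m * β)) / √(Lz : ℝ) := by
  have hP1 : (1 : ℝ) ≤ P := L.hP
  have hβ := L.hβ
  have hLz : (1 : ℝ) ≤ Lz := by exact_mod_cast hH1.trans hH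
  have hLz0 : (0 : ℝ) < Lz := by linarith
  have hmb : 0 < m * β := by positivity
  have hsq := Real.sqrt_pos.2 hmb
  have hsLz := Real.sqrt_pos.2 hLz0
  rcases le_or_gt b a with hba | hab
  · rw [Finset.Ico_eq_empty (by omega)]
    simp only [Finset.sum_empty, norm_zero]
    positivity
  have ha := (hk a (by simp [hab])).1
  have hb := (hk (b - 1) (by simp; omega)).2
  have hb' : (b - 1) * (Lz + 1) ≤ 3 * P := (Nat.mul_le_mul_left _ (by omega)).trans hb
  have hl0 : 1 ≤ l' := by omega
  have ha1 : 1 ≤ a := by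
    rcases Nat.eq_zero_or_pos a with h | h
    · subst h; simp at ha
    · exact h
  obtain ⟨b', rfl⟩ : ∃ b', b = b' + 1 := ⟨b - 1, by omega⟩
  simp only [Nat.add_sub_cancel] at hb hb'
  have hb1 : 1 ≤ b' := by omega
  have hbl : l ≤ 3 * P := le_trans (by nlinarith) hb
  have haR : (P : ℝ) < a * l' := by exact_mod_cast ha
  have hbR : (b' : ℝ) * l ≤ 3 * P := by exact_mod_cast hb
  have hbR' : (b' : ℝ) * (Lz + 1) ≤ 3 * P := by exact_mod_cast hb'
  have hblR : (l : ℝ) ≤ 3 * P := by exact_mod_cast hbl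
  have hllR : (l' : ℝ) + 1 ≤ l := by exact_mod_cast hl
  have hl'R : (Lz : ℝ) + 1 ≤ l' := by exact_mod_cast h1
  have hl2 : (l : ℝ) ≤ 2 * Lz := by
    have : l ≤ 2 * Lz := by omega
    exact_mod_cast this
  have htH : (l : ℝ) - l' ≤ H := by
    have : l ≤ l' + H := by omega
    have : (l : ℝ) ≤ l' + H := by exact_mod_cast this
    linarith
  have haR1 : (1 : ℝ) ≤ a := by exact_mod_cast ha1
  set t : ℝ := (l : ℝ) - l' with ht
  have ht1 : 1 ≤ t := by linarith
  set lam : ℝ := m * β * t * Lz / (180 * P ^ 2) with hlam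
  set Lam : ℝ := 400 * m * β * t * Lz / P ^ 2 with hLam
  have hin : ∀ x ∈ Icc (a : ℝ) (((b' + 1 : ℕ) : ℝ) + 1), 0 < x ∧ P ≤ l' * x ∧ l' * x ≤ l * x ∧ l * x ≤ 9 * P := by
    intro x hx
    have g1 := hx.1
    have g2 := hx.2
    push_cast at g2
    have hx0 : 0 < x := by linarith
    refine ⟨hx0, ?_, ?_, ?_⟩
    · nlinarith
    · nlinarith
    · nlinarith
  have key := vdc_real (fun x => ph φ ξ m (l * x) - ph φ ξ m (l' * x))
    (fun x => (ξ * l - m * (φ1 (l * x) * l)) - (ξ * l' - m * (φ1 (l' * x) * l')))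
    (fun x => m * B (l * x) / x ^ 2 - m * B (l' * x) / x ^ 2)
    a (b' + 1) hab.le lam Lam (by positivity)
    (by rw [hlam, hLam, div_le_div_iff₀ (by positivity) (by positivity)]
        have : 0 ≤ m * β * t * Lz * P ^ 2 := by positivity
        nlinarith)
    (fun x hx => by
      obtain ⟨h0, h1, h2, h3⟩ := hin x hx
      exact (ph_deriv L ξ m l x (by linarith) ⟨by linarith, by linarith⟩).1.sub
        (ph_deriv L ξ m l' x (by linarith) ⟨by linarith, by linarith⟩).1)
    (fun x hx => by
      obtain ⟨h0, h1, h2, h3⟩ := hin x hx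
      exact (ph_deriv L ξ m l x (by linarith) ⟨by linarith, by linarith⟩).2.sub
        (ph_deriv L ξ m l' x (by linarith) ⟨by linarith, by linarith⟩).2)
    (by
      intro x hx
      obtain ⟨h0, h1, h2, h3⟩ := hin x hx
      have hlt : l' * x < l * x := by nlinarith
      obtain ⟨ζ, hζ, hζe⟩ := exists_hasDerivAt_eq_slope B B1 hlt
        (fun y hy => (L.d3 y ⟨by linarith [hy.1], by linarith [hy.2]⟩).continuousAt.continuousWithinAt)
        (fun y hy => L.d3 y ⟨by linarith [hy.1], by linarith [hy.2]⟩)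
      have hb1 := L.b1 ζ ⟨by linarith [hζ.1], by linarith [hζ.2]⟩
      have hdiff : B (l * x) - B (l' * x) = B1 ζ * (t * x) := by
        rw [hζe]
        have : (l : ℝ) * x - l' * x ≠ 0 := by linarith
        rw [show t * x = l * x - l' * x by rw [ht]; ring]
        exact (div_mul_cancel₀ _ this).symm
      have hG : m * B (l * x) / x ^ 2 - m * B (l' * x) / x ^ 2 = m * t * B1 ζ / x := by
        rw [← sub_div, ← mul_sub, hdiff]; field_simp
      rw [hG]
      have c1 : Lz * x ≤ 9 * P := le_trans (mul_le_mul_of_nonneg_right (by linarith) h0.le) h3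
      have c2 : P ≤ 2 * Lz * x := (h1.trans h2).trans (mul_le_mul_of_nonneg_right hl2 h0.le)
      constructor
      · rw [hlam, div_le_div_iff₀ (by positivity) h0]
        calc m * β * t * Lz * x = m * t * β * (Lz * x) := by ring
          _ ≤ m * t * β * (9 * P) := by gcongr
          _ = m * t * (β / (20 * P)) * (180 * P ^ 2) := by field_simp; norm_num
          _ ≤ _ := by gcongr; exact hb1.1
      · rw [hLam, div_le_div_iff₀ h0 (by positivity)]
        calc m * t * B1 ζ * P ^ 2 ≤ m * t * (200 * β / P) * P ^ 2 := by gcongr; exact hb1.2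
          _ = m * t * 200 * β * P := by field_simp
          _ ≤ m * t * 200 * β * (2 * Lz * x) := by gcongr
          _ = _ := by ring)
  have hcong : ∑ k ∈ Finset.Ico a (b' + 1), e (ph φ ξ m ((k * l : ℕ) : ℝ) - ph φ ξ m ((k * l' : ℕ) : ℝ)) =
      ∑ k ∈ Finset.Ico a (b' + 1), e (ph φ ξ m (l * k) - ph φ ξ m (l' * k)) := by
    refine Finset.sum_congr rfl fun n _ => by push_cast; rw [mul_comm (n : ℝ), mul_comm (n : ℝ)]
  rw [hcong]
  refine key.trans ?_
  have ht0 : (0 : ℝ) < t := by linarith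
  have hsl : √(m * β) * √t * √(Lz : ℝ) / (14 * P) ≤ √lam := by
    refine Real.le_sqrt_of_sq_le ?_
    rw [div_pow, mul_pow, mul_pow, Real.sq_sqrt hmb.le, Real.sq_sqrt ht0.le, Real.sq_sqrt hLz0.le, hlam]
    rw [div_le_div_iff₀ (by positivity) (by positivity)]
    have : 0 ≤ m * β * t * Lz * P ^ 2 := by positivity
    nlinarith
  have hst : 1 ≤ √t := Real.one_le_sqrt.2 ht1
  have hlen : ((b' + 1 : ℕ) : ℝ) - a ≤ 3 * P / Lz := by
    rw [le_div_iff₀ hLz0]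
    push_cast
    nlinarith
  have hstH : √(m * β) * √t ≤ √(m * β * H) := by
    rw [← Real.sqrt_mul hmb.le]
    exact Real.sqrt_le_sqrt (by gcongr)
  have hsl0 : 0 < √(m * β) * √t * √(Lz : ℝ) / (14 * P) := by positivity
  calc 12 * (Lam * (((b' + 1 : ℕ) : ℝ) - a) + 1) / √lam
      ≤ 12 * (Lam * (3 * P / Lz) + 1) / (√(m * β) * √t * √(Lz : ℝ) / (14 * P)) := by
        have : 0 ≤ Lam := by positivity
        gcongr
    _ = 201600 * ((m * β) / √(m * β) * (t / √t)) / √(Lz : ℝ) + 168 * (P / (√(m * β) * √t)) / √(Lz : ℝ) := by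
        rw [hLam]; field_simp; ring
    _ = 201600 * (√(m * β) * √t) / √(Lz : ℝ) + 168 * (P / (√(m * β) * √t)) / √(Lz : ℝ) := by
        rw [Real.div_sqrt, Real.div_sqrt]
    _ ≤ 201600 * √(m * β * H) / √(Lz : ℝ) + 201600 * (P / √(m * β)) / √(Lz : ℝ) := by
        gcongr
        · norm_num
        · exact le_mul_of_one_le_right hsq.le hst
    _ = _ := by ring

lemma cs_bound (Ks Bs : Finset ℕ) (α b : ℕ → ℝ) (u : ℕ → ℕ → ℂ) (A D E : ℝ) (hA : 0 ≤ A) (hD : 0 ≤ D) (hE : 0 ≤ E)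
    (hα : ∀ k ∈ Ks, |α k| ≤ A) (hb : ∀ l ∈ Bs, |b l| ≤ A)
    (hd : ∀ l ∈ Bs, ‖∑ k ∈ Ks, u k l * starRingEnd ℂ (u k l)‖ ≤ D)
    (ho : ∀ l ∈ Bs, ∀ l' ∈ Bs, l' ≠ l → ‖∑ k ∈ Ks, u k l * starRingEnd ℂ (u k l')‖ ≤ E) :
    ‖∑ l ∈ Bs, ∑ k ∈ Ks, (α k : ℂ) * (b l : ℂ) * u k l‖ ^ 2 ≤ A ^ 4 * Ks.card * (Bs.card * D + Bs.card ^ 2 * E) := by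
  have e1 : ∑ l ∈ Bs, ∑ k ∈ Ks, (α k : ℂ) * (b l : ℂ) * u k l = ∑ k ∈ Ks, (α k : ℂ) * ∑ l ∈ Bs, (b l : ℂ) * u k l := by
    rw [Finset.sum_comm]
    refine Finset.sum_congr rfl fun k _ => ?_
    rw [Finset.mul_sum]
    exact Finset.sum_congr rfl fun l _ => by ring
  rw [e1]
  have n1 : ‖∑ k ∈ Ks, (α k : ℂ) * ∑ l ∈ Bs, (b l : ℂ) * u k l‖ ≤ ∑ k ∈ Ks, |α k| * ‖∑ l ∈ Bs, (b l : ℂ) * u k l‖ := by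
    refine (norm_sum_le _ _).trans (le_of_eq ?_)
    refine Finset.sum_congr rfl fun k _ => ?_
    rw [norm_mul, Complex.norm_real, Real.norm_eq_abs]
  have n2 := Finset.sum_mul_sq_le_sq_mul_sq Ks (fun k => |α k|) (fun k => ‖∑ l ∈ Bs, (b l : ℂ) * u k l‖)
  have n3 : ∑ k ∈ Ks, |α k| ^ 2 ≤ A ^ 2 * Ks.card := by
    calc ∑ k ∈ Ks, |α k| ^ 2 ≤ ∑ k ∈ Ks, A ^ 2 := Finset.sum_le_sum fun k hk =>
          pow_le_pow_left₀ (abs_nonneg _) (hα k hk) 2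
      _ = _ := by simp [mul_comm]
  have n4 : ∑ k ∈ Ks, ‖∑ l ∈ Bs, (b l : ℂ) * u k l‖ ^ 2 ≤ A ^ 2 * (Bs.card * D + Bs.card ^ 2 * E) := by
    have c1 : ((∑ k ∈ Ks, ‖∑ l ∈ Bs, (b l : ℂ) * u k l‖ ^ 2 : ℝ) : ℂ) =
        ∑ l ∈ Bs, ∑ l' ∈ Bs, (b l : ℂ) * (b l' : ℂ) * ∑ k ∈ Ks, u k l * starRingEnd ℂ (u k l') := by
      push_cast
      simp_rw [← Complex.mul_conj', map_sum, Finset.sum_mul_sum, Finset.mul_sum]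
      rw [Finset.sum_comm]
      refine Finset.sum_congr rfl fun l _ => ?_
      rw [Finset.sum_comm]
      refine Finset.sum_congr rfl fun l' _ => ?_
      refine Finset.sum_congr rfl fun k _ => ?_
      simp only [map_mul, Complex.conj_ofReal]; ring
    have c2 : ∑ k ∈ Ks, ‖∑ l ∈ Bs, (b l : ℂ) * u k l‖ ^ 2 = ‖((∑ k ∈ Ks, ‖∑ l ∈ Bs, (b l : ℂ) * u k l‖ ^ 2 : ℝ) : ℂ)‖ := by
      rw [Complex.norm_real, Real.norm_of_nonneg (Finset.sum_nonneg fun _ _ => by positivity)]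
    rw [c2, c1]
    refine (norm_sum_le _ _).trans ?_
    have c3 : ∀ l ∈ Bs, ‖∑ l' ∈ Bs, (b l : ℂ) * (b l' : ℂ) * ∑ k ∈ Ks, u k l * starRingEnd ℂ (u k l')‖ ≤
        A ^ 2 * (D + Bs.card * E) := by
      intro l hl
      refine (norm_sum_le _ _).trans ?_
      have c4 : ∀ l' ∈ Bs, ‖(b l : ℂ) * (b l' : ℂ) * ∑ k ∈ Ks, u k l * starRingEnd ℂ (u k l')‖ ≤
          (if l = l' then A ^ 2 * D else 0) + A ^ 2 * E := by
        intro l' hl'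
        rw [norm_mul, norm_mul, Complex.norm_real, Complex.norm_real, Real.norm_eq_abs, Real.norm_eq_abs]
        have hbb : |b l| * |b l'| ≤ A ^ 2 := by
          rw [sq]; exact mul_le_mul (hb l hl) (hb l' hl') (abs_nonneg _) hA
        by_cases h : l = l'
        · subst h
          rw [if_pos rfl]
          have := mul_le_mul hbb (hd l hl) (norm_nonneg _) (by positivity)
          have : 0 ≤ A ^ 2 * E := by positivity
          linarith
        · rw [if_neg h, zero_add]
          exact mul_le_mul hbb (ho l hl l' hl' (Ne.symm h)) (norm_nonneg _) (by positivity)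
      refine (Finset.sum_le_sum c4).trans (le_of_eq ?_)
      rw [Finset.sum_add_distrib, Finset.sum_ite_eq, if_pos hl, Finset.sum_const, nsmul_eq_mul]
      ring
    refine (Finset.sum_le_sum c3).trans (le_of_eq ?_)
    rw [Finset.sum_const, nsmul_eq_mul]; ring
  calc _ ≤ (∑ k ∈ Ks, |α k| * ‖∑ l ∈ Bs, (b l : ℂ) * u k l‖) ^ 2 := pow_le_pow_left₀ (norm_nonneg _) n1 2
    _ ≤ _ := n2
    _ ≤ (A ^ 2 * Ks.card) * (A ^ 2 * (Bs.card * D + Bs.card ^ 2 * E)) :=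
        mul_le_mul n3 n4 (Finset.sum_nonneg fun _ _ => by positivity) (by positivity)
    _ = _ := by ring

/-- Type II kernel. -/
noncomputable def uu (φ : ℝ → ℝ) (ξ m : ℝ) (P Q s k l : ℕ) : ℂ :=
  if P < k * l ∧ k * l ≤ Q ∧ l + s ≤ k then e (ph φ ξ m ((k * l : ℕ) : ℝ)) else 0

noncomputable def Wd (m β : ℝ) (H P : ℕ) : ℝ := √(m * β * H) + P / √(m * β)

noncomputable def Zd (m β : ℝ) (H P : ℕ) : ℝ := 9 * (P:ℝ) ^ 2 / H + 1209600 * P * √√(P:ℝ) * Wd m β H P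

lemma typeII_off' {φ φ1 B B1 : ℝ → ℝ} {P : ℕ} {β : ℝ} (L : Loc φ φ1 B B1 P β) (ξ m : ℝ) (hm : 0 < m)
    (l l' Lz H Q s : ℕ) (hl : l' < l) (h1 : Lz < l') (h2 : l ≤ Lz + H) (hH : H ≤ Lz) (hH1 : 1 ≤ H)
    (hQ : Q ≤ 3 * P) :
    ‖∑ k ∈ (Finset.Icc 1 Q).filter (fun k => k * Lz ≤ 3 * P), uu φ ξ m P Q s k l * starRingEnd ℂ (uu φ ξ m P Q s k l')‖ ≤
      201600 * Wd m β H P / √(Lz : ℝ) := by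
  have e1 : ∀ k ∈ (Finset.Icc 1 Q).filter (fun k => k * Lz ≤ 3 * P), uu φ ξ m P Q s k l * starRingEnd ℂ (uu φ ξ m P Q s k l') =
      if (P < k * l ∧ k * l ≤ Q ∧ l + s ≤ k) ∧ (P < k * l' ∧ k * l' ≤ Q ∧ l' + s ≤ k) then
        e (ph φ ξ m ((k * l : ℕ) : ℝ) - ph φ ξ m ((k * l' : ℕ) : ℝ)) else 0 := by
    intro k _
    unfold uu
    by_cases c1 : (P < k * l ∧ k * l ≤ Q ∧ l + s ≤ k)
    · by_cases c2 : (P < k * l' ∧ k * l' ≤ Q ∧ l' + s ≤ k)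
      · rw [if_pos c1, if_pos c2, if_pos ⟨c1, c2⟩, e_sub]
      · rw [if_neg c2, if_neg (c := (_ ∧ _ ∧ _) ∧ _) (fun h => c2 h.2)]; simp
    · rw [if_neg c1, if_neg (c := (_ ∧ _ ∧ _) ∧ _) (fun h => c1 h.1)]; simp
  rw [Finset.sum_congr rfl e1, ← Finset.sum_filter]
  have e2 : ((Finset.Icc 1 Q).filter (fun k => k * Lz ≤ 3 * P)).filter
      (fun k => (P < k * l ∧ k * l ≤ Q ∧ l + s ≤ k) ∧ (P < k * l' ∧ k * l' ≤ Q ∧ l' + s ≤ k)) =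
      Finset.Ico (max (P / l' + 1) (l + s)) (Q / l + 1) := by
    ext k
    simp only [Finset.mem_filter, Finset.mem_Icc, Finset.mem_Ico, max_le_iff, Nat.lt_succ_iff, Nat.succ_le_iff,
      Nat.div_lt_iff_lt_mul (show 0 < l' by omega), Nat.le_div_iff_mul_le (show 0 < l by omega)]
    constructor
    · rintro ⟨⟨⟨a1, a2⟩, a3⟩, ⟨a4, a5, a6⟩, ⟨a7, a8, a9⟩⟩
      exact ⟨⟨a7, a6⟩, a5⟩
    · rintro ⟨⟨a1, a2⟩, a3⟩
      have g1 : k * l' ≤ k * l := Nat.mul_le_mul_left _ hl.le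
      have g2 : k * Lz ≤ k * l' := Nat.mul_le_mul_left _ h1.le
      have g3 : k * 1 ≤ k * l' := Nat.mul_le_mul_left _ (by omega)
      refine ⟨⟨⟨by omega, by omega⟩, by omega⟩, ⟨by omega, by omega, by omega⟩, ⟨by omega, by omega, by omega⟩⟩
  rw [e2]
  refine typeII_off L ξ m hm l l' Lz H hl h1 h2 hH hH1 _ _ ?_
  intro k hk
  rw [← e2] at hk
  simp only [Finset.mem_filter, Finset.mem_Icc] at hk
  exact ⟨hk.2.2.1, hk.2.1.2.1.trans hQ⟩

lemma norm_uu_le (φ : ℝ → ℝ) (ξ m : ℝ) (P Q s k l : ℕ) : ‖uu φ ξ m P Q s k l‖ ≤ 1 := by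
  unfold uu; split_ifs <;> simp [norm_e]

lemma typeII_block {φ φ1 B B1 : ℝ → ℝ} {P : ℕ} {β : ℝ} (L : Loc φ φ1 B B1 P β) (ξ m : ℝ) (hm : 0 < m)
    (α b : ℕ → ℝ) (A : ℝ) (hA : 0 ≤ A) (j H Q s : ℕ) (hj : 1 ≤ j) (hH1 : 1 ≤ H) (hQ : Q ≤ 3 * P)
    (hα : ∀ k, 1 ≤ k → k ≤ Q → |α k| ≤ A) (hb : ∀ k, 1 ≤ k → k ≤ Q → |b k| ≤ A)
    (Bs : Finset ℕ) (hB : ∀ l ∈ Bs, j * H < l ∧ l ≤ j * H + H ∧ l ≤ Q) :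
    ‖∑ l ∈ Bs, ∑ k ∈ Finset.Icc 1 Q, (α k : ℂ) * (b l : ℂ) * uu φ ξ m P Q s k l‖ ≤ A ^ 2 * √(Zd m β H P) * (1 / j) := by
  have hP1 : (1 : ℝ) ≤ P := L.hP
  have hβ := L.hβ
  have hmb : 0 < m * β := by positivity
  have hW : 0 ≤ Wd m β H P := by unfold Wd; positivity
  have hZ : 0 ≤ Zd m β H P := by unfold Zd; positivity
  have hj' : (1 : ℝ) ≤ j := by exact_mod_cast hj
  have hH' : (1 : ℝ) ≤ H := by exact_mod_cast hH1
  set Lz := j * H with hLz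
  have hHL : H ≤ Lz := by rw [hLz]; nlinarith
  have hL1 : (1 : ℝ) ≤ Lz := by exact_mod_cast hH1.trans hHL
  by_cases hbig : 3 * P < Lz ^ 2
  · rw [Finset.sum_eq_zero]
    · simp only [norm_zero]; positivity
    · intro l hl
      refine Finset.sum_eq_zero fun k hk => ?_
      unfold uu
      rw [if_neg, mul_zero]
      rintro ⟨a1, a2, a3⟩
      have := (hB l hl).1
      have : Lz * Lz ≤ k * l := Nat.mul_le_mul (by omega) (by omega)
      nlinarith
  push Not at hbig
  have hsub : ∀ l ∈ Bs, ∑ k ∈ Finset.Icc 1 Q, (α k : ℂ) * (b l : ℂ) * uu φ ξ m P Q s k l =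
      ∑ k ∈ (Finset.Icc 1 Q).filter (fun k => k * Lz ≤ 3 * P), (α k : ℂ) * (b l : ℂ) * uu φ ξ m P Q s k l := by
    intro l hl
    symm
    refine Finset.sum_subset (Finset.filter_subset _ _) ?_
    intro k hk hk'
    unfold uu
    rw [if_neg, mul_zero]
    rintro ⟨a1, a2, a3⟩
    refine hk' (Finset.mem_filter.2 ⟨hk, ?_⟩)
    have := (hB l hl).1
    have : k * Lz ≤ k * l := Nat.mul_le_mul_left _ this.le
    omega
  rw [Finset.sum_congr rfl hsub]
  set Ks := (Finset.Icc 1 Q).filter (fun k => k * Lz ≤ 3 * P) with hKs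
  have hKc : (Ks.card : ℝ) ≤ 3 * P / Lz := by
    have : Ks ⊆ Finset.Icc 1 (3 * P / Lz) := by
      intro k hk
      rw [hKs, Finset.mem_filter, Finset.mem_Icc] at hk
      rw [Finset.mem_Icc]
      exact ⟨hk.1.1, (Nat.le_div_iff_mul_le (by omega)).2 hk.2⟩
    have := Finset.card_le_card this
    rw [Nat.card_Icc] at this
    rw [Nat.add_sub_cancel] at this
    have h3 : (Ks.card : ℝ) ≤ ((3 * P / Lz : ℕ) : ℝ) := by exact_mod_cast this
    refine h3.trans ?_
    have := @Nat.cast_div_le ℝ _ _ _ (3 * P) Lz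
    push_cast at this
    exact this
  have hBc : (Bs.card : ℝ) ≤ H := by
    have : Bs ⊆ Finset.Ioc Lz (Lz + H) := fun l hl => Finset.mem_Ioc.2 ⟨(hB l hl).1, (hB l hl).2.1⟩
    have := Finset.card_le_card this
    rw [Nat.card_Ioc] at this
    exact_mod_cast (by omega)
  have key := cs_bound Ks Bs α b (uu φ ξ m P Q s) A Ks.card (201600 * Wd m β H P / √(Lz : ℝ)) hA (by positivity) (by positivity)
    (fun k hk => by
      rw [hKs, Finset.mem_filter, Finset.mem_Icc] at hk
      exact hα k hk.1.1 hk.1.2)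
    (fun l hl => hb l (by have := (hB l hl).1; omega) (hB l hl).2.2)
    (fun l hl => by
      refine (norm_sum_le _ _).trans ?_
      calc _ ≤ ∑ k ∈ Ks, (1:ℝ) := Finset.sum_le_sum fun k _ => by
            rw [norm_mul, RCLike.norm_conj]
            have := norm_uu_le φ ξ m P Q s k l
            exact mul_le_one₀ this (norm_nonneg _) this
        _ = _ := by simp)
    (fun l hl l' hl' hne => by
      rcases Nat.lt_or_gt_of_ne hne with h | h
      · exact typeII_off' L ξ m hm l l' Lz H Q s h (hB l' hl').1 (hB l hl).2.1 hHL hH1 hQ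
      · have := typeII_off' L ξ m hm l' l Lz H Q s h (hB l hl).1 (hB l' hl').2.1 hHL hH1 hQ
        rw [← RCLike.norm_conj, map_sum] at this
        refine le_of_eq_of_le ?_ this
        congr 1
        refine Finset.sum_congr rfl fun k _ => ?_
        rw [map_mul, Complex.conj_conj, mul_comm])
  refine le_of_sq_le_sq (key.trans ?_) (by positivity)
  rw [mul_pow, mul_pow, Real.sq_sqrt hZ]
  have hL0 : (0:ℝ) < Lz := by linarith
  have hLe : (Lz : ℝ) = j * H := by rw [hLz]; push_cast; ring
  have hsL : √(Lz : ℝ) ≤ 2 * √√(P:ℝ) := by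
    have h1 : (Lz : ℝ) ≤ 4 * √(P : ℝ) := by
      refine le_of_sq_le_sq ?_ (by positivity)
      rw [mul_pow, Real.sq_sqrt (by positivity)]
      have : ((Lz ^ 2 : ℕ) : ℝ) ≤ ((3 * P : ℕ) : ℝ) := by exact_mod_cast hbig
      push_cast at this
      linarith
    refine (Real.sqrt_le_sqrt h1).trans (le_of_eq ?_)
    rw [Real.sqrt_mul (by norm_num), show (4:ℝ) = 2 ^ 2 by norm_num, Real.sqrt_sq (by norm_num)]
  have hsL0 := Real.sqrt_pos.2 hL0
  calc A ^ 4 * Ks.card * (Bs.card * Ks.card + Bs.card ^ 2 * (201600 * Wd m β H P / √(Lz : ℝ)))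
      ≤ A ^ 4 * (3 * P / Lz) * (H * (3 * P / Lz) + H ^ 2 * (201600 * Wd m β H P / √(Lz : ℝ))) := by gcongr
    _ = A ^ 4 * (9 * P ^ 2 / H + 604800 * P * (Lz / √(Lz : ℝ)) * Wd m β H P) * (1 / j) ^ 2 := by
        rw [hLe] at hsL0 hL0 ⊢; field_simp; ring
    _ = A ^ 4 * (9 * P ^ 2 / H + 604800 * P * (√(Lz : ℝ)) * Wd m β H P) * (1 / j) ^ 2 := by
        rw [Real.div_sqrt]
    _ ≤ A ^ 4 * (9 * P ^ 2 / H + 604800 * P * (2 * √√(P:ℝ)) * Wd m β H P) * (1 / j) ^ 2 := by gcongr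
    _ = _ := by unfold Zd; ring

lemma typeII_half {φ φ1 B B1 : ℝ → ℝ} {P : ℕ} {β : ℝ} (L : Loc φ φ1 B B1 P β) (ξ m : ℝ) (hm : 0 < m)
    (α b : ℕ → ℝ) (A : ℝ) (hA : 0 ≤ A) (H Q s : ℕ) (hH1 : 1 ≤ H) (hQ : Q ≤ 3 * P)
    (hα : ∀ k, 1 ≤ k → k ≤ Q → |α k| ≤ A) (hb : ∀ k, 1 ≤ k → k ≤ Q → |b k| ≤ A)
    (hb0 : ∀ l, l ≤ H → b l = 0) :
    ‖∑ l ∈ Finset.Icc 1 Q, ∑ k ∈ Finset.Icc 1 Q, (α k : ℂ) * (b l : ℂ) * uu φ ξ m P Q s k l‖ ≤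
      A ^ 2 * √(Zd m β H P) * (1 + Real.log Q) := by
  have hmaps : ∀ l ∈ Finset.Icc 1 Q, (l - 1) / H ∈ Finset.range (Q + 1) := by
    intro l hl
    rw [Finset.mem_Icc] at hl
    rw [Finset.mem_range]
    have := Nat.div_le_self (l - 1) H
    omega
  rw [← Finset.sum_fiberwise_of_maps_to hmaps]
  rw [Finset.sum_range_succ']
  have hz : ∑ l ∈ (Finset.Icc 1 Q).filter (fun l => (l - 1) / H = 0), ∑ k ∈ Finset.Icc 1 Q, (α k : ℂ) * (b l : ℂ) * uu φ ξ m P Q s k l = 0 := by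
    refine Finset.sum_eq_zero fun l hl => ?_
    rw [Finset.mem_filter, Finset.mem_Icc, Nat.div_eq_zero_iff] at hl
    refine Finset.sum_eq_zero fun k _ => ?_
    rw [hb0 l (by omega)]; simp
  rw [hz, add_zero]
  refine (norm_sum_le _ _).trans ?_
  have hbl : ∀ j ∈ Finset.range Q, ‖∑ l ∈ (Finset.Icc 1 Q).filter (fun l => (l - 1) / H = j + 1), ∑ k ∈ Finset.Icc 1 Q, (α k : ℂ) * (b l : ℂ) * uu φ ξ m P Q s k l‖ ≤ A ^ 2 * √(Zd m β H P) * (1 / ((j + 1 : ℕ) : ℝ)) := by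
    intro j _
    refine typeII_block L ξ m hm α b A hA (j + 1) H Q s (by omega) hH1 hQ hα hb _ ?_
    intro l hl
    rw [Finset.mem_filter, Finset.mem_Icc] at hl
    have h1 := Nat.div_mul_le_self (l - 1) H
    have h2 := Nat.lt_div_mul_add (a := l - 1) (b := H) (by omega)
    rw [hl.2] at h1 h2
    omega
  refine (Finset.sum_le_sum hbl).trans ?_
  rw [← Finset.mul_sum]
  have : ∑ i ∈ Finset.range Q, (1 : ℝ) / ((i + 1 : ℕ) : ℝ) ≤ 1 + Real.log Q := by
    refine le_trans (le_of_eq ?_) (sum_inv_le Q)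
    rw [Finset.range_eq_Ico, Finset.sum_Ico_add' (fun i : ℕ => (1:ℝ) / i) 0 Q 1]
    rfl
  exact mul_le_mul_of_nonneg_left this (by positivity)

lemma typeII_full {φ φ1 B B1 : ℝ → ℝ} {P : ℕ} {β : ℝ} (L : Loc φ φ1 B B1 P β) (ξ m : ℝ) (hm : 0 < m)
    (α b : ℕ → ℝ) (A : ℝ) (hA : 0 ≤ A) (H Q : ℕ) (hH1 : 1 ≤ H) (hQ : Q ≤ 3 * P)
    (hα : ∀ k, 1 ≤ k → k ≤ Q → |α k| ≤ A) (hb : ∀ k, 1 ≤ k → k ≤ Q → |b k| ≤ A)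
    (hα0 : ∀ l, l ≤ H → α l = 0) (hb0 : ∀ l, l ≤ H → b l = 0) :
    ‖∑ k ∈ Finset.Icc 1 Q, ∑ l ∈ Finset.Icc 1 Q, (if P < k * l ∧ k * l ≤ Q then
      (α k : ℂ) * (b l : ℂ) * e (ph φ ξ m ((k * l : ℕ) : ℝ)) else 0)‖ ≤
      2 * (A ^ 2 * √(Zd m β H P) * (1 + Real.log Q)) := by
  have h1 := typeII_half L ξ m hm α b A hA H Q 0 hH1 hQ hα hb hb0
  have h2 := typeII_half L ξ m hm b α A hA H Q 1 hH1 hQ hb hα hα0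
  rw [Finset.sum_comm] at h1
  have : ∑ k ∈ Finset.Icc 1 Q, ∑ l ∈ Finset.Icc 1 Q, (if P < k * l ∧ k * l ≤ Q then
      (α k : ℂ) * (b l : ℂ) * e (ph φ ξ m ((k * l : ℕ) : ℝ)) else 0) =
      ∑ k ∈ Finset.Icc 1 Q, ∑ l ∈ Finset.Icc 1 Q, (α k : ℂ) * (b l : ℂ) * uu φ ξ m P Q 0 k l +
      ∑ k ∈ Finset.Icc 1 Q, ∑ l ∈ Finset.Icc 1 Q, (b l : ℂ) * (α k : ℂ) * uu φ ξ m P Q 1 l k := by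
    rw [← Finset.sum_add_distrib]
    refine Finset.sum_congr rfl fun k _ => ?_
    rw [← Finset.sum_add_distrib]
    refine Finset.sum_congr rfl fun l _ => ?_
    unfold uu
    rw [mul_comm l k]
    by_cases h : P < k * l ∧ k * l ≤ Q
    · rcases Nat.lt_or_ge k l with hkl | hkl
      · rw [if_pos h, if_neg (by omega), if_pos (by omega)]; ring
      · rw [if_pos h, if_pos (by omega), if_neg (by omega)]; ring
    · rw [if_neg h, if_neg (by tauto), if_neg (by tauto)]; ring
  rw [this]
  refine (norm_add_le _ _).trans ?_
  linarith

lemma abs_muR_le (n : ℕ) : |muR n| ≤ 1 := by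
  unfold muR
  rw [ArithmeticFunction.intCoe_apply]
  have := ArithmeticFunction.abs_moebius_le_one (n := n)
  exact_mod_cast this

lemma typeIb_coef (H k : ℕ) (hk : 1 ≤ k) : |(trunc muR H * trunc vM H) k| ≤ Real.log k := by
  rw [ArithmeticFunction.mul_apply]
  refine (Finset.abs_sum_le_sum_abs _ _).trans ?_
  rw [← ArithmeticFunction.log_apply, ← ArithmeticFunction.zeta_mul_vonMangoldt, ArithmeticFunction.mul_apply]
  refine Finset.sum_le_sum fun x hx => ?_
  rw [Nat.mem_divisorsAntidiagonal] at hx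
  have hx1 : x.1 ≠ 0 := by rintro h; rw [h, zero_mul] at hx; exact hx.2 hx.1.symm
  rw [abs_mul, ArithmeticFunction.natCoe_apply, ArithmeticFunction.zeta_apply, if_neg hx1]
  have h1 : |trunc muR H x.1| ≤ 1 := by
    rw [trunc_apply]; split_ifs
    · exact abs_muR_le _
    · simp
  have h2 : |trunc vM H x.2| ≤ vM x.2 := by
    rw [trunc_apply]; split_ifs
    · rw [abs_of_nonneg ArithmeticFunction.vonMangoldt_nonneg]
    · simp [ArithmeticFunction.vonMangoldt_nonneg]
  push_cast
  exact mul_le_mul h1 h2 (abs_nonneg _) zero_le_one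

lemma typeIb_zero (H k : ℕ) (hk : H * H < k) : (trunc muR H * trunc vM H) k = 0 := by
  rw [ArithmeticFunction.mul_apply]
  refine Finset.sum_eq_zero fun x hx => ?_
  rw [Nat.mem_divisorsAntidiagonal] at hx
  rw [trunc_apply, trunc_apply]
  by_cases h1 : x.1 ≤ H
  · by_cases h2 : x.2 ≤ H
    · have := Nat.mul_le_mul h1 h2
      omega
    · rw [if_neg h2, mul_zero]
  · rw [if_neg h1, zero_mul]

lemma typeII_coef (H l : ℕ) : |((muR - trunc muR H) * zeR) l| ≤ l.divisors.card := by
  rw [zeR, ArithmeticFunction.coe_mul_zeta_apply]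
  refine (Finset.abs_sum_le_sum_abs _ _).trans ?_
  calc _ ≤ ∑ i ∈ l.divisors, (1:ℝ) := by
        refine Finset.sum_le_sum fun i _ => ?_
        have : (muR - trunc muR H) i = muR i - trunc muR H i := by
          rw [sub_eq_add_neg, ArithmeticFunction.add_apply, ArithmeticFunction.neg_apply]; ring
        rw [this, trunc_apply]
        split_ifs
        · simp
        · simpa using abs_muR_le i
    _ = _ := by simp

lemma typeII_coef_zero (H l : ℕ) (hl : l ≤ H) : ((muR - trunc muR H) * zeR) l = 0 := by
  rw [zeR, ArithmeticFunction.coe_mul_zeta_apply]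
  refine Finset.sum_eq_zero fun i hi => ?_
  have hi' : i ≤ H := (Nat.divisor_le hi).trans hl
  rw [sub_eq_add_neg, ArithmeticFunction.add_apply, ArithmeticFunction.neg_apply, trunc_apply, if_pos hi']; ring

lemma typeII_coef2 (H l : ℕ) : (vM - trunc vM H) l = if l ≤ H then 0 else vM l := by
  rw [sub_eq_add_neg, ArithmeticFunction.add_apply, ArithmeticFunction.neg_apply, trunc_apply]
  split_ifs <;> simp

lemma vM_sum {φ φ1 B B1 : ℝ → ℝ} {P : ℕ} {β : ℝ} (L : Loc φ φ1 B B1 P β) (ξ m : ℝ) (hm : 0 < m)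
    (A : ℝ) (hA : 1 ≤ A) (H Q : ℕ) (hH1 : 1 ≤ H) (hHP : H * H ≤ P) (hPQ : P ≤ Q) (hQ : Q ≤ 3 * P)
    (hlog : Real.log Q ≤ A) (htau : ∀ l : ℕ, 1 ≤ l → l ≤ Q → (l.divisors.card : ℝ) ≤ A) :
    ‖∑ n ∈ Finset.Ioc P Q, (vM n : ℂ) * e (ph φ ξ m n)‖ ≤
      3 * (A * ((H * H : ℕ) * (18000 * √(m * β)) + 18000 * (P / √(m * β)) * (1 + A))) +
      2 * (A ^ 2 * √(Zd m β H P) * (1 + A)) := by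
  have hP1 : (1 : ℝ) ≤ P := L.hP
  have hP1' : 1 ≤ P := by exact_mod_cast hP1
  have hβ := L.hβ
  have hmb : 0 < m * β := by positivity
  have hsq := Real.sqrt_pos.2 hmb
  have hlog0 : 0 ≤ Real.log Q := Real.log_natCast_nonneg _
  have hlogle : ∀ k : ℕ, 1 ≤ k → k ≤ Q → Real.log k ≤ A := fun k h1 h2 =>
    (Real.log_le_log (by exact_mod_cast h1) (by exact_mod_cast h2)).trans hlog
  have hHle : H ≤ H * H := by nlinarith
  set X : ℝ := 18000 * √(m * β) with hX
  set Y : ℝ := 18000 * (P / √(m * β)) with hY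
  have hX0 : 0 ≤ X := by positivity
  have hY0 : 0 ≤ Y := by positivity
  set F : ℕ → ℂ := fun n => e (ph φ ξ m (n : ℝ)) with hF
  have hinner : ∀ k, 1 ≤ k → k ≤ P → ∀ R, P ≤ R → R ≤ 3 * P →
      ‖∑ l ∈ Finset.Ioc (P / k) (R / k), F (k * l)‖ ≤ X + Y / k := by
    intro k hk1 hk2 R h1 h2
    refine (typeI_inner L ξ m hm k hk1 hk2 R h1 h2).trans (le_of_eq ?_)
    have : (0 : ℝ) < k := by exact_mod_cast hk1
    rw [hX, hY]; field_simp
  -- type Ia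
  have TA : ‖∑ n ∈ Finset.Ioc P Q, (((trunc muR H * ArithmeticFunction.log) n : ℝ) : ℂ) * F n‖ ≤
      2 * (A * ((H * H : ℕ) * X + Y * (1 + A))) := by
    rw [sum_conv']
    have := typeI_sum (fun k => trunc muR H k) (fun k => ∑ l ∈ Finset.Ioc (P / k) (Q / k), ((ArithmeticFunction.log l : ℝ) : ℂ) * F (k * l))
      1 (X * (2 * A)) (Y * (2 * A)) H Q hH1 (by omega) zero_le_one (by positivity)
      (fun k _ hk => by
        simp only [trunc_apply]; rw [if_pos hk]; exact abs_muR_le k)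
      (fun k hk => by simp only [trunc_apply]; rw [if_neg (by omega)])
      (fun k hk1 hk2 => by
        have h0 : (0 : ℝ) < k := by exact_mod_cast hk1
        have := abel_mono (fun l => ArithmeticFunction.log l) (fun l => F (k * l)) (P / k) (Q / k)
          (Nat.div_le_div_right hPQ) (X + Y / k) A (by positivity) (by positivity)
          (fun n hn1 hn2 => by
            have h1 : P < k * n := by
              rw [Nat.div_lt_iff_lt_mul (by omega)] at hn1; rwa [mul_comm]
            have h2 : k * n ≤ Q := by
              rw [Nat.le_div_iff_mul_le (by omega)] at hn2; rwa [mul_comm]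
            have := hinner k hk1 (by omega) (k * n) h1.le (h2.trans hQ)
            rwa [Nat.mul_div_cancel_left _ (by omega : 0 < k)] at this)
          (fun n _ _ => by
            simp only [ArithmeticFunction.log_apply]; exact Real.log_natCast_nonneg _)
          (fun n hn1 hn2 => by
            simp only [ArithmeticFunction.log_apply]
            exact hlogle n (Nat.one_le_of_lt hn1) (hn2.trans (Nat.div_le_self _ _)))
          (fun n hn1 hn2 => by
            simp only [ArithmeticFunction.log_apply]
            exact Real.log_le_log (by exact_mod_cast (Nat.one_le_of_lt hn1)) (by push_cast; linarith))
        refine this.trans (le_of_eq ?_)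
        ring)
    refine this.trans ?_
    have hHH : (H : ℝ) ≤ ((H * H : ℕ) : ℝ) := by exact_mod_cast hHle
    calc 1 * (H * (X * (2 * A)) + Y * (2 * A) * (1 + Real.log Q))
        = 2 * (A * (H * X + Y * (1 + Real.log Q))) := by ring
      _ ≤ _ := by gcongr
  have TB : ‖∑ n ∈ Finset.Ioc P Q, ((((trunc muR H * trunc vM H) * zeR) n : ℝ) : ℂ) * F n‖ ≤
      A * ((H * H : ℕ) * X + Y * (1 + A)) := by
    rw [sum_conv']
    have := typeI_sum (fun k => (trunc muR H * trunc vM H) k) (fun k => ∑ l ∈ Finset.Ioc (P / k) (Q / k), ((zeR l : ℝ) : ℂ) * F (k * l))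
      A X Y (H * H) Q (by omega) (by omega) (by positivity) (by positivity)
      (fun k hk1 hk => (typeIb_coef H k hk1).trans (hlogle k hk1 (by omega)))
      (fun k hk => typeIb_zero H k hk)
      (fun k hk1 hk2 => by
        refine le_trans (le_of_eq ?_) (hinner k hk1 (by omega) Q hPQ hQ)
        congr 1
        refine Finset.sum_congr rfl fun l hl => ?_
        rw [Finset.mem_Ioc] at hl
        rw [zeR, ArithmeticFunction.natCoe_apply, ArithmeticFunction.zeta_apply, if_neg (Nat.ne_of_gt (Nat.zero_lt_of_lt hl.1))]
        simp)
    refine this.trans ?_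
    gcongr
  have TC : ‖∑ n ∈ Finset.Ioc P Q, ((((vM - trunc vM H) * ((muR - trunc muR H) * zeR)) n : ℝ) : ℂ) * F n‖ ≤
      2 * (A ^ 2 * √(Zd m β H P) * (1 + A)) := by
    rw [sum_conv]
    have := typeII_full L ξ m hm (fun k => (vM - trunc vM H) k) (fun k => ((muR - trunc muR H) * zeR) k) A (by linarith) H Q hH1 hQ
      (fun k hk1 hk2 => by
        simp only [typeII_coef2]
        split_ifs
        · simp; linarith
        · rw [abs_of_nonneg ArithmeticFunction.vonMangoldt_nonneg]
          exact ArithmeticFunction.vonMangoldt_le_log.trans (hlogle k hk1 hk2))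
      (fun k hk1 hk2 => (typeII_coef H k).trans (htau k hk1 hk2))
      (fun k hk => by simp only [typeII_coef2]; rw [if_pos hk])
      (fun k hk => typeII_coef_zero H k hk)
    refine this.trans ?_
    gcongr
  have hsplit : ∑ n ∈ Finset.Ioc P Q, (vM n : ℂ) * F n =
      ∑ n ∈ Finset.Ioc P Q, (((trunc muR H * ArithmeticFunction.log) n : ℝ) : ℂ) * F n
      - ∑ n ∈ Finset.Ioc P Q, ((((trunc muR H * trunc vM H) * zeR) n : ℝ) : ℂ) * F n
      + ∑ n ∈ Finset.Ioc P Q, ((((vM - trunc vM H) * ((muR - trunc muR H) * zeR)) n : ℝ) : ℂ) * F n := by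
    rw [← Finset.sum_sub_distrib, ← Finset.sum_add_distrib]
    refine Finset.sum_congr rfl fun n hn => ?_
    rw [Finset.mem_Ioc] at hn
    have hv := congrArg (fun f => f n) (vaughan H)
    rw [ArithmeticFunction.add_apply, sub_eq_add_neg, ArithmeticFunction.add_apply, ArithmeticFunction.add_apply,
      ArithmeticFunction.neg_apply, trunc_apply vM, if_neg (by omega)] at hv
    rw [hv]; push_cast; ring
  change ‖∑ n ∈ Finset.Ioc P Q, (vM n : ℂ) * F n‖ ≤ _
  rw [hsplit]
  refine (norm_add_le _ _).trans ?_
  have := norm_sub_le (∑ n ∈ Finset.Ioc P Q, (((trunc muR H * ArithmeticFunction.log) n : ℝ) : ℂ) * F n)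
    (∑ n ∈ Finset.Ioc P Q, ((((trunc muR H * trunc vM H) * zeR) n : ℝ) : ℂ) * F n)
  linarith

/-- Global data of the phase function. -/
structure Good (φ φ1 B B1 : ℝ → ℝ) (γ y0 : ℝ) : Prop where
  hy0 : 1 ≤ y0
  d1 : ∀ y ≥ y0, HasDerivAt φ (φ1 y) y
  d2 : ∀ y ≥ y0, HasDerivAt φ1 (-(B y) / y ^ 2) y
  d3 : ∀ y ≥ y0, HasDerivAt B (B1 y) y
  Bpos : ∀ y ≥ y0, 0 < B y
  blo : ∀ y ≥ y0, B y ≤ 2 * (y * B1 y)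
  bhi : ∀ y ≥ y0, y * B1 y ≤ 2 * B y
  p0 : ∀ y ≥ y0, 0 < φ1 y
  p1 : ∀ y ≥ y0, φ1 y ≤ 1
  Bgr : ∀ ε > 0, ∃ y1, ∀ y ≥ y1, y ^ (γ - ε) ≤ B y ∧ B y ≤ y ^ (γ + ε)
  pgr : ∀ ε > 0, ∃ y1, ∀ y ≥ y1, y ^ (γ - 1 - ε) ≤ φ1 y ∧ φ1 y ≤ y ^ (γ - 1 + ε)

lemma Good.loc {φ φ1 B B1 : ℝ → ℝ} {γ y0 : ℝ} (G : Good φ φ1 B B1 γ y0) (P : ℝ) (hP : y0 ≤ P) :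
    Loc φ φ1 B B1 P (B P) := by
  have hP1 : 1 ≤ P := G.hy0.trans hP
  have hmono : MonotoneOn B (Ici y0) := by
    refine monotoneOn_of_deriv_nonneg (convex_Ici _) (fun y hy => (G.d3 y hy).continuousAt.continuousWithinAt)
      (fun y hy => ?_) (fun y hy => ?_)
    · rw [interior_Ici] at hy
      exact (G.d3 y hy.le).differentiableAt.differentiableWithinAt
    · rw [interior_Ici] at hy
      rw [(G.d3 y hy.le).deriv]
      have h1 := G.Bpos y hy.le
      have h2 := G.blo y hy.le
      have : 0 < y * B1 y := by linarith
      have hy1 : 0 < y := by linarith [G.hy0, hy.out]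
      exact ((pos_iff_pos_of_mul_pos this).1 hy1).le
  have hanti : AntitoneOn (fun y => B y / y ^ 2) (Ici y0) := by
    have hd : ∀ y ≥ y0, HasDerivAt (fun y => B y / y ^ 2) ((B1 y * y ^ 2 - B y * (2 * y)) / (y ^ 2) ^ 2) y := by
      intro y hy
      have hy1 : 0 < y := by linarith [G.hy0]
      have := (G.d3 y hy).div (hasDerivAt_pow 2 y) (by positivity)
      refine HasDerivAt.congr_deriv (f := fun y => B y / y ^ 2) this ?_
      norm_num
    refine antitoneOn_of_deriv_nonpos (convex_Ici _) (fun y hy => (hd y hy).continuousAt.continuousWithinAt)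
      (fun y hy => ?_) (fun y hy => ?_)
    · rw [interior_Ici] at hy
      exact (hd y hy.le).differentiableAt.differentiableWithinAt
    · rw [interior_Ici] at hy
      rw [(hd y hy.le).deriv]
      have hy1 : 0 < y := by linarith [G.hy0, hy.out]
      refine div_nonpos_of_nonpos_of_nonneg ?_ (by positivity)
      have := G.bhi y hy.le
      nlinarith
  have hb : ∀ x ∈ Icc P (10 * P), B P ≤ B x ∧ B x ≤ 100 * B P := by
    intro x hx
    have hx0 : y0 ≤ x := hP.trans hx.1
    have hxp : 0 < x := by linarith [hx.1]
    refine ⟨hmono hP hx0 hx.1, ?_⟩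
    have h1 := hanti hP hx0 hx.1
    simp only at h1
    rw [div_le_div_iff₀ (by positivity) (by positivity)] at h1
    have h2 : x ^ 2 ≤ (10 * P) ^ 2 := pow_le_pow_left₀ hxp.le hx.2 2
    have h3 := G.Bpos P hP
    have h4 : B x * P ^ 2 ≤ (100 * B P) * P ^ 2 := by
      calc B x * P ^ 2 ≤ B P * x ^ 2 := h1
        _ ≤ B P * (10 * P) ^ 2 := by gcongr
        _ = _ := by ring
    exact le_of_mul_le_mul_right h4 (by positivity)
  refine ⟨hP1, G.Bpos P hP, fun x hx => G.d1 x (hP.trans hx.1), fun x hx => G.d2 x (hP.trans hx.1),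
    fun x hx => G.d3 x (hP.trans hx.1), hb, ?_⟩
  intro x hx
  have hx0 : y0 ≤ x := hP.trans hx.1
  have hxp : 0 < x := by linarith [hx.1]
  have hP0 : 0 < P := by linarith
  have h1 := G.blo x hx0
  have h2 := G.bhi x hx0
  have h3 := hb x hx
  have h4 := G.Bpos P hP
  have hB1 : 0 < B1 x := (pos_iff_pos_of_mul_pos (by linarith [G.Bpos x hx0])).1 hxp
  have hx2 := hx.2
  have hx1 := hx.1
  constructor
  · rw [div_le_iff₀ (by positivity)]
    nlinarith
  · rw [le_div_iff₀ hP0]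
    nlinarith

lemma rpow_mul_le {p a b c : ℝ} (hp : 1 ≤ p) (h : a + b ≤ c) : p ^ a * p ^ b ≤ p ^ c := by
  rw [← Real.rpow_add (by linarith)]
  exact Real.rpow_le_rpow_of_exponent_le hp h

lemma Zd_bound (p m β M η χ δ ε : ℝ) (P H : ℕ) (hp : p = P) (hp1 : 1 ≤ p) (hε : 0 < ε) (_hm : 1 ≤ m)
    (_hM0 : 0 < M) (hβ0 : 0 < β)
    (U : ℝ) (hU1 : 1 ≤ U) (hmb1 : m * β ≤ p ^ (1 + χ + 4 * ε) * U ^ 2) (hmb2 : p ^ (1 - δ - ε) ≤ m * β)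
    (hH1 : p ^ (2 * η) ≤ H) (hH2 : (H : ℝ) ≤ 2 * p ^ (2 * η))
    (hc1 : 12 * η + 2 * χ + 8 * ε ≤ 1) (hc2 : 8 * η + 2 * δ + 2 * ε ≤ 1) :
    √(Zd m β H P) ≤ 2000 * (p ^ (1 - η) * U) := by
  have hp0 : 0 < p := by linarith
  have hmb : 0 < m * β := by positivity
  have hU0 : 0 < U := by linarith
  have s1 : √(m * β) ≤ p ^ (1 / 2 + χ / 2 + 2 * ε) * U := by
    refine Real.sqrt_le_iff.2 ⟨by positivity, hmb1.trans (le_of_eq ?_)⟩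
    rw [mul_pow, ← Real.rpow_natCast (p ^ _) 2, ← Real.rpow_mul hp0.le]
    congr 2; push_cast; ring
  have s2 : p ^ (1 / 2 - δ / 2 - ε / 2) ≤ √(m * β) := by
    refine Real.le_sqrt_of_sq_le (le_trans (le_of_eq ?_) hmb2)
    rw [← Real.rpow_natCast (p ^ _) 2, ← Real.rpow_mul hp0.le]
    congr 1; push_cast; ring
  have hH0 : (0:ℝ) < H := lt_of_lt_of_le (by positivity) hH1
  have s3 : √(H : ℝ) ≤ 2 * p ^ η := by
    refine Real.sqrt_le_iff.2 ⟨by positivity, hH2.trans ?_⟩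
    rw [mul_pow, ← Real.rpow_natCast (p ^ _) 2, ← Real.rpow_mul hp0.le]
    have : p ^ (2 * η) = p ^ (η * (2:ℕ)) := by congr 1; push_cast; ring
    rw [this]
    have : 0 < p ^ (η * (2:ℕ)) := by positivity
    linarith
  have s4 : √√p = p ^ (1/4 : ℝ) := by
    rw [Real.sqrt_eq_rpow, Real.sqrt_eq_rpow, ← Real.rpow_mul hp0.le]; norm_num
  have z1 : 9 * p ^ 2 / H ≤ 9 * (p ^ (2 - 2 * η) * U ^ 2) := by
    rw [div_le_iff₀ hH0]
    have : p ^ 2 = p ^ (2 - 2 * η) * p ^ (2 * η) := by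
      rw [← Real.rpow_add hp0, ← Real.rpow_natCast]; congr 1; push_cast; ring
    rw [this]
    have hU2 : 1 ≤ U ^ 2 := one_le_pow₀ hU1
    calc 9 * (p ^ (2 - 2 * η) * p ^ (2 * η)) ≤ 9 * (p ^ (2 - 2 * η) * H) := by gcongr
      _ ≤ 9 * (p ^ (2 - 2 * η) * U ^ 2) * H := by
        have : 0 ≤ p ^ (2 - 2 * η) * H := by positivity
        nlinarith
  have z2 : p * √√p * √(m * β * H) ≤ 2 * (p ^ (2 - 2 * η) * U ^ 2) := by
    rw [Real.sqrt_mul hmb.le, s4]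
    calc p * p ^ (1/4:ℝ) * (√(m * β) * √(H:ℝ)) ≤ p * p ^ (1/4:ℝ) * ((p ^ (1 / 2 + χ / 2 + 2 * ε) * U) * (2 * p ^ η)) := by gcongr
      _ = 2 * (p ^ (1:ℝ) * p ^ (1/4:ℝ) * p ^ (1 / 2 + χ / 2 + 2 * ε) * p ^ η) * U := by rw [Real.rpow_one]; ring
      _ ≤ 2 * p ^ (2 - 2 * η) * U ^ 2 := by
        rw [← Real.rpow_add hp0, ← Real.rpow_add hp0, ← Real.rpow_add hp0]
        gcongr
        · linarith
        · nlinarith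
      _ = _ := by ring
  have z3 : p * √√p * (p / √(m * β)) ≤ p ^ (2 - 2 * η) * U ^ 2 := by
    have hU2 : 1 ≤ U ^ 2 := one_le_pow₀ hU1
    rw [s4]
    calc p * p ^ (1/4:ℝ) * (p / √(m * β)) ≤ p * p ^ (1/4:ℝ) * (p / p ^ (1 / 2 - δ / 2 - ε / 2)) := by gcongr
      _ = p ^ (1:ℝ) * p ^ (1/4:ℝ) * p ^ (1:ℝ) * p ^ (-(1 / 2 - δ / 2 - ε / 2)) := by
        rw [Real.rpow_one, Real.rpow_neg hp0.le]; ring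
      _ ≤ p ^ (2 - 2 * η) := by
        rw [← Real.rpow_add hp0, ← Real.rpow_add hp0, ← Real.rpow_add hp0]
        exact Real.rpow_le_rpow_of_exponent_le hp1 (by linarith)
      _ ≤ _ := le_mul_of_one_le_right (by positivity) hU2
  refine Real.sqrt_le_iff.2 ⟨by positivity, ?_⟩
  unfold Zd Wd
  rw [← hp]
  have : (2000 * (p ^ (1 - η) * U)) ^ 2 = 4000000 * (p ^ (2 - 2 * η) * U ^ 2) := by
    rw [mul_pow, mul_pow, ← Real.rpow_natCast (p ^ _) 2, ← Real.rpow_mul hp0.le]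
    rw [show (1 - η) * ((2:ℕ):ℝ) = 2 - 2 * η by push_cast; ring]
    norm_num
  rw [this]
  have h0 : 0 ≤ p ^ (2 - 2 * η) * U ^ 2 := by positivity
  nlinarith

lemma S_bound {φ φ1 B B1 : ℝ → ℝ} {γ y0 : ℝ} (G : Good φ φ1 B B1 γ y0) (χ ε : ℝ) (hχ : 0 < χ) (hε : 0 < ε)
    (hγ : γ ≤ 1) (hcond : 16 * (1 - γ) + 28 * χ + 1000 * ε ≤ 1) :
    ∃ C > 0, ∃ P0 : ℕ, ∀ P : ℕ, P0 ≤ P → ∀ Q : ℕ, P ≤ Q → Q ≤ 3 * P → ∀ ξ m : ℝ, 1 ≤ m →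
      ‖∑ n ∈ Finset.Ioc P Q, (vM n : ℂ) * e (ph φ ξ m n)‖ ≤
        C * (P:ℝ) ^ (γ - 2 * χ - 17 * ε) * √(1 + m / (P:ℝ) ^ (1 - γ + χ + 3 * ε)) := by
  obtain ⟨Cd, hCd1, hCd⟩ := divisor_bound ε hε
  obtain ⟨y1, hy1⟩ := G.Bgr ε hε
  set δ := 1 - γ with hδ
  have hδ0 : 0 ≤ δ := by linarith
  set η := δ + 2 * χ + 20 * ε with hη
  have hη0 : 0 < η := by linarith
  -- A constant
  have hev : ∀ᶠ P : ℕ in atTop, y0 ≤ P ∧ y1 ≤ P ∧ (4:ℝ) ≤ (P:ℝ) ^ (1 - 4 * η) ∧ (1:ℝ) ≤ P := by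
    have t1 : Tendsto (fun n : ℕ => (n:ℝ)) atTop atTop := tendsto_natCast_atTop_atTop
    have t2 : Tendsto (fun n : ℕ => (n:ℝ) ^ (1 - 4 * η)) atTop atTop :=
      (tendsto_rpow_atTop (by linarith)).comp t1
    filter_upwards [t1.eventually_ge_atTop y0, t1.eventually_ge_atTop y1, t2.eventually_ge_atTop 4,
      t1.eventually_ge_atTop 1] with P h1 h2 h3 h4
    exact ⟨h1, h2, h3, h4⟩
  obtain ⟨P0, hP0⟩ := eventually_atTop.1 hev
  set CA : ℝ := max (Cd * 3 ^ ε) (3 ^ ε / ε) with hCA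
  have h3e : (1:ℝ) ≤ 3 ^ ε := Real.one_le_rpow (by norm_num) hε.le
  have hCA1 : 1 ≤ CA := le_max_of_le_left (one_le_mul_of_one_le_of_one_le hCd1 h3e)
  refine ⟨3 * (72000 * CA + 36000 * CA ^ 2) + 8000 * CA ^ 3, by positivity, P0, ?_⟩
  intro P hP Q hPQ hQ ξ m hm
  obtain ⟨hPy0, hPy1, hP4, hP1⟩ := hP0 P hP
  have L := G.loc P hPy0
  set β := B P with hβ
  have hβ0 : 0 < β := L.hβ
  obtain ⟨hb1, hb2⟩ := hy1 P hPy1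
  set p : ℝ := (P:ℝ) with hp
  have hp0 : 0 < p := by linarith
  set M : ℝ := p ^ (δ + χ + 3 * ε) with hM
  have hM0 : 0 < M := by positivity
  set U : ℝ := √(1 + m / M) with hU
  have hmM : 0 ≤ m / M := by positivity
  have hU1 : 1 ≤ U := Real.one_le_sqrt.2 (by linarith)
  have hUsq : U ^ 2 = 1 + m / M := Real.sq_sqrt (by linarith)
  have hU0 : 0 < U := by linarith
  have hmU : m ≤ M * U ^ 2 := by
    rw [hUsq]; field_simp; linarith
  have hmb0 : 0 < m * β := by positivity
  have hmb1 : m * β ≤ p ^ (1 + χ + 4 * ε) * U ^ 2 := by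
    calc m * β ≤ (M * U ^ 2) * p ^ (γ + ε) := by gcongr
      _ = (M * p ^ (γ + ε)) * U ^ 2 := by ring
      _ = _ := by rw [hM, ← Real.rpow_add hp0]; congr 2; rw [hδ]; ring
  have hmb2 : p ^ (1 - δ - ε) ≤ m * β := by
    calc p ^ (1 - δ - ε) = p ^ (γ - ε) := by rw [hδ]; ring_nf
      _ ≤ β := hb1
      _ ≤ m * β := le_mul_of_one_le_left hβ0.le hm
  set H : ℕ := ⌈p ^ (2 * η)⌉₊ with hH
  have hpη : 1 ≤ p ^ (2 * η) := Real.one_le_rpow hP1 (by linarith)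
  have hH1 : p ^ (2 * η) ≤ H := Nat.le_ceil _
  have hH2 : (H : ℝ) ≤ 2 * p ^ (2 * η) := by
    have := (Nat.ceil_lt_add_one (show 0 ≤ p ^ (2 * η) by positivity)).le
    linarith
  have hH1' : 1 ≤ H := by
    have : (1:ℝ) ≤ H := hpη.trans hH1
    exact_mod_cast this
  have hHH : (H : ℝ) * H ≤ 4 * p ^ (4 * η) := by
    calc (H : ℝ) * H ≤ (2 * p ^ (2 * η)) * (2 * p ^ (2 * η)) := by gcongr
      _ = 4 * (p ^ (2 * η) * p ^ (2 * η)) := by ring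
      _ = _ := by rw [← Real.rpow_add hp0]; congr 2; ring
  have hHP : H * H ≤ P := by
    have : (H : ℝ) * H ≤ p := by
      refine hHH.trans ?_
      calc 4 * p ^ (4 * η) ≤ p ^ (1 - 4 * η) * p ^ (4 * η) := by gcongr
        _ = p := by rw [← Real.rpow_add hp0]; simp
    rw [hp] at this
    exact_mod_cast this
  have hQ' : (Q : ℝ) ≤ 3 * p := by rw [hp]; exact_mod_cast hQ
  have hQ0 : (1:ℝ) ≤ Q := hP1.trans (by rw [hp]; exact_mod_cast hPQ)
  have hQe : (Q : ℝ) ^ ε ≤ 3 ^ ε * p ^ ε := by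
    rw [← Real.mul_rpow (by norm_num) hp0.le]
    exact Real.rpow_le_rpow (by linarith) hQ' hε.le
  set A : ℝ := CA * p ^ ε with hA
  have hpe : 1 ≤ p ^ ε := Real.one_le_rpow hP1 hε.le
  have hA1 : 1 ≤ A := one_le_mul_of_one_le_of_one_le hCA1 hpe
  have hlog : Real.log Q ≤ A := by
    calc Real.log Q ≤ (Q:ℝ) ^ ε / ε := Real.log_le_rpow_div (by linarith) hε
      _ ≤ 3 ^ ε * p ^ ε / ε := by gcongr
      _ = (3 ^ ε / ε) * p ^ ε := by ring
      _ ≤ A := by rw [hA]; gcongr; exact le_max_right _ _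
  have htau : ∀ l : ℕ, 1 ≤ l → l ≤ Q → (l.divisors.card : ℝ) ≤ A := by
    intro l hl1 hl2
    have hl2' : (l:ℝ) ≤ Q := by exact_mod_cast hl2
    calc (l.divisors.card : ℝ) ≤ Cd * (l:ℝ) ^ ε := hCd l (by omega)
      _ ≤ Cd * (Q:ℝ) ^ ε := by gcongr
      _ ≤ Cd * (3 ^ ε * p ^ ε) := by gcongr
      _ = (Cd * 3 ^ ε) * p ^ ε := by ring
      _ ≤ A := by rw [hA]; gcongr; exact le_max_left _ _
  have key := vM_sum L ξ m (by linarith) A hA1 H Q hH1' hHP hPQ hQ hlog htau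
  have hZ := Zd_bound p m β M η χ δ ε P H hp hP1 hε hm hM0 hβ0 U hU1 hmb1 hmb2 hH1 hH2 (by linarith) (by linarith)
  refine key.trans ?_
  set T : ℝ := p ^ (γ - 2 * χ - 17 * ε) * U with hT
  have hT0 : 0 ≤ T := by positivity
  have s1 : √(m * β) ≤ p ^ (1 / 2 + χ / 2 + 2 * ε) * U := by
    refine Real.sqrt_le_iff.2 ⟨by positivity, hmb1.trans (le_of_eq ?_)⟩
    rw [mul_pow, ← Real.rpow_natCast (p ^ _) 2, ← Real.rpow_mul hp0.le]
    congr 2; push_cast; ring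
  have s2 : p ^ (1 / 2 - δ / 2 - ε / 2) ≤ √(m * β) := by
    refine Real.le_sqrt_of_sq_le (le_trans (le_of_eq ?_) hmb2)
    rw [← Real.rpow_natCast (p ^ _) 2, ← Real.rpow_mul hp0.le]
    congr 1; push_cast; ring
  have T1 : A * ((H * H : ℕ) * (18000 * √(m * β))) ≤ 72000 * CA * T := by
    push_cast
    calc A * (H * H * (18000 * √(m * β))) ≤ (CA * p ^ ε) * (4 * p ^ (4 * η) * (18000 * (p ^ (1 / 2 + χ / 2 + 2 * ε) * U))) := by gcongr
      _ = 72000 * CA * (p ^ ε * p ^ (4 * η) * p ^ (1 / 2 + χ / 2 + 2 * ε) * U) := by ring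
      _ ≤ 72000 * CA * T := by
        rw [hT, ← Real.rpow_add hp0, ← Real.rpow_add hp0]
        gcongr
        · linarith
  have T2 : A * (18000 * (p / √(m * β)) * (1 + A)) ≤ 36000 * CA ^ 2 * T := by
    calc A * (18000 * (p / √(m * β)) * (1 + A)) ≤ A * (18000 * (p / p ^ (1 / 2 - δ / 2 - ε / 2)) * (A + A)) := by gcongr
      _ = 36000 * CA ^ 2 * (p ^ ε * p ^ ε * p ^ (1:ℝ) * p ^ (-(1 / 2 - δ / 2 - ε / 2))) := by
        rw [hA, Real.rpow_one, Real.rpow_neg hp0.le]; ring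
      _ ≤ 36000 * CA ^ 2 * (p ^ (γ - 2 * χ - 17 * ε) * 1) := by
        rw [← Real.rpow_add hp0, ← Real.rpow_add hp0, ← Real.rpow_add hp0, mul_one]
        gcongr
        · linarith
      _ ≤ _ := by rw [hT]; gcongr
  have T3 : 2 * (A ^ 2 * √(Zd m β H P) * (1 + A)) ≤ 8000 * CA ^ 3 * T := by
    calc 2 * (A ^ 2 * √(Zd m β H P) * (1 + A)) ≤ 2 * (A ^ 2 * (2000 * (p ^ (1 - η) * U)) * (A + A)) := by gcongr
      _ = 8000 * CA ^ 3 * (p ^ ε * p ^ ε * p ^ ε * p ^ (1 - η) * U) := by rw [hA]; ring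
      _ ≤ _ := by
        rw [hT, ← Real.rpow_add hp0, ← Real.rpow_add hp0, ← Real.rpow_add hp0]
        gcongr
        · linarith
  calc _ = 3 * (A * ((H * H : ℕ) * (18000 * √(m * β))) + A * (18000 * (p / √(m * β)) * (1 + A))) + 2 * (A ^ 2 * √(Zd m β H P) * (1 + A)) := by ring
    _ ≤ 3 * (72000 * CA * T + 36000 * CA ^ 2 * T) + 8000 * CA ^ 3 * T := by linarith
    _ = _ := by rw [hT]; ring

lemma bern3 (x : ℝ) : bernoulliFun 3 x = x^3 - 3/2*x^2 + x/2 := by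
  simp only [bernoulliFun, Polynomial.bernoulli, Finset.sum_range_succ, Polynomial.map_add]
  simp
  norm_num [bernoulli_eq_bernoulli'_of_ne_one, bernoulli_one]
  try ring

/-- periodic cubic -/
noncomputable def b3 (t : ℝ) : ℝ := (Int.fract t)^3 - 3/2*(Int.fract t)^2 + (Int.fract t)/2

lemma b3_hasSum (t : ℝ) : HasSum (fun n : ℤ => (-6 / (2 * π * Complex.I) ^ 3) * (1 / (n : ℂ) ^ 3) * e (n * t)) (b3 t : ℂ) := by
  have h := hasSum_one_div_pow_mul_fourier_mul_bernoulliFun (k := 3) (by norm_num) (x := Int.fract t)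
    ⟨Int.fract_nonneg t, (Int.fract_lt_one t).le⟩
  have h2 := h.mul_left (-6 / (2 * π * Complex.I) ^ 3 : ℂ)
  have hpi : (2 * π * Complex.I : ℂ) ≠ 0 := by
    simp [Real.pi_ne_zero]
  convert h2 using 1
  · rfl
  · ext n
    rw [fourier_coe_apply, mul_assoc]
    congr 2
    have : (n : ℝ) * t = n * Int.fract t + ((n * ⌊t⌋ : ℤ) : ℝ) := by
      rw [Int.fract]; push_cast; ring
    rw [this, e_add_int, e]
    congr 1
    push_cast
    ring
  · rw [bern3, b3]
    have : ((3:ℕ).factorial : ℂ) = 6 := by norm_num [Nat.factorial]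
    rw [this]
    field_simp

/-- sawtooth -/
noncomputable def saw (t : ℝ) : ℝ := Int.fract t - 1/2

lemma fract_of (t s : ℝ) (k : ℤ) (h0 : 0 ≤ Int.fract t + s - k) (h1 : Int.fract t + s - k < 1) :
    Int.fract (t + s) = Int.fract t + s - k := by
  rw [Int.fract_eq_iff]
  refine ⟨h0, h1, ⌊t⌋ + k, ?_⟩
  rw [Int.fract]; push_cast; ring

lemma saw_approx (d : ℝ) (hd : 0 < d) (hd2 : d ≤ 1/2) (t : ℝ) :
    |saw t - (b3 (t + d) - 2 * b3 t + b3 (t - d)) / (6 * d ^ 2)| ≤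
      if Int.fract t < d ∨ 1 - d ≤ Int.fract t then 1 else 0 := by
  have hx0 := Int.fract_nonneg t
  have hx1 := Int.fract_lt_one t
  set x := Int.fract t with hx
  by_cases h1 : x < d
  · rw [if_pos (Or.inl h1)]
    have f1 : Int.fract (t + d) = x + d := by
      have := fract_of t d 0 (by push_cast; linarith) (by push_cast; linarith)
      simpa using this
    have f2 : Int.fract (t - d) = x - d + 1 := by
      have := fract_of t (-d) (-1) (by push_cast; linarith) (by push_cast; linarith)
      rw [← sub_eq_add_neg] at this
      rw [this]; push_cast; ring
    unfold saw b3
    rw [f1, f2, ← hx]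
    have : x - 1 / 2 - ((x + d) ^ 3 - 3 / 2 * (x + d) ^ 2 + (x + d) / 2 - 2 * (x ^ 3 - 3 / 2 * x ^ 2 + x / 2) +
          ((x - d + 1) ^ 3 - 3 / 2 * (x - d + 1) ^ 2 + (x - d + 1) / 2)) / (6 * d ^ 2) = -((x - d) ^ 2 / (2 * d ^ 2)) := by
      field_simp; ring
    rw [this, abs_neg, abs_of_nonneg (by positivity), div_le_one (by positivity)]
    nlinarith
  by_cases h2 : 1 - d ≤ x
  · rw [if_pos (Or.inr h2)]
    have f1 : Int.fract (t + d) = x + d - 1 := by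
      have := fract_of t d 1 (by push_cast; linarith) (by push_cast; linarith)
      simpa using this
    have f2 : Int.fract (t - d) = x - d := by
      have := fract_of t (-d) 0 (by push_cast; linarith) (by push_cast; linarith)
      rw [← sub_eq_add_neg] at this
      rw [this]; push_cast; ring
    unfold saw b3
    rw [f1, f2, ← hx]
    have : x - 1 / 2 - ((x + d - 1) ^ 3 - 3 / 2 * (x + d - 1) ^ 2 + (x + d - 1) / 2 - 2 * (x ^ 3 - 3 / 2 * x ^ 2 + x / 2) +
          ((x - d) ^ 3 - 3 / 2 * (x - d) ^ 2 + (x - d) / 2)) / (6 * d ^ 2) = ((x + d - 1) ^ 2 / (2 * d ^ 2)) := by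
      field_simp; ring
    rw [this, abs_of_nonneg (by positivity), div_le_one (by positivity)]
    nlinarith
  · rw [if_neg (by tauto)]
    push Not at h1 h2
    have f1 : Int.fract (t + d) = x + d := by
      have := fract_of t d 0 (by push_cast; linarith) (by push_cast; linarith)
      simpa using this
    have f2 : Int.fract (t - d) = x - d := by
      have := fract_of t (-d) 0 (by push_cast; linarith) (by push_cast; linarith)
      rw [← sub_eq_add_neg] at this
      rw [this]; push_cast; ring
    unfold saw b3
    rw [f1, f2, ← hx]
    have : x - 1 / 2 - ((x + d) ^ 3 - 3 / 2 * (x + d) ^ 2 + (x + d) / 2 - 2 * (x ^ 3 - 3 / 2 * x ^ 2 + x / 2) +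
          ((x - d) ^ 3 - 3 / 2 * (x - d) ^ 2 + (x - d) / 2)) / (6 * d ^ 2) = 0 := by
      field_simp; ring
    rw [this]; simp

lemma saw_fourier (d : ℝ) (hd : 0 < d) (hd2 : d ≤ 1/2) :
    ∃ (c : ℤ → ℂ) (g : ℝ → ℝ), c 0 = 0 ∧ (∀ n, n ≠ 0 → ‖c n‖ ≤ 1 / |(n:ℝ)| ∧ ‖c n‖ ≤ 1 / (d ^ 2 * |(n:ℝ)| ^ 3)) ∧
      (∀ t, HasSum (fun n : ℤ => c n * e (n * t)) (g t : ℂ)) ∧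
      ∀ t, |saw t - g t| ≤ if Int.fract t < d ∨ 1 - d ≤ Int.fract t then 1 else 0 := by
  have hC : ‖(-6 / (2 * π * Complex.I) ^ 3 : ℂ)‖ = 6 / (2 * π) ^ 3 := by
    rw [norm_div, norm_pow]
    simp [abs_of_pos Real.pi_pos]
  refine ⟨fun n => (-6 / (2 * π * Complex.I) ^ 3) * (1 / (n : ℂ) ^ 3) * (e (n * d) - 2 + e (-(n * d))) / (6 * d ^ 2),
    fun t => (b3 (t + d) - 2 * b3 t + b3 (t - d)) / (6 * d ^ 2), by simp, ?_, ?_, saw_approx d hd hd2⟩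
  · intro n hn
    have hn0 : 0 < |(n:ℝ)| := abs_pos.2 (by exact_mod_cast hn)
    have hfac : ‖e (n * d) - 2 + e (-(n * d))‖ = ‖e (n * d) - 1‖ ^ 2 := by
      have h1 : e (n * d) - 2 + e (-(n * d)) = -((e (n * d) - 1) * starRingEnd ℂ (e (n * d) - 1)) := by
        have := e_mul_conj (n * d)
        rw [e_neg, map_sub, map_one]
        linear_combination this
      rw [h1, norm_neg, norm_mul, RCLike.norm_conj, sq]
    have hN : ‖(-6 / (2 * π * Complex.I) ^ 3) * (1 / (n : ℂ) ^ 3) * (e (n * d) - 2 + e (-(n * d))) / (6 * d ^ 2)‖ =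
        ‖e (n * d) - 1‖ ^ 2 / ((2 * π) ^ 3 * |(n:ℝ)| ^ 3 * d ^ 2) := by
      rw [norm_div, norm_mul, norm_mul, hC, hfac, norm_div, norm_pow, Complex.norm_intCast]
      have : ‖(6 * (d:ℂ) ^ 2)‖ = 6 * d ^ 2 := by
        rw [norm_mul, norm_pow, Complex.norm_real, Real.norm_of_nonneg hd.le]; norm_num
      rw [this, norm_one]
      field_simp
    have hpi := Real.pi_gt_three
    rw [hN]
    constructor
    · have h1 := norm_e_sub_one_le (n * d)
      rw [div_le_div_iff₀ (by positivity) hn0]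
      calc ‖e (n * d) - 1‖ ^ 2 * |(n:ℝ)| ≤ (2 * π * |n * d|) ^ 2 * |(n:ℝ)| := by gcongr
        _ = (2 * π) ^ 2 * |(n:ℝ)| ^ 3 * d ^ 2 := by rw [abs_mul, abs_of_pos hd]; ring
        _ ≤ 1 * ((2 * π) ^ 3 * |(n:ℝ)| ^ 3 * d ^ 2) := by
          rw [one_mul]
          gcongr
          · linarith
          · norm_num
    · have h1 : ‖e (n * d) - 1‖ ≤ 2 := by
        refine (norm_sub_le _ _).trans ?_
        rw [norm_e, norm_one]; norm_num
      rw [div_le_div_iff₀ (by positivity) (by positivity)]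
      have h8 : (4:ℝ) ≤ (2 * π) ^ 3 := by
        have : (6:ℝ) ^ 3 ≤ (2 * π) ^ 3 := pow_le_pow_left₀ (by norm_num) (by linarith) 3
        linarith
      calc ‖e (n * d) - 1‖ ^ 2 * (d ^ 2 * |(n:ℝ)| ^ 3) ≤ 2 ^ 2 * (d ^ 2 * |(n:ℝ)| ^ 3) := by gcongr
        _ ≤ (2 * π) ^ 3 * (d ^ 2 * |(n:ℝ)| ^ 3) := by
          gcongr; linarith
        _ = _ := by ring
  · intro t
    have h := ((b3_hasSum (t + d)).sub ((b3_hasSum t).mul_left 2)).add (b3_hasSum (t - d))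
    have h2 := h.div_const (6 * (d:ℂ) ^ 2)
    convert h2 using 1
    · rfl
    · ext n
      have e1 : (n:ℝ) * (t + d) = n * t + n * d := by ring
      have e2 : (n:ℝ) * (t - d) = n * t + -(n * d) := by ring
      rw [e1, e2, e_add, e_add]
      ring
    · push_cast; ring

lemma Good.anti {φ φ1 B B1 : ℝ → ℝ} {γ y0 : ℝ} (G : Good φ φ1 B B1 γ y0) {x y : ℝ} (hx : y0 ≤ x) (hxy : x ≤ y) :
    φ1 y ≤ φ1 x := by
  have hanti : AntitoneOn φ1 (Ici y0) := by
    refine antitoneOn_of_deriv_nonpos (convex_Ici _) ?_ ?_ ?_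
    · intro z hz; exact (G.d2 z hz).continuousAt.continuousWithinAt
    · intro z hz; rw [interior_Ici] at hz; exact (G.d2 z (le_of_lt hz)).differentiableAt.differentiableWithinAt
    · intro z hz
      rw [interior_Ici] at hz
      rw [(G.d2 z (le_of_lt hz)).deriv]
      have := G.Bpos z (le_of_lt hz)
      rw [neg_div]
      have : 0 ≤ B z / z ^ 2 := by positivity
      linarith
  exact hanti hx (le_trans hx hxy) hxy

lemma Good.delta {φ φ1 B B1 : ℝ → ℝ} {γ y0 : ℝ} (G : Good φ φ1 B B1 γ y0) {x : ℝ} (hx : y0 ≤ x) :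
    φ1 (x + 1) ≤ φ (x + 1) - φ x ∧ φ (x + 1) - φ x ≤ φ1 x := by
  obtain ⟨z, hz, h⟩ := exists_hasDerivAt_eq_slope φ φ1 (show x < x + 1 by linarith)
    (fun z hz => (G.d1 z (by linarith [hz.1])).continuousAt.continuousWithinAt)
    (fun z hz => G.d1 z (by linarith [hz.1]))
  have h' : φ (x + 1) - φ x = φ1 z := by rw [h]; simp
  rw [h']
  exact ⟨G.anti (by linarith [hz.1]) hz.2.le, G.anti hx hz.1.le⟩

lemma D_bound {φ φ1 B B1 : ℝ → ℝ} {γ y0 : ℝ} (G : Good φ φ1 B B1 γ y0) (χ ε : ℝ) (hχ : 0 < χ) (hε : 0 < ε)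
    (hγ : γ ≤ 1) (hcond : 16 * (1 - γ) + 28 * χ + 1000 * ε ≤ 1) :
    ∃ C > 0, ∃ P0 : ℕ, ∀ P : ℕ, P0 ≤ P → ∀ Q : ℕ, P ≤ Q → Q ≤ 3 * P → ∀ ξ m : ℝ, 1 ≤ m →
      ‖∑ n ∈ Finset.Ioc P Q, (((φ1 n)⁻¹ : ℝ) : ℂ) * ((vM n : ℂ) * (e (ξ * n) * (e (m * -φ ((n : ℝ) + 1)) - e (m * -φ n))))‖
        ≤ C * (P : ℝ) ^ (γ - 2 * χ - 15 * ε) * (m * √(1 + m / (P : ℝ) ^ (1 - γ + χ + 3 * ε))) := by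
  obtain ⟨C, hC, P0, H⟩ := S_bound G χ ε hχ hε hγ hcond
  obtain ⟨y1, hy1⟩ := G.pgr ε hε
  refine ⟨C * 24 * π, by positivity, max P0 (max ⌈y0⌉₊ ⌈y1⌉₊), ?_⟩
  intro P hP Q hPQ hQ ξ m hm
  simp only [max_le_iff, Nat.ceil_le] at hP
  obtain ⟨hP0, hPy0, hPy1⟩ := hP
  have hP1 : (1 : ℝ) ≤ P := le_trans G.hy0 hPy0
  set p : ℝ := (P : ℝ) with hp
  set Sq := √(1 + m / p ^ (1 - γ + χ + 3 * ε)) with hSq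
  set A := C * p ^ (γ - 2 * χ - 17 * ε) * Sq with hA
  have hA0 : 0 ≤ A := by positivity
  have hπ := Real.pi_pos
  set Δ : ℕ → ℝ := fun n => φ ((n : ℝ) + 1) - φ n with hΔ
  have hny : ∀ n : ℕ, P ≤ n → y0 ≤ (n : ℝ) := fun n hn => le_trans hPy0 (by rw [hp]; exact_mod_cast hn)
  have hΔpos : ∀ n : ℕ, P ≤ n → 0 ≤ Δ n := fun n hn =>
    le_trans (G.p0 _ (by linarith [hny n hn])).le (G.delta (hny n hn)).1
  have hΔanti : ∀ n : ℕ, P ≤ n → Δ (n + 1) ≤ Δ n := by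
    intro n hn
    have h1 := (G.delta (hny n hn)).1
    have h2 := (G.delta (hny (n+1) (by omega))).2
    simp only [hΔ]
    push_cast at h2 ⊢
    linarith
  set u : ℕ → ℂ := fun n => e (-(m * Δ n)) - 1 with hu
  have hm0 : 0 < m := by linarith
  have huv : ∀ Q : ℕ, P ≤ Q → 2 * π * m * Δ Q + ∑ n ∈ Finset.Ico P Q, ‖u (n + 1) - u n‖ ≤ 2 * π * m * φ1 p := by
    intro Q hQ
    induction Q, hQ using Nat.le_induction with
    | base =>
      simp only [Finset.Ico_self, Finset.sum_empty, add_zero]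
      have := (G.delta hPy0).2
      exact mul_le_mul_of_nonneg_left this (by positivity)
    | succ n hn ih =>
      rw [Finset.sum_Ico_succ_top hn]
      have h1 : ‖u (n + 1) - u n‖ ≤ 2 * π * m * (Δ n - Δ (n + 1)) := by
        have : u (n + 1) - u n = e (-(m * Δ (n + 1))) - e (-(m * Δ n)) := by simp only [hu]; ring
        rw [this]
        refine (norm_e_sub_e_le _ _).trans (le_of_eq ?_)
        rw [show -(m * Δ (n + 1)) - -(m * Δ n) = m * (Δ n - Δ (n + 1)) by ring, abs_of_nonneg
          (mul_nonneg hm0.le (by linarith [hΔanti n hn]))]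
        ring
      nlinarith [h1, ih]
  have hinner : ∀ R : ℕ, P ≤ R → R ≤ Q →
      ‖∑ n ∈ Finset.Ioc P R, u n * ((vM n : ℂ) * e (ph φ ξ m n))‖ ≤ A * (2 * π * m * φ1 p) := by
    intro R hPR hRQ
    refine abel_bound u _ P R hPR A _ hA0 ?_ ?_ ?_
    · have := G.p0 p hPy0
      positivity
    · intro n hn hnR
      exact H P hP0 n hn.le (by omega) ξ m hm
    · refine le_trans ?_ (huv R hPR)
      refine add_le_add ?_ ?_
      · refine (norm_e_sub_one_le _).trans (le_of_eq ?_)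
        rw [abs_neg, abs_of_nonneg (mul_nonneg hm0.le (hΔpos R hPR))]; ring
      · refine Finset.sum_le_sum_of_subset_of_nonneg ?_ fun _ _ _ => norm_nonneg _
        exact Finset.Ico_subset_Ico (by omega) le_rfl
  have hφP := G.p0 p hPy0
  have h3P : y0 ≤ 3 * p := by linarith
  have hφ3P := G.p0 (3 * p) h3P
  have hmain := abel_mono (fun n => (φ1 n)⁻¹) (fun n => u n * ((vM n : ℂ) * e (ph φ ξ m n))) P Q hPQ
    (A * (2 * π * m * φ1 p)) ((φ1 (3 * p))⁻¹) (by positivity) (by positivity)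
    (fun n hn hnQ => hinner n hn.le hnQ)
    (by
      intro n hn hnQ
      have := G.p0 n (hny n hn.le); positivity)
    (by
      intro n hn hnQ
      refine inv_anti₀ hφ3P (G.anti (hny n hn.le) ?_)
      have : (n : ℝ) ≤ (3 * P : ℕ) := by exact_mod_cast hnQ.trans hQ
      push_cast at this; exact this)
    (by
      intro n hn hnQ
      refine inv_anti₀ (G.p0 _ (hny _ (by omega))) (G.anti (hny n hn.le) ?_)
      push_cast; linarith)
  have hrew : ∑ n ∈ Finset.Ioc P Q, (((φ1 n)⁻¹ : ℝ) : ℂ) * ((vM n : ℂ) * (e (ξ * n) * (e (m * -φ ((n : ℝ) + 1)) - e (m * -φ n))))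
      = ∑ n ∈ Finset.Ioc P Q, (((φ1 n)⁻¹ : ℝ) : ℂ) * (u n * ((vM n : ℂ) * e (ph φ ξ m n))) := by
    refine Finset.sum_congr rfl fun n _ => ?_
    congr 1
    have h1 : e (m * -φ ((n : ℝ) + 1)) = e (-(m * Δ n)) * e (m * -φ n) := by
      rw [← e_add]; congr 1; simp only [hΔ]; ring
    have h2 : e (ph φ ξ m n) = e (ξ * n) * e (m * -φ n) := by
      rw [← e_add]; congr 1; simp only [ph]; ring
    rw [h1, h2]; simp only [hu]; ring
  rw [hrew]
  refine hmain.trans ?_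
  have e1 : φ1 p ≤ p ^ (γ - 1 + ε) := (hy1 p hPy1).2
  have e2 : (φ1 (3 * p))⁻¹ ≤ 3 * p ^ (1 - γ + ε) := by
    have := (hy1 (3 * p) (by linarith)).1
    have h3 : (φ1 (3 * p))⁻¹ ≤ ((3 * p) ^ (γ - 1 - ε))⁻¹ := inv_anti₀ (by positivity) this
    refine h3.trans ?_
    rw [← Real.rpow_neg (by positivity), show -(γ - 1 - ε) = 1 - γ + ε by ring,
      Real.mul_rpow (by norm_num) (by positivity)]
    refine mul_le_mul_of_nonneg_right ?_ (by positivity)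
    calc (3 : ℝ) ^ (1 - γ + ε) ≤ 3 ^ (1 : ℝ) := Real.rpow_le_rpow_of_exponent_le (by norm_num) (by linarith)
      _ = 3 := by norm_num
  have e3 : φ1 p * (φ1 (3 * p))⁻¹ ≤ 3 * p ^ (2 * ε) := by
    calc φ1 p * (φ1 (3 * p))⁻¹ ≤ p ^ (γ - 1 + ε) * (3 * p ^ (1 - γ + ε)) :=
          mul_le_mul e1 e2 (by positivity) (by positivity)
      _ = 3 * (p ^ (γ - 1 + ε) * p ^ (1 - γ + ε)) := by ring
      _ ≤ 3 * p ^ (2 * ε) := mul_le_mul_of_nonneg_left (rpow_mul_le hP1 (by linarith)) (by norm_num)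
  have e4 : p ^ (γ - 2 * χ - 17 * ε) * p ^ (2 * ε) ≤ p ^ (γ - 2 * χ - 15 * ε) := rpow_mul_le hP1 (by linarith)
  calc A * (2 * π * m * φ1 p) * (2 * (φ1 (3 * p))⁻¹)
      = 4 * π * m * C * Sq * p ^ (γ - 2 * χ - 17 * ε) * (φ1 p * (φ1 (3 * p))⁻¹) := by rw [hA]; ring
    _ ≤ 4 * π * m * C * Sq * p ^ (γ - 2 * χ - 17 * ε) * (3 * p ^ (2 * ε)) :=
        mul_le_mul_of_nonneg_left e3 (by positivity)
    _ = 12 * π * m * C * Sq * (p ^ (γ - 2 * χ - 17 * ε) * p ^ (2 * ε)) := by ring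
    _ ≤ 12 * π * m * C * Sq * p ^ (γ - 2 * χ - 15 * ε) := mul_le_mul_of_nonneg_left e4 (by positivity)
    _ ≤ C * 24 * π * p ^ (γ - 2 * χ - 15 * ε) * (m * Sq) := by
        have : 0 ≤ C * π * p ^ (γ - 2 * χ - 15 * ε) * (m * Sq) := by positivity
        nlinarith

/-- Version for nonzero integers. -/
lemma D_bound_int {φ φ1 : ℝ → ℝ} {P Q : ℕ} {K M : ℝ}
    (H : ∀ ξ m : ℝ, 1 ≤ m →
      ‖∑ n ∈ Finset.Ioc P Q, (((φ1 n)⁻¹ : ℝ) : ℂ) * ((vM n : ℂ) * (e (ξ * n) * (e (m * -φ ((n : ℝ) + 1)) - e (m * -φ n))))‖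
        ≤ K * (m * √(1 + m / M))) (ξ : ℝ) (m : ℤ) (hm : m ≠ 0) :
      ‖∑ n ∈ Finset.Ioc P Q, (((φ1 n)⁻¹ : ℝ) : ℂ) * ((vM n : ℂ) * (e (ξ * n) * (e (m * -φ ((n : ℝ) + 1)) - e (m * -φ n))))‖
        ≤ K * (|(m : ℝ)| * √(1 + |(m : ℝ)| / M)) := by
  rcases lt_or_gt_of_ne hm with h | h
  · have h1 : (1 : ℝ) ≤ -(m : ℝ) := by
      have : m ≤ -1 := by omega
      have : (m : ℝ) ≤ -1 := by exact_mod_cast this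
      linarith
    have := H (-ξ) (-(m : ℝ)) h1
    rw [abs_of_neg (by linarith : (m : ℝ) < 0)]
    refine le_trans (le_of_eq ?_) this
    rw [← Complex.norm_conj, map_sum]
    congr 1
    refine Finset.sum_congr rfl fun n _ => ?_
    simp only [map_mul, map_sub, Complex.conj_ofReal, ← e_neg]
    congr 4 <;> congr 1 <;> ring
  · have h1 : (1 : ℝ) ≤ (m : ℝ) := by exact_mod_cast (by omega : (1:ℤ) ≤ m)
    rw [abs_of_pos (by linarith : (0 : ℝ) < m)]
    exact H ξ m h1

lemma four_sum (ε : ℝ) (hε : 0 < ε) (hε2 : ε ≤ 1 / 2) : ∃ C > 0, ∀ (M : ℝ), 1 ≤ M → ∀ (c : ℤ → ℂ) (g : ℝ → ℝ), c 0 = 0 →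
    (∀ n : ℤ, n ≠ 0 → ‖c n‖ ≤ 1 / |(n : ℝ)| ∧ ‖c n‖ ≤ 1 / ((1 / M) ^ 2 * |(n : ℝ)| ^ 3)) →
    (∀ t, HasSum (fun n : ℤ => c n * e (n * t)) (g t : ℂ)) →
    ∀ (S : Finset ℕ) (w : ℕ → ℂ) (x y : ℕ → ℝ) (K : ℝ), 0 ≤ K →
    (∀ m : ℤ, m ≠ 0 → ‖∑ n ∈ S, w n * (e (m * y n) - e (m * x n))‖ ≤ K * (|(m : ℝ)| * √(1 + |(m : ℝ)| / M))) →
    ‖∑ n ∈ S, w n * ((g (y n) : ℂ) - (g (x n) : ℂ))‖ ≤ C * K * M ^ (1 + ε) := by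
  have hsum := Real.summable_abs_int_rpow (b := 1 + ε) (by linarith)
  refine ⟨2 * ∑' n : ℤ, |(n : ℝ)| ^ (-(1 + ε)) + 1, ?_, ?_⟩
  · have : 0 ≤ ∑' n : ℤ, |(n : ℝ)| ^ (-(1 + ε)) := tsum_nonneg fun n => by positivity
    linarith
  intro M hM c g hc0 hc hg S w x y K hK hD
  have h1 : HasSum (fun m : ℤ => c m * ∑ n ∈ S, w n * (e (m * y n) - e (m * x n)))
      (∑ n ∈ S, w n * ((g (y n) : ℂ) - (g (x n) : ℂ))) := by
    have : HasSum (fun m : ℤ => ∑ n ∈ S, w n * (c m * e (m * y n) - c m * e (m * x n)))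
      (∑ n ∈ S, w n * ((g (y n) : ℂ) - (g (x n) : ℂ))) :=
      hasSum_sum fun n _ => ((hg (y n)).sub (hg (x n))).mul_left (w n)
    refine this.congr_fun fun m => ?_
    rw [Finset.mul_sum]
    refine Finset.sum_congr rfl fun n _ => ?_
    ring
  have hM0 : 0 < M := by linarith
  have hsum2 : HasSum (fun n : ℤ => (2 * K * M ^ (1 + ε)) * |(n : ℝ)| ^ (-(1 + ε)))
      ((2 * K * M ^ (1 + ε)) * ∑' n : ℤ, |(n : ℝ)| ^ (-(1 + ε))) := hsum.hasSum.mul_left _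
  have h2 := HasSum.norm_le_of_bounded h1 hsum2 ?_
  · refine h2.trans ?_
    have : 0 ≤ K * M ^ (1 + ε) := by positivity
    nlinarith
  · intro m
    by_cases hm : m = 0
    · subst hm
      rw [hc0, zero_mul, norm_zero]
      positivity
    · have hm0 : 0 < |(m : ℝ)| := abs_pos.2 (by exact_mod_cast hm)
      obtain ⟨c1, c2⟩ := hc m hm
      have hd := hD m hm
      set z := |(m : ℝ)| with hz
      rw [norm_mul]
      have key : ‖c m‖ * z * √(1 + z / M) ≤ 2 * (M / z) ^ (1 + ε) := by
        by_cases hzM : z ≤ M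
        · have k1 : ‖c m‖ * z ≤ 1 := by
            calc ‖c m‖ * z ≤ 1 / z * z := by gcongr
              _ = 1 := by field_simp
          have k2 : √(1 + z / M) ≤ 2 := by
            rw [Real.sqrt_le_left (by norm_num)]
            have : z / M ≤ 1 := (div_le_one hM0).2 hzM
            linarith
          have k3 : 1 ≤ (M / z) ^ (1 + ε) := Real.one_le_rpow ((one_le_div hm0).2 hzM) (by linarith)
          calc ‖c m‖ * z * √(1 + z / M) ≤ 1 * 2 := by gcongr
            _ ≤ _ := by linarith
        · push Not at hzM
          have k1 : ‖c m‖ * z ≤ (M / z) ^ 2 := by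
            calc ‖c m‖ * z ≤ 1 / ((1 / M) ^ 2 * z ^ 3) * z := by gcongr
              _ = (M / z) ^ 2 := by field_simp
          have hzM1 : 1 ≤ z / M := (one_le_div hM0).2 hzM.le
          have k2 : √(1 + z / M) ≤ 2 * √(z / M) := by
            rw [Real.sqrt_le_left (by positivity), mul_pow, Real.sq_sqrt (by positivity)]
            linarith
          have k3 : (M / z) ^ 2 * √(z / M) = (z / M) ^ (-(3 / 2) : ℝ) := by
            rw [Real.sqrt_eq_rpow, show M / z = (z / M)⁻¹ by rw [inv_div], inv_pow, ← Real.rpow_natCast,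
              ← Real.rpow_neg (by positivity), ← Real.rpow_add (by positivity)]
            norm_num
          have k4 : (M / z) ^ (1 + ε) = (z / M) ^ (-(1 + ε)) := by
            rw [show M / z = (z / M)⁻¹ by rw [inv_div], Real.inv_rpow (by positivity), Real.rpow_neg (by positivity)]
          calc ‖c m‖ * z * √(1 + z / M) ≤ (M / z) ^ 2 * (2 * √(z / M)) := by gcongr
            _ = 2 * ((M / z) ^ 2 * √(z / M)) := by ring
            _ = 2 * (z / M) ^ (-(3 / 2) : ℝ) := by rw [k3]
            _ ≤ 2 * (z / M) ^ (-(1 + ε)) := by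
                refine mul_le_mul_of_nonneg_left ?_ (by norm_num)
                exact Real.rpow_le_rpow_of_exponent_le hzM1 (by linarith)
            _ = _ := by rw [k4]
      calc ‖c m‖ * ‖∑ n ∈ S, w n * (e (m * y n) - e (m * x n))‖ ≤ ‖c m‖ * (K * (z * √(1 + z / M))) := by gcongr
        _ = K * (‖c m‖ * z * √(1 + z / M)) := by ring
        _ ≤ K * (2 * (M / z) ^ (1 + ε)) := by gcongr
        _ = _ := by
            rw [Real.div_rpow hM0.le hm0.le, Real.rpow_neg hm0.le]
            field_simp

/-- distance to the nearest integer at most `d` -/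
def near (d t : ℝ) : Prop := Int.fract t < d ∨ 1 - d ≤ Int.fract t

lemma near_sum_lower (d t : ℝ) (J : ℕ) (hd : 2 * π * (J * d) ≤ 1 / 2) (h : near d t) :
    (J : ℝ) / 2 ≤ ‖∑ j ∈ Finset.range J, e (j * t)‖ := by
  obtain ⟨s, k, hs, hst⟩ : ∃ (s : ℝ) (k : ℤ), |s| ≤ d ∧ t = s + k := by
    have h0 := Int.fract_nonneg t
    have h1 := Int.fract_lt_one t
    rcases h with h | h
    · exact ⟨Int.fract t, ⌊t⌋, by rw [abs_of_nonneg h0]; exact h.le, (Int.fract_add_floor t).symm⟩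
    · refine ⟨Int.fract t - 1, ⌊t⌋ + 1, ?_, ?_⟩
      · rw [abs_of_nonpos (by linarith)]; linarith
      · have := Int.fract_add_floor t
        push_cast; linarith
  have hdd : 0 ≤ d := le_trans (abs_nonneg _) hs
  have h1 : ∀ j ∈ Finset.range J, ‖e (j * t) - 1‖ ≤ 1 / 2 := by
    intro j hj
    have hj' : (j : ℝ) ≤ J := by exact_mod_cast (Finset.mem_range.1 hj).le
    have : e (j * t) = e (j * s) := by
      rw [hst, mul_add]
      have := e_add_int (j * s) (j * k)
      push_cast at this; exact this
    rw [this]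
    refine (norm_e_sub_one_le _).trans (le_trans ?_ hd)
    rw [abs_mul, Nat.abs_cast]
    have hπ := Real.pi_pos
    gcongr
  have h2 : ‖∑ j ∈ Finset.range J, (e (j * t) - 1)‖ ≤ J / 2 := by
    refine (norm_sum_le_of_le _ h1).trans (le_of_eq ?_)
    simp; ring
  rw [Finset.sum_sub_distrib] at h2
  simp only [Finset.sum_const, Finset.card_range, nsmul_eq_mul, mul_one] at h2
  have h3 : ‖(J : ℂ)‖ ≤ ‖∑ j ∈ Finset.range J, e (j * t)‖ + ‖∑ j ∈ Finset.range J, e (j * t) - J‖ := by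
    have := norm_sub_le (∑ j ∈ Finset.range J, e (j * t)) (∑ j ∈ Finset.range J, e (j * t) - J)
    simpa using this
  rw [Complex.norm_natCast] at h3
  linarith

lemma count_bound (S : Finset ℕ) (x : ℕ → ℝ) (J : ℕ) (hJ : 1 ≤ J) (d E : ℝ) (hE : 0 ≤ E)
    (hd : 2 * π * (J * d) ≤ 1 / 2)
    (H : ∀ m : ℕ, 1 ≤ m → m < J → ‖∑ n ∈ S, e (m * x n)‖ ≤ E) :
    ((S.filter fun n => near d (x n)).card : ℝ) ≤ 4 * (S.card / J + E) := by
  have hJ0 : (0 : ℝ) < J := by exact_mod_cast hJ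
  set T : ℕ → ℂ := fun n => ∑ j ∈ Finset.range J, e (j * x n) with hT
  have h1 : ((S.filter fun n => near d (x n)).card : ℝ) * (J / 2) ^ 2 ≤ ∑ n ∈ S, ‖T n‖ ^ 2 := by
    calc ((S.filter fun n => near d (x n)).card : ℝ) * (J / 2) ^ 2
        = ∑ n ∈ S.filter fun n => near d (x n), ((J : ℝ) / 2) ^ 2 := by simp
      _ ≤ ∑ n ∈ S.filter fun n => near d (x n), ‖T n‖ ^ 2 := by
          refine Finset.sum_le_sum fun n hn => ?_
          have := near_sum_lower d (x n) J hd (Finset.mem_filter.1 hn).2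
          gcongr
      _ ≤ _ := Finset.sum_le_sum_of_subset_of_nonneg (Finset.filter_subset _ _) fun _ _ _ => by positivity
  have h2 : ((∑ n ∈ S, ‖T n‖ ^ 2 : ℝ) : ℂ) = ∑ j ∈ Finset.range J, ∑ k ∈ Finset.range J, ∑ n ∈ S, e (((j : ℝ) - k) * x n) := by
    rw [Complex.ofReal_sum]
    calc ∑ n ∈ S, ((‖T n‖ ^ 2 : ℝ) : ℂ) = ∑ n ∈ S, ∑ j ∈ Finset.range J, ∑ k ∈ Finset.range J, e (((j : ℝ) - k) * x n) := by
          refine Finset.sum_congr rfl fun n _ => ?_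
          rw [Complex.ofReal_pow, ← Complex.mul_conj', hT]
          simp only [map_sum]
          rw [Finset.sum_mul_sum]
          refine Finset.sum_congr rfl fun j _ => Finset.sum_congr rfl fun k _ => ?_
          rw [sub_mul, e_sub]
      _ = _ := by
          rw [Finset.sum_comm]
          refine Finset.sum_congr rfl fun j _ => ?_
          rw [Finset.sum_comm]
  have h3 : ∑ n ∈ S, ‖T n‖ ^ 2 ≤ ∑ j ∈ Finset.range J, ∑ k ∈ Finset.range J, ((if j = k then (S.card : ℝ) else 0) + E) := by
    have : ∑ n ∈ S, ‖T n‖ ^ 2 = ‖((∑ n ∈ S, ‖T n‖ ^ 2 : ℝ) : ℂ)‖ := by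
      rw [Complex.norm_real, Real.norm_of_nonneg]
      exact Finset.sum_nonneg fun _ _ => by positivity
    rw [this, h2]
    refine norm_sum_le_of_le _ fun j hj => norm_sum_le_of_le _ fun k hk => ?_
    rw [Finset.mem_range] at hj hk
    rcases lt_trichotomy j k with hjk | hjk | hjk
    · rw [if_neg hjk.ne, zero_add]
      refine le_trans (le_of_eq ?_) (H (k - j) (by omega) (by omega))
      rw [← Complex.norm_conj, map_sum]
      congr 1
      refine Finset.sum_congr rfl fun n _ => ?_
      rw [← e_neg]
      congr 1
      push_cast [Nat.cast_sub hjk.le]; ring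
    · subst hjk
      rw [if_pos rfl]
      have := norm_sum_e_le_card S (fun n => ((j : ℝ) - j) * x n)
      linarith
    · rw [if_neg hjk.ne', zero_add]
      refine le_trans (le_of_eq ?_) (H (j - k) (by omega) (by omega))
      congr 1
      refine Finset.sum_congr rfl fun n _ => ?_
      congr 1
      push_cast [Nat.cast_sub hjk.le]; ring
  have h4 : ∑ j ∈ Finset.range J, ∑ k ∈ Finset.range J, ((if j = k then (S.card : ℝ) else 0) + E) ≤ J * S.card + J ^ 2 * E := by
    refine le_of_eq ?_
    simp only [Finset.sum_add_distrib, Finset.sum_ite_eq, Finset.sum_const, Finset.card_range, nsmul_eq_mul]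
    rw [Finset.sum_congr rfl (g := fun _ => (S.card : ℝ)) (fun j hj => by rw [if_pos hj])]
    simp; ring
  have h5 := (h1.trans h3).trans h4
  generalize ((S.filter fun n => near d (x n)).card : ℝ) = X at h5 ⊢
  have h6 : X = X * (J / 2) ^ 2 * (4 / J ^ 2) := by
    field_simp
    norm_num
  rw [h6]
  generalize (S.card : ℝ) = Y at h5 ⊢
  calc _ ≤ (J * Y + J ^ 2 * E) * (4 / J ^ 2) := by gcongr
    _ = _ := by field_simp

lemma near_count {φ φ1 B B1 : ℝ → ℝ} {P : ℕ} {β : ℝ} (L : Loc φ φ1 B B1 P β) (R : ℕ) (hPR : P ≤ R) (hR : R ≤ 3 * P)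
    (M : ℝ) (hM : 32 ≤ M) :
    (((Finset.Ioc P R).filter fun n : ℕ => near (1 / M) (-φ n)).card : ℝ) ≤ 72000 * (P / M + √(M * β) + P / √β) := by
  have hβ := L.hβ
  have hP1 : (1 : ℝ) ≤ P := L.hP
  have hM0 : 0 < M := by linarith
  set J := ⌊M / 16⌋₊ with hJ
  have hJle : (J : ℝ) ≤ M / 16 := Nat.floor_le (by positivity)
  have hJge : M / 32 ≤ J := by
    have := Nat.lt_floor_add_one (M / 16)
    rw [← hJ] at this; linarith
  have hJ1 : 1 ≤ J := Nat.le_floor (by norm_num; linarith)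
  have hb := count_bound (Finset.Ioc P R) (fun n => -φ n) J hJ1 (1 / M) (18000 * (√(M * β) + P / √β)) (by positivity) ?_ ?_
  · refine hb.trans ?_
    have h1 : ((Finset.Ioc P R).card : ℝ) ≤ 2 * P := by
      rw [Nat.card_Ioc, Nat.cast_sub hPR]
      have : (R : ℝ) ≤ 3 * P := by exact_mod_cast hR
      linarith
    have h2 : ((Finset.Ioc P R).card : ℝ) / J ≤ 2 * P / (M / 32) := by gcongr
    have h3 : 2 * P / (M / 32) = 64 * (P / M) := by field_simp; norm_num
    have : 0 ≤ P / M := by positivity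
    linarith
  · have h1 : (J : ℝ) * (1 / M) ≤ 1 / 16 := by
      rw [mul_one_div, div_le_iff₀ hM0]; linarith
    have := Real.pi_lt_four
    nlinarith [Real.pi_pos]
  · intro m hm1 hmJ
    have hm1' : (1 : ℝ) ≤ m := by exact_mod_cast hm1
    have hmM : (m : ℝ) ≤ M := by
      have : (m : ℝ) ≤ J := by exact_mod_cast hmJ.le
      linarith
    have hP1' : 1 ≤ P := by exact_mod_cast hP1
    have := typeI_inner L 0 m (by linarith) 1 le_rfl hP1' R hPR hR
    simp only [Nat.div_one, one_mul, ph, zero_mul, zero_sub, Nat.cast_one] at this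
    simp only [mul_neg]
    refine this.trans ?_
    have h1 : √(m * β) ≤ √(M * β) := Real.sqrt_le_sqrt (by gcongr)
    have h2 : √β ≤ √(m * β) := Real.sqrt_le_sqrt (by nlinarith)
    have h3 : 0 < √β := Real.sqrt_pos.2 hβ
    gcongr

lemma err_bound {φ φ1 B B1 : ℝ → ℝ} {γ y0 : ℝ} (G : Good φ φ1 B B1 γ y0) (χ ε : ℝ) (hχ : 0 < χ) (hε : 0 < ε)
    (hγ : γ ≤ 1) (hcond : 16 * (1 - γ) + 28 * χ + 1000 * ε ≤ 1) :
    ∃ C > 0, ∃ P0 : ℕ, ∀ P : ℕ, P0 ≤ P → ∀ Q : ℕ, P ≤ Q → Q ≤ 3 * P → 32 ≤ (P : ℝ) ^ (1 - γ + χ + 3 * ε) ∧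
      ∑ n ∈ Finset.Ioc P Q, (φ1 n)⁻¹ * vM n * ((if near (1 / (P : ℝ) ^ (1 - γ + χ + 3 * ε)) (-φ ((n : ℝ) + 1)) then 1 else 0)
        + (if near (1 / (P : ℝ) ^ (1 - γ + χ + 3 * ε)) (-φ n) then 1 else 0)) ≤ C * (P : ℝ) ^ (1 - χ - ε) := by
  obtain ⟨y1, hy1⟩ := G.pgr ε hε
  obtain ⟨y2, hy2⟩ := G.Bgr ε hε
  refine ⟨(9 / ε) * (2 * (72000 * 3) + 1), by positivity, max ⌈y0⌉₊ (max ⌈y1⌉₊ (max ⌈y2⌉₊ ⌈(32 : ℝ) ^ (1 / χ)⌉₊)), ?_⟩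
  intro P hP Q hPQ hQ
  simp only [max_le_iff, Nat.ceil_le] at hP
  obtain ⟨hPy0, hPy1, hPy2, hP32⟩ := hP
  have hP1 : (1 : ℝ) ≤ P := le_trans G.hy0 hPy0
  have hL := G.loc P hPy0
  have hQ' : (Q : ℝ) ≤ 3 * P := by exact_mod_cast hQ
  have hp0 : (0 : ℝ) < P := by linarith
  have hlogQ : ∀ n : ℕ, n ∈ Finset.Ioc P Q → Real.log n ≤ 3 / ε * (P : ℝ) ^ ε := by
    intro n hn
    rw [Finset.mem_Ioc] at hn
    have hn3 : (n : ℝ) ≤ 3 * P := le_trans (by exact_mod_cast hn.2) hQ'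
    have hn0 : (0 : ℝ) < n := by exact_mod_cast (by omega : 0 < n)
    calc Real.log n ≤ Real.log (3 * P) := Real.log_le_log hn0 hn3
      _ ≤ (3 * P : ℝ) ^ ε / ε := Real.log_le_rpow_div (by positivity) hε
      _ = 3 ^ ε * (P : ℝ) ^ ε / ε := by rw [Real.mul_rpow (by norm_num) hp0.le]
      _ ≤ 3 ^ (1 : ℝ) * (P : ℝ) ^ ε / ε := by
          have : (3 : ℝ) ^ ε ≤ 3 ^ (1 : ℝ) := Real.rpow_le_rpow_of_exponent_le (by norm_num) (by linarith)
          gcongr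
      _ = _ := by rw [Real.rpow_one]; ring
  set p : ℝ := (P : ℝ) with hp
  set M := p ^ (1 - γ + χ + 3 * ε) with hM
  have hM32 : 32 ≤ M := by
    calc (32 : ℝ) = ((32 : ℝ) ^ (1 / χ)) ^ χ := by
          rw [← Real.rpow_mul (by norm_num), one_div_mul_cancel hχ.ne', Real.rpow_one]
      _ ≤ p ^ χ := Real.rpow_le_rpow (by positivity) hP32 hχ.le
      _ ≤ M := Real.rpow_le_rpow_of_exponent_le hP1 (by linarith)
  refine ⟨hM32, ?_⟩
  have hny : ∀ n : ℕ, P ≤ n → y0 ≤ (n : ℝ) := fun n hn => le_trans hPy0 (by rw [hp]; exact_mod_cast hn)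
  have hφ3P := G.p0 (3 * p) (by linarith)
  have e2 : (φ1 (3 * p))⁻¹ ≤ 3 * p ^ (1 - γ + ε) := by
    have := (hy1 (3 * p) (by linarith)).1
    have h3 : (φ1 (3 * p))⁻¹ ≤ ((3 * p) ^ (γ - 1 - ε))⁻¹ := inv_anti₀ (by positivity) this
    refine h3.trans ?_
    rw [← Real.rpow_neg (by positivity), show -(γ - 1 - ε) = 1 - γ + ε by ring,
      Real.mul_rpow (by norm_num) (by positivity)]
    refine mul_le_mul_of_nonneg_right ?_ (by positivity)
    calc (3 : ℝ) ^ (1 - γ + ε) ≤ 3 ^ (1 : ℝ) := Real.rpow_le_rpow_of_exponent_le (by norm_num) (by linarith)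
      _ = 3 := by norm_num
  set X := p / M + √(M * B p) + p / √(B p) with hX
  have hcount := near_count hL Q hPQ hQ M hM32
  rw [← hp, ← hX] at hcount
  have hcount2 : (((Finset.Ioc P Q).filter fun n : ℕ => near (1 / M) (-φ ((n : ℝ) + 1))).card : ℝ) ≤ 72000 * X + 1 := by
    have : ((Finset.Ioc P Q).filter fun n : ℕ => near (1 / M) (-φ ((n : ℝ) + 1))).card ≤
        (insert (Q+1) ((Finset.Ioc P Q).filter fun n : ℕ => near (1 / M) (-φ n))).card := by
      refine Finset.card_le_card_of_injOn (fun n => n + 1) ?_ ?_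
      · intro n hn
        simp only [Finset.coe_filter, Finset.mem_Ioc, Set.mem_ofPred_eq] at hn
        simp only [Finset.coe_insert, Finset.coe_filter, Finset.mem_Ioc]
        rcases eq_or_lt_of_le hn.1.2 with h | h
        · left; omega
        · right
          refine ⟨⟨by omega, by omega⟩, ?_⟩
          push_cast; exact hn.2
      · intro a _ b _ hab
        simpa using hab
    have h2 := this.trans (Finset.card_insert_le _ _)
    have h3 : (((Finset.Ioc P Q).filter fun n : ℕ => near (1 / M) (-φ ((n : ℝ) + 1))).card : ℝ) ≤
      (((Finset.Ioc P Q).filter fun n : ℕ => near (1 / M) (-φ n)).card : ℝ) + 1 := by exact_mod_cast h2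
    linarith
  have hterm : ∀ n ∈ Finset.Ioc P Q, (φ1 n)⁻¹ * vM n ≤ 9 / ε * p ^ (1 - γ + 2 * ε) := by
    intro n hn
    have hn' := Finset.mem_Ioc.1 hn
    have h1 : (φ1 n)⁻¹ ≤ 3 * p ^ (1 - γ + ε) := by
      refine le_trans (inv_anti₀ hφ3P (G.anti (hny n hn'.1.le) ?_)) e2
      exact le_trans (by exact_mod_cast hn'.2) hQ'
    have h2 : vM n ≤ 3 / ε * p ^ ε := (ArithmeticFunction.vonMangoldt_le_log).trans (hlogQ n hn)
    calc (φ1 n)⁻¹ * vM n ≤ (3 * p ^ (1 - γ + ε)) * (3 / ε * p ^ ε) :=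
          mul_le_mul h1 h2 ArithmeticFunction.vonMangoldt_nonneg (by positivity)
      _ = 9 / ε * (p ^ (1 - γ + ε) * p ^ ε) := by ring
      _ ≤ _ := mul_le_mul_of_nonneg_left (rpow_mul_le hP1 (by linarith)) (by positivity)
  have hBp := G.Bpos p hPy0
  obtain ⟨hB1, hB2⟩ := hy2 p hPy2
  have hsum : ∑ n ∈ Finset.Ioc P Q, (φ1 n)⁻¹ * vM n * ((if near (1 / M) (-φ ((n : ℝ) + 1)) then 1 else 0)
        + (if near (1 / M) (-φ n) then 1 else 0)) ≤ 9 / ε * p ^ (1 - γ + 2 * ε) * (2 * 72000 * X + 1) := by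
    calc _ ≤ ∑ n ∈ Finset.Ioc P Q, 9 / ε * p ^ (1 - γ + 2 * ε) * ((if near (1 / M) (-φ ((n : ℝ) + 1)) then 1 else 0)
        + (if near (1 / M) (-φ n) then 1 else 0)) := by
          refine Finset.sum_le_sum fun n hn => mul_le_mul_of_nonneg_right (hterm n hn) ?_
          split_ifs <;> norm_num
      _ = 9 / ε * p ^ (1 - γ + 2 * ε) * ((((Finset.Ioc P Q).filter fun n : ℕ => near (1 / M) (-φ ((n : ℝ) + 1))).card : ℝ)
           + (((Finset.Ioc P Q).filter fun n : ℕ => near (1 / M) (-φ n)).card : ℝ)) := by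
          rw [← Finset.mul_sum, Finset.sum_add_distrib, Finset.sum_boole, Finset.sum_boole]
      _ ≤ _ := by
          refine mul_le_mul_of_nonneg_left ?_ (by positivity)
          linarith
  refine hsum.trans ?_
  have hsqp : ∀ a : ℝ, √(p ^ a) = p ^ (a / 2) := by
    intro a
    rw [Real.sqrt_eq_rpow, ← Real.rpow_mul hp0.le]; congr 1; ring
  set w := p ^ (1 - γ + 2 * ε) with hw
  set z := p ^ (1 - χ - ε) with hz
  have hw0 : 0 ≤ w := by positivity
  have t1 : w * (p / M) ≤ z := by
    rw [hM, div_eq_mul_inv, ← Real.rpow_neg hp0.le]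
    calc w * (p * p ^ (-(1 - γ + χ + 3 * ε))) = p ^ (1 - γ + 2 * ε) * (p ^ (1 : ℝ) * p ^ (-(1 - γ + χ + 3 * ε))) := by
          rw [Real.rpow_one]
      _ ≤ z := by rw [← Real.rpow_add hp0, ← Real.rpow_add hp0, hz]; exact le_of_eq (by congr 1; ring)
  have t2 : w * √(M * B p) ≤ z := by
    calc w * √(M * B p) ≤ w * √(p ^ (1 - γ + χ + 3 * ε) * p ^ (γ + ε)) := by
          gcongr
      _ = w * p ^ ((1 - γ + χ + 3 * ε + (γ + ε)) / 2) := by rw [← Real.rpow_add hp0, hsqp]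
      _ ≤ z := rpow_mul_le hP1 (by linarith)
  have t3 : w * (p / √(B p)) ≤ z := by
    calc w * (p / √(B p)) ≤ w * (p / √(p ^ (γ - ε))) := by
          gcongr
      _ = p ^ (1 - γ + 2 * ε) * (p ^ (1 : ℝ) * p ^ (-((γ - ε) / 2))) := by
          rw [hsqp, Real.rpow_one, Real.rpow_neg hp0.le]; rfl
      _ ≤ p ^ (1 - γ + 2 * ε) * p ^ (1 + -((γ - ε) / 2)) :=
          mul_le_mul_of_nonneg_left (rpow_mul_le hP1 le_rfl) hw0
      _ ≤ z := rpow_mul_le hP1 (by linarith)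
  have t4 : w ≤ z := Real.rpow_le_rpow_of_exponent_le hP1 (by linarith)
  have t5 : w * (2 * 72000 * X + 1) ≤ (2 * (72000 * 3) + 1) * z := by
    rw [hX]; linarith
  calc 9 / ε * w * (2 * 72000 * X + 1) = 9 / ε * (w * (2 * 72000 * X + 1)) := by ring
    _ ≤ 9 / ε * ((2 * (72000 * 3) + 1) * z) := by gcongr
    _ = _ := by ring

lemma saw_block {φ φ1 B B1 : ℝ → ℝ} {γ y0 : ℝ} (G : Good φ φ1 B B1 γ y0) (χ ε : ℝ) (hχ : 0 < χ) (hε : 0 < ε)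
    (hγ : γ ≤ 1) (hcond : 16 * (1 - γ) + 28 * χ + 1000 * ε ≤ 1) :
    ∃ C > 0, ∃ P0 : ℕ, ∀ P : ℕ, P0 ≤ P → ∀ Q : ℕ, P ≤ Q → Q ≤ 3 * P → ∀ ξ : ℝ,
      ‖∑ n ∈ Finset.Ioc P Q, (((φ1 n)⁻¹ : ℝ) : ℂ) * ((vM n : ℂ) * (e (ξ * n) * ((saw (-φ ((n : ℝ) + 1)) : ℂ) - (saw (-φ n) : ℂ))))‖
        ≤ C * (P : ℝ) ^ (1 - χ - ε) := by
  obtain ⟨C1, hC1, P1, H1⟩ := D_bound G χ ε hχ hε hγ hcond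
  obtain ⟨C2, hC2, P2, H2⟩ := err_bound G χ ε hχ hε hγ hcond
  obtain ⟨C3, hC3, H3⟩ := four_sum ε hε (by linarith)
  refine ⟨C3 * C1 + C2, by positivity, max (max P1 P2) ⌈y0⌉₊, ?_⟩
  intro P hP Q hPQ hQ ξ
  simp only [max_le_iff, Nat.ceil_le] at hP
  obtain ⟨⟨hPP1, hPP2⟩, hPy0⟩ := hP
  have hP1 : (1 : ℝ) ≤ P := le_trans G.hy0 hPy0
  obtain ⟨hM32, herr⟩ := H2 P hPP2 Q hPQ hQ
  have hD := fun ξ m hm => H1 P hPP1 Q hPQ hQ ξ m hm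
  have hny : ∀ n : ℕ, P ≤ n → y0 ≤ (n : ℝ) := fun n hn => le_trans hPy0 (by exact_mod_cast hn)
  set p : ℝ := (P : ℝ) with hp
  set M := p ^ (1 - γ + χ + 3 * ε) with hM
  have hM0 : 0 < M := by linarith
  obtain ⟨c, g, hc0, hc, hg, hsaw⟩ := saw_fourier (1 / M) (by positivity) (by
    rw [div_le_div_iff₀ hM0 (by norm_num)]; linarith)
  have hmain := H3 M (by linarith) c g hc0 hc hg (Finset.Ioc P Q)
    (fun n => (((φ1 n)⁻¹ : ℝ) : ℂ) * ((vM n : ℂ) * e (ξ * n))) (fun n => -φ n) (fun n => -φ ((n : ℝ) + 1))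
    (C1 * p ^ (γ - 2 * χ - 15 * ε)) (by positivity) (by
      intro m hm
      have := D_bound_int hD ξ m hm
      refine le_trans (le_of_eq ?_) this
      congr 1
      refine Finset.sum_congr rfl fun n _ => ?_
      ring)
  have hdiff : ‖(∑ n ∈ Finset.Ioc P Q, (((φ1 n)⁻¹ : ℝ) : ℂ) * ((vM n : ℂ) * (e (ξ * n) * ((saw (-φ ((n : ℝ) + 1)) : ℂ) - (saw (-φ n) : ℂ)))))
      - ∑ n ∈ Finset.Ioc P Q, (((φ1 n)⁻¹ : ℝ) : ℂ) * ((vM n : ℂ) * e (ξ * n)) * ((g (-φ ((n : ℝ) + 1)) : ℂ) - (g (-φ n) : ℂ))‖ ≤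
      C2 * p ^ (1 - χ - ε) := by
    refine le_trans ?_ herr
    rw [← Finset.sum_sub_distrib]
    refine norm_sum_le_of_le _ fun n hn => ?_
    have hn' := Finset.mem_Ioc.1 hn
    have hφ := G.p0 n (hny n hn'.1.le)
    have : (((φ1 n)⁻¹ : ℝ) : ℂ) * ((vM n : ℂ) * (e (ξ * n) * ((saw (-φ ((n : ℝ) + 1)) : ℂ) - (saw (-φ n) : ℂ))))
       - (((φ1 n)⁻¹ : ℝ) : ℂ) * ((vM n : ℂ) * e (ξ * n)) * ((g (-φ ((n : ℝ) + 1)) : ℂ) - (g (-φ n) : ℂ))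
       = ((((φ1 n)⁻¹ * vM n) * ((saw (-φ ((n : ℝ) + 1)) - g (-φ ((n : ℝ) + 1))) - (saw (-φ n) - g (-φ n))) : ℝ) : ℂ) * e (ξ * n) := by
      push_cast; ring
    rw [this, norm_mul, norm_e, mul_one, Complex.norm_real, Real.norm_eq_abs, abs_mul,
      abs_of_nonneg (mul_nonneg (inv_nonneg.2 hφ.le) ArithmeticFunction.vonMangoldt_nonneg)]
    refine mul_le_mul_of_nonneg_left ?_ (mul_nonneg (inv_nonneg.2 hφ.le) ArithmeticFunction.vonMangoldt_nonneg)
    refine (abs_sub _ _).trans ?_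
    have hs' : ∀ t, |saw t - g t| ≤ if near (1 / M) t then 1 else 0 := by
      intro t
      refine (hsaw t).trans (le_of_eq ?_)
      by_cases h : near (1 / M) t
      · rw [if_pos h, if_pos (show _ ∨ _ from h)]
      · rw [if_neg h, if_neg (show ¬ (_ ∨ _) from h)]
    exact add_le_add (hs' _) (hs' _)
  have hfin : C3 * (C1 * p ^ (γ - 2 * χ - 15 * ε)) * M ^ (1 + ε) ≤ C3 * C1 * p ^ (1 - χ - ε) := by
    have : M ^ (1 + ε) = p ^ ((1 - γ + χ + 3 * ε) * (1 + ε)) := by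
      rw [hM, ← Real.rpow_mul (by linarith)]
    rw [this]
    calc C3 * (C1 * p ^ (γ - 2 * χ - 15 * ε)) * p ^ ((1 - γ + χ + 3 * ε) * (1 + ε))
        = C3 * C1 * (p ^ (γ - 2 * χ - 15 * ε) * p ^ ((1 - γ + χ + 3 * ε) * (1 + ε))) := by ring
      _ ≤ _ := by
        refine mul_le_mul_of_nonneg_left (rpow_mul_le hP1 ?_) (by positivity)
        nlinarith
  have := norm_sub_norm_le (∑ n ∈ Finset.Ioc P Q, (((φ1 n)⁻¹ : ℝ) : ℂ) * ((vM n : ℂ) * (e (ξ * n) * ((saw (-φ ((n : ℝ) + 1)) : ℂ) - (saw (-φ n) : ℂ)))))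
    (∑ n ∈ Finset.Ioc P Q, (((φ1 n)⁻¹ : ℝ) : ℂ) * ((vM n : ℂ) * e (ξ * n)) * ((g (-φ ((n : ℝ) + 1)) : ℂ) - (g (-φ n) : ℂ)))
  linarith

lemma e_natmul (b : ℕ) (t : ℝ) : e (b * t) = e t ^ b := by
  simp only [e]
  rw [← Complex.exp_nat_mul]; congr 1; push_cast; ring

lemma e_eq_one {t : ℝ} (h : e t = 1) : ∃ k : ℤ, t = k := by
  rw [e, Complex.exp_eq_one_iff] at h
  obtain ⟨k, hk⟩ := h
  refine ⟨k, ?_⟩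
  have hpi : (2 * (π : ℂ) * Complex.I) ≠ 0 := Complex.two_pi_I_ne_zero
  have : (t : ℂ) = (k : ℂ) := by
    apply mul_left_cancel₀ hpi
    rw [hk]; ring
  exact_mod_cast this

lemma orth (q a n : ℕ) (ha : a < q) :
    ∑ b ∈ Finset.range q, e (b * (((n : ℝ) - a) / q)) = if n % q = a then (q : ℂ) else 0 := by
  have hq : (q : ℝ) ≠ 0 := by
    have : 0 < q := by omega
    positivity
  split_ifs with h
  · have : ∀ b ∈ Finset.range q, e (b * (((n : ℝ) - a) / q)) = 1 := by
      intro b _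
      have h1 : (n : ℝ) = q * (n / q : ℕ) + a := by
        have := Nat.div_add_mod n q
        rw [h] at this; exact_mod_cast this.symm
      have h2 : (b : ℝ) * (((n : ℝ) - a) / q) = (((b * (n / q) : ℕ) : ℤ) : ℝ) := by
        rw [h1, Int.cast_natCast, Nat.cast_mul]; field_simp; ring
      rw [h2, e_int]
    rw [Finset.sum_congr rfl this]; simp
  · simp only [e_natmul]
    have hne : e (((n : ℝ) - a) / q) ≠ 1 := by
      intro h1
      obtain ⟨k, hk⟩ := e_eq_one h1
      rw [div_eq_iff hq] at hk
      have h2 : (n : ℤ) - a = k * q := by exact_mod_cast hk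
      apply h
      have h3 : (n : ℤ) % q = a := by
        have : (n : ℤ) = a + k * q := by linarith
        rw [this, Int.add_mul_emod_self_right]
        exact Int.emod_eq_of_lt (by positivity) (by exact_mod_cast ha)
      exact_mod_cast h3
    rw [geom_sum_eq hne, ← e_natmul]
    have : (q : ℝ) * (((n : ℝ) - a) / q) = (((n : ℤ) - a : ℤ) : ℝ) := by push_cast; field_simp
    rw [this, e_int]; simp

lemma residue (w : ℕ → ℂ) (S : Finset ℕ) (E : ℝ) (H : ∀ ξ : ℝ, ‖∑ n ∈ S, w n * e (ξ * n)‖ ≤ E) (q a : ℕ) (ha : a < q) (ξ : ℝ) :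
    ‖∑ n ∈ S, if n % q = a then w n * e (ξ * n) else 0‖ ≤ E := by
  have hq : (0 : ℝ) < q := by
    have : 0 < q := by omega
    positivity
  have h1 : ∑ n ∈ S, (if n % q = a then w n * e (ξ * n) else 0)
      = (1 / q : ℂ) * ∑ b ∈ Finset.range q, e (-(b * a / q)) * ∑ n ∈ S, w n * e ((ξ + b / q) * n) := by
    simp only [Finset.mul_sum]
    rw [Finset.sum_comm]
    refine Finset.sum_congr rfl fun n _ => ?_
    have h2 : ∀ b ∈ Finset.range q, (1 / q : ℂ) * (e (-(b * a / q)) * (w n * e ((ξ + b / q) * n)))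
        = (1 / q : ℂ) * (w n * e (ξ * n)) * e (b * (((n : ℝ) - a) / q)) := by
      intro b _
      have : e ((b : ℝ) * (((n : ℝ) - a) / q)) = e (-(b * a / q)) * e (b / q * n) := by
        rw [← e_add]; congr 1; ring
      rw [this, add_mul, e_add]; ring
    rw [Finset.sum_congr rfl h2, ← Finset.mul_sum, orth q a n ha]
    split_ifs
    · have : (q : ℂ) ≠ 0 := by exact_mod_cast hq.ne'
      field_simp
    · simp
  rw [h1, norm_mul]
  have h3 : ‖∑ b ∈ Finset.range q, e (-(b * a / q)) * ∑ n ∈ S, w n * e ((ξ + b / q) * n)‖ ≤ q * E := by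
    have := norm_sum_le_of_le (f := fun b : ℕ => e (-(b * a / q)) * ∑ n ∈ S, w n * e ((ξ + b / q) * n)) (Finset.range q) (n := fun _ => E) (fun b _ => by
      rw [norm_mul, norm_e, one_mul]; exact H _)
    simpa using this
  calc ‖(1 / q : ℂ)‖ * _ ≤ ‖(1 / q : ℂ)‖ * (q * E) := by gcongr
    _ = E := by
      rw [norm_div, norm_one, Complex.norm_natCast]; field_simp

lemma Good.W {φ φ1 B B1 : ℝ → ℝ} {γ y0 : ℝ} (G : Good φ φ1 B B1 γ y0) (ε : ℝ) (hε : 0 < ε) (hε1 : ε ≤ 1) (hγ : 1 - γ + ε ≤ 1) :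
    ∃ P0 : ℕ, ∀ P : ℕ, P0 ≤ P → y0 ≤ P ∧ φ1 P ≤ (P : ℝ) ^ (γ - 1 + ε) ∧ ∀ n : ℕ, P ≤ n → n ≤ 3 * P →
      (φ1 n)⁻¹ ≤ 3 * (P : ℝ) ^ (1 - γ + ε) ∧ vM n ≤ 3 / ε * (P : ℝ) ^ ε := by
  obtain ⟨y1, hy1⟩ := G.pgr ε hε
  refine ⟨max ⌈y0⌉₊ ⌈y1⌉₊, ?_⟩
  intro P hP
  simp only [max_le_iff, Nat.ceil_le] at hP
  obtain ⟨hPy0, hPy1⟩ := hP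
  have hP1 : (1 : ℝ) ≤ P := le_trans G.hy0 hPy0
  have hp0 : (0 : ℝ) < P := by linarith
  refine ⟨hPy0, (hy1 P hPy1).2, ?_⟩
  intro n hn hn3
  have hn' : (P : ℝ) ≤ n := by exact_mod_cast hn
  have hn3' : (n : ℝ) ≤ 3 * P := by exact_mod_cast hn3
  have key : ∀ a : ℝ, a ≤ 1 → 0 ≤ a → (n : ℝ) ^ a ≤ 3 * (P : ℝ) ^ a := by
    intro a ha ha0
    calc (n : ℝ) ^ a ≤ (3 * P : ℝ) ^ a := Real.rpow_le_rpow (by positivity) hn3' ha0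
      _ = 3 ^ a * (P : ℝ) ^ a := by rw [Real.mul_rpow (by norm_num) hp0.le]
      _ ≤ 3 ^ (1 : ℝ) * (P : ℝ) ^ a := by
          have : (3 : ℝ) ^ a ≤ 3 ^ (1 : ℝ) := Real.rpow_le_rpow_of_exponent_le (by norm_num) ha
          gcongr
      _ = _ := by rw [Real.rpow_one]
  constructor
  · have h1 := (hy1 n (by linarith)).1
    have hn0 : (0 : ℝ) < n := by linarith
    have h2 : (φ1 n)⁻¹ ≤ (n : ℝ) ^ (1 - γ + ε) := by
      refine (inv_anti₀ (by positivity) h1).trans ?_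
      rw [← Real.rpow_neg hn0.le, show -(γ - 1 - ε) = 1 - γ + ε by ring]
    by_cases h0 : 0 ≤ 1 - γ + ε
    · exact h2.trans (key _ hγ h0)
    · push Not at h0
      refine h2.trans ((Real.rpow_le_rpow_of_nonpos hp0 hn' h0.le).trans ?_)
      have : 0 ≤ (P : ℝ) ^ (1 - γ + ε) := by positivity
      linarith
  · have hn0 : (0 : ℝ) < n := by linarith
    calc vM n ≤ Real.log n := ArithmeticFunction.vonMangoldt_le_log
      _ ≤ (n : ℝ) ^ ε / ε := Real.log_le_rpow_div hn0.le hε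
      _ ≤ 3 * (P : ℝ) ^ ε / ε := by have := key ε hε1 hε.le; gcongr
      _ = _ := by ring

lemma block_final {φ φ1 B B1 : ℝ → ℝ} {γ y0 : ℝ} (G : Good φ φ1 B B1 γ y0) (χ ε : ℝ) (hχ : 0 < χ) (hε : 0 < ε)
    (hγ : γ ≤ 1) (hcond : 16 * (1 - γ) + 28 * χ + 1000 * ε ≤ 1) (I : ℕ → Prop)
    (hI : ∀ n : ℕ, y0 ≤ n → (if I n then (1 : ℝ) else 0) = (φ ((n : ℝ) + 1) - φ n) + (saw (-φ ((n : ℝ) + 1)) - saw (-φ n)))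
    (q a : ℕ) (ha : a < q) :
    ∃ C > 0, ∃ P0 : ℕ, ∀ P : ℕ, P0 ≤ P → ∀ Q : ℕ, P ≤ Q → Q ≤ 3 * P → ∀ ξ : ℝ,
      ‖∑ n ∈ Finset.Ioc P Q, ((if (n.Prime ∧ I n) ∧ n % q = a then (((φ1 n)⁻¹ * Real.log n : ℝ) : ℂ) * e (ξ * n) else 0)
         - (if n.Prime ∧ n % q = a then ((Real.log n : ℝ) : ℂ) * e (ξ * n) else 0))‖
        ≤ C * (P : ℝ) ^ (1 - χ - ε) := by
  obtain ⟨C1, hC1, P1, H1⟩ := saw_block G χ ε hχ hε hγ hcond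
  obtain ⟨P2, H2⟩ := G.W ε hε (by linarith) (by linarith)
  obtain ⟨C3, hC3⟩ := Chebyshev.psi_sub_theta_le_mul_sqrt
  refine ⟨C1 + 9 / ε + 4 * (2 * |C3|), by positivity, max P1 P2, ?_⟩
  intro P hP Q hPQ hQ ξ
  simp only [max_le_iff] at hP
  obtain ⟨hPP1, hPP2⟩ := hP
  obtain ⟨hPy0, hφP, hW⟩ := H2 P hPP2
  have hP1 : (1 : ℝ) ≤ P := le_trans G.hy0 hPy0
  have hp0 : (0 : ℝ) < P := by linarith
  have hny : ∀ n : ℕ, P ≤ n → y0 ≤ (n : ℝ) := fun n hn => le_trans hPy0 (by exact_mod_cast hn)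
  set w : ℕ → ℂ := fun n => (((φ1 n)⁻¹ * (if I n then 1 else 0) - 1 : ℝ) : ℂ) * (vM n : ℂ) with hw
  have hA : ∀ ξ : ℝ, ‖∑ n ∈ Finset.Ioc P Q, w n * e (ξ * n)‖ ≤ (C1 + 9 / ε) * (P : ℝ) ^ (1 - χ - ε) := by
    intro ξ
    have h1 := H1 P hPP1 Q hPQ hQ ξ
    have h2 : ∑ n ∈ Finset.Ioc P Q, w n * e (ξ * n) =
      (∑ n ∈ Finset.Ioc P Q, (((φ1 n)⁻¹ : ℝ) : ℂ) * ((vM n : ℂ) * (e (ξ * n) * ((saw (-φ ((n : ℝ) + 1)) : ℂ) - (saw (-φ n) : ℂ)))))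
      + ∑ n ∈ Finset.Ioc P Q, (((φ1 n)⁻¹ * (φ ((n : ℝ) + 1) - φ n) - 1 : ℝ) : ℂ) * (vM n : ℂ) * e (ξ * n) := by
      rw [← Finset.sum_add_distrib]
      refine Finset.sum_congr rfl fun n hn => ?_
      have := hI n (hny n (Finset.mem_Ioc.1 hn).1.le)
      simp only [hw]
      rw [this]; push_cast; ring
    have h3 : ‖∑ n ∈ Finset.Ioc P Q, (((φ1 n)⁻¹ * (φ ((n : ℝ) + 1) - φ n) - 1 : ℝ) : ℂ) * (vM n : ℂ) * e (ξ * n)‖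
        ≤ 9 / ε * (P : ℝ) ^ (1 - χ - ε) := by
      have t1 : ∀ n ∈ Finset.Ioc P Q, ‖(((φ1 n)⁻¹ * (φ ((n : ℝ) + 1) - φ n) - 1 : ℝ) : ℂ) * (vM n : ℂ) * e (ξ * n)‖
          ≤ 9 / ε * (P : ℝ) ^ (1 - γ + 2 * ε) * (φ1 n - φ1 ((n + 1 : ℕ) : ℝ)) := by
        intro n hn
        have hn' := Finset.mem_Ioc.1 hn
        obtain ⟨w1, w2⟩ := hW n hn'.1.le (by omega)
        have hy := hny n hn'.1.le
        obtain ⟨d1, d2⟩ := G.delta hy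
        have hφ := G.p0 n hy
        have v0 : 0 ≤ vM n := ArithmeticFunction.vonMangoldt_nonneg
        rw [norm_mul, norm_e, mul_one, norm_mul, Complex.norm_real, Complex.norm_real, Real.norm_eq_abs, Real.norm_of_nonneg v0]
        have t2 : (φ1 n)⁻¹ * (φ ((n : ℝ) + 1) - φ n) - 1 = -((φ1 n)⁻¹ * (φ1 n - (φ ((n : ℝ) + 1) - φ n))) := by
          field_simp; ring
        rw [t2, abs_neg, abs_of_nonneg (mul_nonneg (by positivity) (by linarith))]
        have t3 : φ1 n - (φ ((n : ℝ) + 1) - φ n) ≤ φ1 n - φ1 ((n + 1 : ℕ) : ℝ) := by push_cast; linarith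
        calc (φ1 n)⁻¹ * (φ1 n - (φ ((n : ℝ) + 1) - φ n)) * vM n
            ≤ 3 * (P : ℝ) ^ (1 - γ + ε) * (φ1 n - φ1 ((n + 1 : ℕ) : ℝ)) * (3 / ε * (P : ℝ) ^ ε) := by
              refine mul_le_mul (mul_le_mul w1 t3 (by linarith) (by positivity)) w2 v0 ?_
              exact mul_nonneg (by positivity) (by linarith)
          _ = 9 / ε * ((P : ℝ) ^ (1 - γ + ε) * (P : ℝ) ^ ε) * (φ1 n - φ1 ((n + 1 : ℕ) : ℝ)) := by ring
          _ ≤ _ := by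
              refine mul_le_mul_of_nonneg_right (mul_le_mul_of_nonneg_left (rpow_mul_le hP1 (by linarith)) (by positivity)) (by linarith)
      refine (norm_sum_le_of_le _ t1).trans ?_
      rw [← Finset.mul_sum]
      have t4 : ∀ R : ℕ, P ≤ R → ∑ n ∈ Finset.Ioc P R, (φ1 n - φ1 ((n + 1 : ℕ) : ℝ)) = φ1 ((P + 1 : ℕ) : ℝ) - φ1 ((R + 1 : ℕ) : ℝ) := by
        intro R hR
        induction R, hR using Nat.le_induction with
        | base => simp
        | succ n hn ih => rw [← Finset.insert_Ioc_right_eq_Ioc_add_one hn, Finset.sum_insert (by simp), ih]; ring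
      rw [t4 Q hPQ]
      have t5 : φ1 ((P + 1 : ℕ) : ℝ) - φ1 ((Q + 1 : ℕ) : ℝ) ≤ (P : ℝ) ^ (γ - 1 + ε) := by
        have := G.p0 _ (hny (Q + 1) (by omega))
        have := G.anti hPy0 (show (P : ℝ) ≤ ((P + 1 : ℕ) : ℝ) by push_cast; linarith)
        linarith
      calc 9 / ε * (P : ℝ) ^ (1 - γ + 2 * ε) * (φ1 ((P + 1 : ℕ) : ℝ) - φ1 ((Q + 1 : ℕ) : ℝ))
          ≤ 9 / ε * (P : ℝ) ^ (1 - γ + 2 * ε) * (P : ℝ) ^ (γ - 1 + ε) := by gcongr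
        _ = 9 / ε * ((P : ℝ) ^ (1 - γ + 2 * ε) * (P : ℝ) ^ (γ - 1 + ε)) := by ring
        _ ≤ _ := mul_le_mul_of_nonneg_left (rpow_mul_le hP1 (by linarith)) (by positivity)
    rw [h2]
    refine (norm_add_le _ _).trans ?_
    linarith
  have hB := residue w (Finset.Ioc P Q) _ hA q a ha ξ
  have hC : ‖∑ n ∈ Finset.Ioc P Q, ((if (n.Prime ∧ I n) ∧ n % q = a then (((φ1 n)⁻¹ * Real.log n : ℝ) : ℂ) * e (ξ * n) else 0)
         - (if n.Prime ∧ n % q = a then ((Real.log n : ℝ) : ℂ) * e (ξ * n) else 0))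
       - ∑ n ∈ Finset.Ioc P Q, (if n % q = a then w n * e (ξ * n) else 0)‖ ≤ 4 * (2 * |C3|) * (P : ℝ) ^ (1 - χ - ε) := by
    rw [← Finset.sum_sub_distrib]
    have t1 : ∀ n ∈ Finset.Ioc P Q, ‖((if (n.Prime ∧ I n) ∧ n % q = a then (((φ1 n)⁻¹ * Real.log n : ℝ) : ℂ) * e (ξ * n) else 0)
         - (if n.Prime ∧ n % q = a then ((Real.log n : ℝ) : ℂ) * e (ξ * n) else 0)) - (if n % q = a then w n * e (ξ * n) else 0)‖ ≤
          4 * (P : ℝ) ^ (1 - γ + ε) * (if ¬ n.Prime then vM n else 0) := by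
      intro n hn
      have hn' := Finset.mem_Ioc.1 hn
      obtain ⟨w1, w2⟩ := hW n hn'.1.le (by omega)
      have hφ := G.p0 n (hny n hn'.1.le)
      have v0 : 0 ≤ vM n := ArithmeticFunction.vonMangoldt_nonneg
      by_cases hpr : n.Prime
      · have hv : vM n = Real.log n := ArithmeticFunction.vonMangoldt_apply_prime hpr
        simp only [hpr, true_and, not_true_eq_false, if_false, mul_zero]
        refine le_of_eq (norm_eq_zero.2 ?_)
        simp only [hw, hv]
        by_cases hq : n % q = a <;> by_cases hIn : I n <;> simp [hq, hIn]
        ring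
      · simp only [hpr, false_and, if_false, not_false_eq_true, if_true, sub_zero, zero_sub, norm_neg]
        have hone : 1 ≤ (P : ℝ) ^ (1 - γ + ε) := Real.one_le_rpow hP1 (by linarith)
        split_ifs
        · rw [norm_mul, norm_e, mul_one]
          simp only [hw]
          rw [norm_mul, Complex.norm_real, Complex.norm_real, Real.norm_eq_abs, Real.norm_of_nonneg v0]
          refine mul_le_mul_of_nonneg_right ?_ v0
          refine (abs_sub _ _).trans ?_
          rw [abs_one, abs_mul, abs_of_nonneg (inv_nonneg.2 hφ.le)]
          have : |(if I n then (1 : ℝ) else 0)| ≤ 1 := by split_ifs <;> simp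
          nlinarith [inv_nonneg.2 hφ.le]
        · rw [norm_zero]; positivity
    refine (norm_sum_le_of_le _ t1).trans ?_
    rw [← Finset.mul_sum]
    have t2 : ∑ n ∈ Finset.Ioc P Q, (if ¬ n.Prime then vM n else 0) ≤ 2 * |C3| * (P : ℝ) ^ (1 / 2 : ℝ) := by
      have s1 := Chebyshev.psi_sub_theta_eq_sum_not_prime (Q : ℝ)
      rw [Nat.floor_natCast, Finset.sum_filter] at s1
      calc ∑ n ∈ Finset.Ioc P Q, (if ¬ n.Prime then vM n else 0) ≤ ∑ n ∈ Finset.Ioc 0 Q, (if ¬ n.Prime then vM n else 0) := by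
            refine Finset.sum_le_sum_of_subset_of_nonneg (Finset.Ioc_subset_Ioc_left (by omega)) fun n _ _ => ?_
            split_ifs
            · exact le_rfl
            · exact ArithmeticFunction.vonMangoldt_nonneg
        _ = Chebyshev.psi Q - Chebyshev.theta Q := by
            rw [s1]
        _ ≤ C3 * √Q := hC3 Q
        _ ≤ |C3| * √(2 ^ 2 * P) := by
            have : (Q : ℝ) ≤ 2 ^ 2 * P := by
              have : (Q : ℝ) ≤ 3 * P := by exact_mod_cast hQ
              linarith
            gcongr
            exact le_abs_self _
        _ = _ := by
            rw [Real.sqrt_mul (by norm_num), Real.sqrt_sq (by norm_num), Real.sqrt_eq_rpow]; ring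
    calc 4 * (P : ℝ) ^ (1 - γ + ε) * ∑ n ∈ Finset.Ioc P Q, (if ¬ n.Prime then vM n else 0)
        ≤ 4 * (P : ℝ) ^ (1 - γ + ε) * (2 * |C3| * (P : ℝ) ^ (1 / 2 : ℝ)) := by gcongr
      _ = 4 * (2 * |C3|) * ((P : ℝ) ^ (1 - γ + ε) * (P : ℝ) ^ (1 / 2 : ℝ)) := by ring
      _ ≤ _ := mul_le_mul_of_nonneg_left (rpow_mul_le hP1 (by linarith)) (by positivity)
  have := norm_sub_norm_le (∑ n ∈ Finset.Ioc P Q, ((if (n.Prime ∧ I n) ∧ n % q = a then (((φ1 n)⁻¹ * Real.log n : ℝ) : ℂ) * e (ξ * n) else 0)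
         - (if n.Prime ∧ n % q = a then ((Real.log n : ℝ) : ℂ) * e (ξ * n) else 0)))
       (∑ n ∈ Finset.Ioc P Q, (if n % q = a then w n * e (ξ * n) else 0))
  linarith

lemma dyadic (θ C1 K : ℝ) (hθ : 0 < θ) (hC1 : 0 ≤ C1) (P0 : ℕ) (f : ℕ → ℂ)
    (hb : ∀ P : ℕ, P0 ≤ P → ∀ Q : ℕ, P ≤ Q → Q ≤ 3 * P → ‖∑ n ∈ Finset.Ioc P Q, f n‖ ≤ C1 * (P : ℝ) ^ θ)
    (hK : ∑ n ∈ Finset.Ioc 0 (2 * P0 + 2), ‖f n‖ ≤ K) (N : ℕ) :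
    ‖∑ n ∈ Finset.Ioc 0 N, f n‖ ≤ (K + C1 / (2 ^ θ - 1)) * (N : ℝ) ^ θ := by
  have h2 : (1 : ℝ) < 2 ^ θ := Real.one_lt_rpow (by norm_num) hθ
  have hK0 : 0 ≤ K := le_trans (Finset.sum_nonneg fun _ _ => norm_nonneg _) hK
  set D := C1 / (2 ^ θ - 1) with hD
  have hD0 : 0 ≤ D := div_nonneg hC1 (by linarith)
  have hDC : D + C1 = D * 2 ^ θ := by
    have : D * (2 ^ θ - 1) = C1 := div_mul_cancel₀ _ (by linarith)
    linarith
  have main : ∀ N : ℕ, ‖∑ n ∈ Finset.Ioc 0 N, f n‖ ≤ K + D * (N : ℝ) ^ θ := by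
    intro N
    induction N using Nat.strong_induction_on with
    | _ N ih =>
      by_cases hN : N ≤ 2 * P0 + 2
      · have h1 : ‖∑ n ∈ Finset.Ioc 0 N, f n‖ ≤ K := by
          refine (norm_sum_le _ _).trans (le_trans ?_ hK)
          exact Finset.sum_le_sum_of_subset_of_nonneg (Finset.Ioc_subset_Ioc_right hN) fun _ _ _ => norm_nonneg _
        have : 0 ≤ D * (N : ℝ) ^ θ := by positivity
        linarith
      · push Not at hN
        set P := N / 2 with hP
        have hu : Finset.Ioc 0 N = Finset.Ioc 0 P ∪ Finset.Ioc P N := by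
          rw [Finset.Ioc_union_Ioc_eq_Ioc (by omega) (by omega)]
        rw [hu, Finset.sum_union (by
          rw [Finset.disjoint_left]; intro x hx hx'
          rw [Finset.mem_Ioc] at hx hx'; omega)]
        have t1 := ih P (by omega)
        have t2 := hb P (by omega) N (by omega) (by omega)
        have t3 : (P : ℝ) ^ θ * 2 ^ θ ≤ (N : ℝ) ^ θ := by
          rw [← Real.mul_rpow (by positivity) (by norm_num)]
          refine Real.rpow_le_rpow (by positivity) ?_ hθ.le
          exact_mod_cast (by omega : P * 2 ≤ N)
        refine (norm_add_le _ _).trans ?_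
        calc _ ≤ K + D * (P : ℝ) ^ θ + C1 * (P : ℝ) ^ θ := add_le_add t1 t2
          _ = K + D * ((P : ℝ) ^ θ * 2 ^ θ) := by linear_combination (P : ℝ) ^ θ * hDC
          _ ≤ _ := by gcongr
  rcases Nat.eq_zero_or_pos N with h | h
  · subst h; simp; positivity
  · have h1 : 1 ≤ (N : ℝ) ^ θ := Real.one_le_rpow (by exact_mod_cast h) hθ.le
    refine (main N).trans ?_
    nlinarith

lemma regvar_up (f f' : ℝ → ℝ) (y0 γ : ℝ) (hd : ∀ y ≥ y0, HasDerivAt f (f' y) y) (hf : ∀ y ≥ y0, 0 < f y)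
    (hl : Tendsto (fun y => y * f' y / f y) atTop (nhds γ)) (ε : ℝ) (hε : 0 < ε) :
    ∃ y1, ∀ y ≥ y1, f y ≤ y ^ (γ + ε) := by
  have h1 : ∀ᶠ y in atTop, y * f' y / f y < γ + ε / 2 := hl.eventually_lt_const (by linarith)
  obtain ⟨y2, hy2⟩ := eventually_atTop.1 h1
  set y3 := max (max y0 y2) 1 with hy3
  have h30 : y0 ≤ y3 := le_trans (le_max_left _ _) (le_max_left _ _)
  have h32 : y2 ≤ y3 := le_trans (le_max_right _ _) (le_max_left _ _)
  have h31 : 1 ≤ y3 := le_max_right _ _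
  set L : ℝ → ℝ := fun y => Real.log (f y) - (γ + ε / 2) * Real.log y with hL
  have hLd : ∀ y ≥ y3, HasDerivAt L (f' y / f y - (γ + ε / 2) * y⁻¹) y := by
    intro y hy
    exact ((hd y (by linarith)).log (hf y (by linarith)).ne').sub
      ((Real.hasDerivAt_log (by linarith : y ≠ 0)).const_mul _)
  have hanti : AntitoneOn L (Ici y3) := by
    refine antitoneOn_of_deriv_nonpos (convex_Ici _) ?_ ?_ ?_
    · intro z hz; exact (hLd z hz).continuousAt.continuousWithinAt
    · intro z hz; rw [interior_Ici] at hz; exact (hLd z (le_of_lt hz)).differentiableAt.differentiableWithinAt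
    · intro z hz
      rw [interior_Ici] at hz
      have hz' : y3 < z := hz
      rw [(hLd z hz'.le).deriv]
      have h := hy2 z (by linarith)
      have hz0 : 0 < z := by linarith
      have : f' z / f z - (γ + ε / 2) * z⁻¹ = (z * f' z / f z - (γ + ε / 2)) * z⁻¹ := by
        field_simp
      rw [this]
      exact mul_nonpos_of_nonpos_of_nonneg (by linarith) (by positivity)
  have h2 : ∀ᶠ y in atTop, L y3 / (ε / 2) ≤ Real.log y := Real.tendsto_log_atTop.eventually_ge_atTop _
  obtain ⟨y4, hy4⟩ := eventually_atTop.1 h2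
  refine ⟨max y3 y4, fun y hy => ?_⟩
  have hy3' : y3 ≤ y := le_trans (le_max_left _ _) hy
  have a1 := hanti (Set.mem_Ici.2 le_rfl) (Set.mem_Ici.2 hy3') hy3'
  have a2 := hy4 y (le_trans (le_max_right _ _) hy)
  rw [div_le_iff₀ (by positivity)] at a2
  simp only [hL] at a1 a2
  have hy0 : 0 < y := by linarith
  rw [← Real.log_le_log_iff (hf y (by linarith)) (by positivity), Real.log_rpow hy0]
  linarith

lemma regvar (f f' : ℝ → ℝ) (y0 γ : ℝ) (hd : ∀ y ≥ y0, HasDerivAt f (f' y) y) (hf : ∀ y ≥ y0, 0 < f y)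
    (hl : Tendsto (fun y => y * f' y / f y) atTop (nhds γ)) (ε : ℝ) (hε : 0 < ε) :
    ∃ y1, ∀ y ≥ y1, y ^ (γ - ε) ≤ f y ∧ f y ≤ y ^ (γ + ε) := by
  obtain ⟨y1, hy1⟩ := regvar_up f f' y0 γ hd hf hl ε hε
  obtain ⟨y2, hy2⟩ := regvar_up (fun y => (f y)⁻¹) (fun y => -f' y / f y ^ 2) y0 (-γ)
    (fun y hy => (hd y hy).inv (hf y hy).ne') (fun y hy => inv_pos.2 (hf y hy)) (by
      refine (hl.neg).congr' ?_
      filter_upwards [eventually_ge_atTop y0] with y hy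
      have := (hf y hy).ne'
      field_simp) ε hε
  refine ⟨max (max y1 y2) (max y0 1), fun y hy => ⟨?_, hy1 y (le_trans (le_trans (le_max_left _ _) (le_max_left _ _)) hy)⟩⟩
  have h1 := hy2 y (le_trans (le_trans (le_max_right _ _) (le_max_left _ _)) hy)
  have hy0 : 0 < y := by linarith [le_trans (le_trans (le_max_right _ _) (le_max_right _ _)) hy]
  have hf0 := hf y (le_trans (le_trans (le_max_left _ _) (le_max_right _ _)) hy)
  have h2 := inv_anti₀ (inv_pos.2 hf0) h1
  rw [inv_inv, ← Real.rpow_neg hy0.le] at h2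
  rwa [show -(-γ + ε) = γ - ε by ring] at h2

lemma Fc.strictMono {c : ℝ} (F : Fc c) : StrictMonoOn F.toFun (Ici F.x₀) := by
  refine strictMonoOn_of_deriv_pos (convex_Ici _) F.contDiffOn.continuousOn ?_
  intro x hx
  exact F.deriv_pos x (interior_subset hx)

lemma Fc.vth_d1 {c : ℝ} (F : Fc c) {x : ℝ} (hx : F.x₀ < x) : HasDerivAt F.vth (deriv F.vth x) x := by
  have h1 : ContDiffAt ℝ 2 F.vth x := F.vth_contDiffOn.contDiffAt (Ici_mem_nhds hx)
  exact (h1.differentiableAt (by norm_num)).hasDerivAt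

lemma Fc.vth_d2 {c : ℝ} (F : Fc c) {x : ℝ} (hx : F.x₀ < x) :
    HasDerivAt (deriv F.vth) (deriv (deriv F.vth) x) x := by
  have h1 : ContDiffAt ℝ 2 F.vth x := F.vth_contDiffOn.contDiffAt (Ici_mem_nhds hx)
  have h2 : ContDiffAt ℝ 1 (deriv F.vth) x := h1.derivWithin (by norm_num)
  exact (h2.differentiableAt (by norm_num)).hasDerivAt

lemma Fc.h_d {c : ℝ} (F : Fc c) {x : ℝ} (hx : F.x₀ < x) :
    HasDerivAt F.toFun (F.toFun x * (c + F.vth x) / x) x := by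
  have hx0 := F.one_le_x₀
  have hxpos : 0 < x := by linarith
  have hcont : ContinuousOn (fun t => F.vth t / t) (Ici F.x₀) := by
    refine F.vth_contDiffOn.continuousOn.div continuousOn_id ?_
    intro t ht
    have : F.x₀ ≤ t := ht
    show t ≠ 0
    linarith
  have hInt0 : HasDerivAt (fun u => ∫ t in F.x₀..u, F.vth t / t) (F.vth x / x) x := by
    refine intervalIntegral.integral_hasDerivAt_right ?_ ?_ ?_
    · refine ContinuousOn.intervalIntegrable (hcont.mono ?_)
      rw [uIcc_of_le hx.le]
      exact Icc_subset_Ici_self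
    · exact (hcont.mono Ioi_subset_Ici_self).stronglyMeasurableAtFilter isOpen_Ioi x hx
    · exact hcont.continuousAt (Ici_mem_nhds hx)
  have h1 : HasDerivAt (fun u => F.Ch * u ^ c * Real.exp (∫ t in F.x₀..u, F.vth t / t))
      (F.Ch * (c * x ^ (c - 1)) * Real.exp (∫ t in F.x₀..x, F.vth t / t) +
        F.Ch * x ^ c * (Real.exp (∫ t in F.x₀..x, F.vth t / t) * (F.vth x / x))) x :=
    ((Real.hasDerivAt_rpow_const (Or.inl hxpos.ne')).const_mul F.Ch).mul hInt0.exp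
  have h2 : F.toFun =ᶠ[nhds x] (fun u => F.Ch * u ^ c * Real.exp (∫ t in F.x₀..u, F.vth t / t)) := by
    filter_upwards [Ici_mem_nhds hx] with u hu using F.eqn u hu
  refine (h1.congr_of_eventuallyEq h2).congr_deriv ?_
  rw [F.eqn x hx.le, Real.rpow_sub_one hxpos.ne']
  field_simp

lemma inv_facts {c : ℝ} (F : Fc c) (φ : ℝ → ℝ) (hφ₁ : ∀ x ≥ F.x₀, φ (F.toFun x) = x)
    (hφ₂ : ∀ y ≥ F.toFun F.x₀, F.toFun (φ y) = y)
    (hφ₃ : ∀ y ≥ F.toFun F.x₀, F.x₀ ≤ φ y) :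
    StrictMonoOn φ (Ici (F.toFun F.x₀)) ∧ Tendsto φ atTop atTop ∧
    (∀ y > F.toFun F.x₀, F.x₀ < φ y) ∧
    (∀ y > F.toFun F.x₀, HasDerivAt φ (φ y / (y * (c + F.vth (φ y)))) y) ∧
    (∀ y > F.toFun F.x₀, 0 < c + F.vth (φ y)) := by
  have hmono := F.strictMono
  have hm : StrictMonoOn φ (Ici (F.toFun F.x₀)) := by
    intro x hx y hy hxy
    by_contra hcon
    push Not at hcon
    have := hmono.monotoneOn (hφ₃ y hy) (hφ₃ x hx) hcon
    rw [hφ₂ x hx, hφ₂ y hy] at this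
    linarith
  have hgt : ∀ y > F.toFun F.x₀, F.x₀ < φ y := by
    intro y hy
    refine lt_of_le_of_ne (hφ₃ y hy.le) ?_
    intro h
    have := hφ₂ y hy.le
    rw [← h] at this; linarith
  have hpos : ∀ y > F.toFun F.x₀, 0 < c + F.vth (φ y) := by
    intro y hy
    have h1 := (F.h_d (hgt y hy)).deriv
    have h2 := F.deriv_pos (φ y) (hgt y hy).le
    rw [h1] at h2
    have h3 : 0 < F.toFun (φ y) := by linarith [F.one_le (φ y) (hgt y hy).le]
    have h4 : 0 < φ y := by linarith [F.one_le_x₀, hgt y hy]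
    by_contra hcon
    push Not at hcon
    have : F.toFun (φ y) * (c + F.vth (φ y)) / φ y ≤ 0 :=
      div_nonpos_of_nonpos_of_nonneg (mul_nonpos_of_nonneg_of_nonpos h3.le hcon) h4.le
    linarith
  refine ⟨hm, ?_, hgt, ?_, hpos⟩
  · rw [tendsto_atTop]
    intro b
    have hb : F.x₀ ≤ max b F.x₀ := le_max_right _ _
    filter_upwards [eventually_ge_atTop (F.toFun (max b F.x₀))] with y hy
    have h0 : F.toFun F.x₀ ≤ F.toFun (max b F.x₀) := hmono.monotoneOn (Set.mem_Ici.2 le_rfl) hb hb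
    have := hm.monotoneOn (show F.toFun (max b F.x₀) ∈ Ici (F.toFun F.x₀) from h0) (show y ∈ Ici (F.toFun F.x₀) from h0.trans hy) hy
    rw [hφ₁ _ hb] at this
    exact (le_max_left _ _).trans this
  · intro y hy
    have hcont : ContinuousAt φ y := by
      refine hm.continuousAt_of_image_mem_nhds (Ici_mem_nhds hy) ?_
      refine mem_of_superset (Ici_mem_nhds (hgt y hy)) ?_
      intro x hx
      exact ⟨F.toFun x, hmono.monotoneOn (Set.mem_Ici.2 le_rfl) hx hx, hφ₁ x hx⟩
    have h3 : 0 < F.toFun (φ y) := by linarith [F.one_le (φ y) (hgt y hy).le]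
    have h4 : 0 < φ y := by linarith [F.one_le_x₀, hgt y hy]
    have h5 := hpos y hy
    have h1 := HasDerivAt.of_local_left_inverse hcont (F.h_d (hgt y hy)) (by positivity) (by
      filter_upwards [Ici_mem_nhds hy] with z hz using hφ₂ z hz)
    refine h1.congr_deriv ?_
    rw [hφ₂ y hy.le, inv_div]

lemma Fc.limits {c : ℝ} (hc : 1 ≤ c) (F : Fc c) :
    Tendsto (fun u => c + F.vth u) atTop (nhds c) ∧ (∀ᶠ u in atTop, 0 < c + F.vth u - 1) ∧
    Tendsto (fun u => u * deriv F.vth u) atTop (nhds 0) ∧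
    Tendsto (fun u => u * deriv F.vth u / (c + F.vth u - 1)) atTop (nhds 0) ∧
    Tendsto (fun u => u ^ 2 * deriv (deriv F.vth) u / (c + F.vth u - 1)) atTop (nhds 0) := by
  rcases eq_or_lt_of_le hc with h | h
  · obtain ⟨k1, _, _, _, k2, k3, k4⟩ := F.cond_eq h.symm
    have e1 : ∀ u, c + F.vth u - 1 = F.vth u := fun u => by linarith
    simp only [e1]
    refine ⟨by simpa using k2.const_add c, ?_, ?_, k3, k4⟩
    · filter_upwards [eventually_ge_atTop F.x₀] with u hu using k1 u hu
    · have := k3.mul k2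
      rw [mul_zero] at this
      refine this.congr' ?_
      filter_upwards [eventually_ge_atTop F.x₀] with u hu
      exact div_mul_cancel₀ _ (k1 u hu).ne'
  · obtain ⟨k2, k3, k4⟩ := F.cond_gt h
    have hT : Tendsto (fun u => c + F.vth u) atTop (nhds c) := by simpa using k2.const_add c
    have hk : Tendsto (fun u => c + F.vth u - 1) atTop (nhds (c - 1)) := hT.sub_const 1
    have hne : c - 1 ≠ 0 := by linarith
    refine ⟨hT, hk.eventually_const_lt (by linarith), k3, ?_, ?_⟩
    · have := k3.div hk hne
      rw [zero_div] at this
      exact this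
    · have := k4.div hk hne
      rw [zero_div] at this
      exact this

lemma exists_good {c : ℝ} (hc₁ : 1 ≤ c) (hc₂ : c < 16 / 15)
    (F : Fc c) (γ : ℝ) (hγ : γ = 1 / c)
    (φ : ℝ → ℝ) (hφ₁ : ∀ x ≥ F.x₀, φ (F.toFun x) = x)
    (hφ₂ : ∀ y ≥ F.toFun F.x₀, F.toFun (φ y) = y)
    (hφ₃ : ∀ y ≥ F.toFun F.x₀, F.x₀ ≤ φ y) :
    ∃ φ1 B B1 : ℝ → ℝ, ∃ y0 : ℝ, F.toFun F.x₀ < y0 ∧ Good φ φ1 B B1 γ y0 := by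
  obtain ⟨-, hinf, hgt, hder, hTpos⟩ := inv_facts F φ hφ₁ hφ₂ hφ₃
  obtain ⟨lT, lk, l1, lr1, lr2⟩ := F.limits hc₁
  have hc0 : 0 < c := by linarith
  set T : ℝ → ℝ := fun u => c + F.vth u with hT
  set T1 := deriv F.vth with hT1
  set T2 := deriv T1 with hT2
  set Nn : ℝ → ℝ := fun u => T u * (T u - 1) + u * T1 u with hNn
  set ρ : ℝ → ℝ := fun u => 1 / T u * (1 + u * (2 * T u * T1 u + u * T2 u) / Nn u - 3 * (u * T1 u) / T u) with hρ
  have lk : ∀ᶠ u in atTop, 0 < T u - 1 := lk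
  have lr1 : Tendsto (fun u => u * T1 u / (T u - 1)) atTop (nhds 0) := lr1
  have lr2 : Tendsto (fun u => u ^ 2 * T2 u / (T u - 1)) atTop (nhds 0) := lr2
  have lN : Tendsto (fun u => T u + u * T1 u / (T u - 1)) atTop (nhds c) := by simpa using lT.add lr1
  have eN : ∀ᶠ u in atTop, 0 < Nn u := by
    filter_upwards [lN.eventually_const_lt hc0, lk] with u h1 h2
    have : Nn u = (T u + u * T1 u / (T u - 1)) * (T u - 1) := by
      have h3 : T u - 1 ≠ 0 := h2.ne'
      simp only [hNn]; field_simp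
    rw [this]; exact mul_pos h1 h2
  have lρ : Tendsto ρ atTop (nhds γ) := by
    have a1 : Tendsto (fun u => u * (2 * T u * T1 u + u * T2 u) / Nn u) atTop (nhds 0) := by
      have a2 : Tendsto (fun u => (2 * T u * (u * T1 u / (T u - 1)) + u ^ 2 * T2 u / (T u - 1)) / (T u + u * T1 u / (T u - 1)))
          atTop (nhds ((2 * c * 0 + 0) / c)) := (((lT.const_mul 2).mul lr1).add lr2).div lN hc0.ne'
      have a3 : (2 * c * 0 + 0) / c = 0 := by simp
      rw [a3] at a2
      refine a2.congr' ?_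
      filter_upwards [lN.eventually_const_lt hc0, lk, eN] with u h1 h2 h3
      have e1 : Nn u = (T u + u * T1 u / (T u - 1)) * (T u - 1) := by
        have h3 : T u - 1 ≠ 0 := h2.ne'
        simp only [hNn]; field_simp
      have h2' : T u - 1 ≠ 0 := h2.ne'
      rw [e1, div_eq_div_iff h1.ne' (mul_pos h1 h2).ne']
      generalize T u + u * T1 u / (T u - 1) = Z
      field_simp
    have a4 : Tendsto ρ atTop (nhds (1 / c * (1 + 0 - 3 * 0 / c))) :=
      (tendsto_const_nhds.div lT hc0.ne').mul (((a1.const_add 1)).sub ((l1.const_mul 3).div lT hc0.ne'))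
    have a5 : 1 / c * (1 + 0 - 3 * 0 / c) = γ := by rw [hγ]; simp
    rwa [a5] at a4
  have lN2 : Tendsto (fun u => -(Nn u / T u ^ 2)) atTop (nhds (γ - 1)) := by
    have a1 : Tendsto (fun u => -(Nn u / T u ^ 2)) atTop (nhds (-((c * (c - 1) + 0) / c ^ 2))) :=
      (((lT.mul (lT.sub_const 1)).add l1).div (lT.pow 2) (by positivity)).neg
    have a2 : -((c * (c - 1) + 0) / c ^ 2) = γ - 1 := by
      rw [hγ]; field_simp; ring
    rwa [a2] at a1
  set φ1 : ℝ → ℝ := fun y => φ y / (y * T (φ y)) with hφ1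
  set B : ℝ → ℝ := fun y => φ y * (Nn (φ y) / T (φ y) ^ 3) with hB
  set B1 : ℝ → ℝ := fun y => φ1 y * (Nn (φ y) / T (φ y) ^ 3) + φ y * (((2 * T (φ y) * T1 (φ y) + φ y * T2 (φ y)) * φ1 y * T (φ y) ^ 3
      - Nn (φ y) * (3 * T (φ y) ^ 2 * (T1 (φ y) * φ1 y))) / (T (φ y) ^ 3) ^ 2) with hB1
  have hh1 : 1 ≤ F.toFun F.x₀ := F.one_le _ le_rfl
  have hphi0 : ∀ y > F.toFun F.x₀, 0 < φ y := fun y hy => by linarith [hgt y hy, F.one_le_x₀]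
  have D1 : ∀ y > F.toFun F.x₀, HasDerivAt φ (φ1 y) y := hder
  have DT : ∀ y > F.toFun F.x₀, HasDerivAt (fun y => T (φ y)) (T1 (φ y) * φ1 y) y := by
    intro y hy
    exact ((F.vth_d1 (hgt y hy)).const_add c).comp y (D1 y hy)
  have DT1 : ∀ y > F.toFun F.x₀, HasDerivAt (fun y => T1 (φ y)) (T2 (φ y) * φ1 y) y := by
    intro y hy
    exact (F.vth_d2 (hgt y hy)).comp y (D1 y hy)
  have D2 : ∀ y > F.toFun F.x₀, HasDerivAt φ1 (-(B y) / y ^ 2) y := by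
    intro y hy
    have hy0 : 0 < y := by linarith
    have hT0 : 0 < T (φ y) := hTpos y hy
    have h1 := (D1 y hy).div ((hasDerivAt_id y).mul (DT y hy)) (mul_pos hy0 hT0).ne'
    refine HasDerivAt.congr_deriv (f := φ1) h1 ?_
    simp only [hB, hφ1, hNn, id, Pi.mul_apply]
    field_simp
    ring
  have DN : ∀ y > F.toFun F.x₀, HasDerivAt (fun y => Nn (φ y)) ((2 * T (φ y) * T1 (φ y) + φ y * T2 (φ y)) * φ1 y) y := by
    intro y hy
    have h1 := ((DT y hy).mul ((DT y hy).sub_const 1)).add ((D1 y hy).mul (DT1 y hy))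
    refine HasDerivAt.congr_deriv (f := fun y => Nn (φ y)) h1 ?_
    ring
  have D3 : ∀ y > F.toFun F.x₀, HasDerivAt B (B1 y) y := by
    intro y hy
    have hT0 : 0 < T (φ y) := hTpos y hy
    have h1 := (D1 y hy).mul ((DN y hy).div ((DT y hy).pow 3) (pow_pos hT0 3).ne')
    refine HasDerivAt.congr_deriv (f := B) h1 ?_
    simp only [hB1, Pi.mul_apply, Pi.div_apply, Pi.pow_apply]
    norm_num
  have r1 : ∀ y > F.toFun F.x₀, 0 < Nn (φ y) → y * B1 y / B y = ρ (φ y) := by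
    intro y hy hN
    have hy0 : 0 < y := by linarith
    have hT0 : 0 < T (φ y) := hTpos y hy
    have hp := hphi0 y hy
    simp only [hB1, hB, hρ, hφ1]
    generalize Nn (φ y) = n at hN ⊢
    generalize T (φ y) = t at hT0 ⊢
    generalize T1 (φ y) = t1
    generalize T2 (φ y) = t2
    generalize φ y = u at hp ⊢
    field_simp
    ring
  have r2 : ∀ y > F.toFun F.x₀, y * (-(B y) / y ^ 2) / φ1 y = -(Nn (φ y) / T (φ y) ^ 2) := by
    intro y hy
    have hy0 : 0 < y := by linarith
    have hT0 : 0 < T (φ y) := hTpos y hy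
    have hp := hphi0 y hy
    simp only [hB, hφ1]
    generalize Nn (φ y) = n
    generalize T (φ y) = t at hT0 ⊢
    generalize φ y = u at hp ⊢
    field_simp
  have eNy : ∀ᶠ y in atTop, 0 < Nn (φ y) := hinf.eventually eN
  have eh : ∀ᶠ y in atTop, F.toFun F.x₀ < y := eventually_gt_atTop _
  have LB : Tendsto (fun y => y * B1 y / B y) atTop (nhds γ) := by
    refine (lρ.comp hinf).congr' ?_
    filter_upwards [eNy, eh] with y h1 h2 using (r1 y h2 h1).symm
  have Lp : Tendsto (fun y => y * (-(B y) / y ^ 2) / φ1 y) atTop (nhds (γ - 1)) := by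
    refine (lN2.comp hinf).congr' ?_
    filter_upwards [eh] with y h2 using (r2 y h2).symm
  have hγ1 : 15 / 16 < γ := by
    rw [hγ, lt_div_iff₀ hc0]; linarith
  have hγ2 : γ ≤ 1 := by
    rw [hγ, div_le_one hc0]; exact hc₁
  have hp0 : ∀ y > F.toFun F.x₀, 0 < φ1 y := by
    intro y hy
    have hy0 : 0 < y := by linarith
    exact div_pos (hphi0 y hy) (mul_pos hy0 (hTpos y hy))
  have hpgr : ∀ ε > 0, ∃ y1, ∀ y ≥ y1, y ^ (γ - 1 - ε) ≤ φ1 y ∧ φ1 y ≤ y ^ (γ - 1 + ε) := by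
    intro ε hε
    exact regvar φ1 (fun y => -(B y) / y ^ 2) (F.toFun F.x₀ + 1) (γ - 1) (fun y hy => D2 y (by linarith))
      (fun y hy => hp0 y (by linarith)) Lp ε hε
  have ep1 : ∀ᶠ y in atTop, φ1 y ≤ 1 := by
    rcases eq_or_lt_of_le hc₁ with h | h
    · obtain ⟨k1, _, _, k2, _, _, _⟩ := F.cond_eq h.symm
      have e1 := hinf.eventually (k2.eventually_lt_const (show (0 : ℝ) < 1 by norm_num))
      filter_upwards [e1, eh] with y h1 h2
      have hy0 : 0 < y := by linarith
      rw [hφ₂ y h2.le] at h1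
      have hT1 : 1 ≤ T (φ y) := by
        have := k1 (φ y) (hgt y h2).le
        simp only [hT]; linarith
      rw [div_lt_one hy0] at h1
      simp only [hφ1]
      rw [div_le_one (by positivity)]
      nlinarith
    · have hlt : γ < 1 := by rw [hγ, div_lt_one hc0]; exact h
      obtain ⟨y1, hy1⟩ := hpgr (1 - γ) (by linarith)
      filter_upwards [eventually_ge_atTop y1] with y hy
      have := (hy1 y hy).2
      rwa [show γ - 1 + (1 - γ) = 0 by ring, Real.rpow_zero] at this
  have eB : ∀ᶠ y in atTop, 0 < B y := by
    filter_upwards [eNy, eh] with y h1 h2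
    exact mul_pos (hphi0 y h2) (div_pos h1 (pow_pos (hTpos y h2) 3))
  have elo : ∀ᶠ y in atTop, B y ≤ 2 * (y * B1 y) := by
    filter_upwards [eB, LB.eventually_const_lt (show (1 / 2 : ℝ) < γ by linarith)] with y h1 h2
    rw [lt_div_iff₀ h1] at h2; linarith
  have ehi : ∀ᶠ y in atTop, y * B1 y ≤ 2 * B y := by
    filter_upwards [eB, LB.eventually_lt_const (show γ < 2 by linarith)] with y h1 h2
    rw [div_lt_iff₀ h1] at h2; linarith
  obtain ⟨y0, hy0⟩ := eventually_atTop.1 ((((eB.and elo).and ehi).and ep1).and eh)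
  refine ⟨φ1, B, B1, max y0 1, ?_, ?_⟩
  · exact (hy0 (max y0 1) (le_max_left _ _)).2
  · have hh : ∀ y ≥ max y0 1, y0 ≤ y := fun y hy => (le_max_left _ _).trans hy
    have hBpos : ∀ y ≥ max y0 1, 0 < B y := fun y hy => (hy0 y (hh y hy)).1.1.1.1
    exact
    { hy0 := le_max_right _ _
      d1 := fun y hy => D1 y (hy0 y (hh y hy)).2
      d2 := fun y hy => D2 y (hy0 y (hh y hy)).2
      d3 := fun y hy => D3 y (hy0 y (hh y hy)).2
      Bpos := hBpos
      blo := fun y hy => (hy0 y (hh y hy)).1.1.1.2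
      bhi := fun y hy => (hy0 y (hh y hy)).1.1.2
      p0 := fun y hy => hp0 y (hy0 y (hh y hy)).2
      p1 := fun y hy => (hy0 y (hh y hy)).1.2
      Bgr := fun ε hε => regvar B B1 (max y0 1) γ (fun y hy => D3 y (hy0 y (hh y hy)).2) hBpos LB ε hε
      pgr := hpgr }

lemma indicator_saw {c : ℝ} (F : Fc c) (φ : ℝ → ℝ) (hφ₁ : ∀ x ≥ F.x₀, φ (F.toFun x) = x)
    (hφ₂ : ∀ y ≥ F.toFun F.x₀, F.toFun (φ y) = y)
    (hφ₃ : ∀ y ≥ F.toFun F.x₀, F.x₀ ≤ φ y) (n : ℕ) (hn : F.toFun F.x₀ < n)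
    (hd : φ ((n : ℝ) + 1) - φ n ≤ 1) :
    (if (∃ k : ℕ, F.x₀ ≤ (k : ℝ) ∧ (n : ℤ) = ⌊F.toFun k⌋) then (1 : ℝ) else 0)
      = (φ ((n : ℝ) + 1) - φ n) + (saw (-φ ((n : ℝ) + 1)) - saw (-φ n)) := by
  obtain ⟨hm, -, -, -, -⟩ := inv_facts F φ hφ₁ hφ₂ hφ₃
  have hlt : φ n < φ ((n : ℝ) + 1) := hm (mem_Ici.2 hn.le) (mem_Ici.2 (by linarith)) (by linarith)
  have hx0 := hφ₃ n hn.le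
  have h1 := F.one_le_x₀
  have key : (∃ k : ℕ, F.x₀ ≤ (k : ℝ) ∧ (n : ℤ) = ⌊F.toFun k⌋) ↔ ∃ k : ℤ, φ n ≤ k ∧ (k : ℝ) < φ ((n : ℝ) + 1) := by
    constructor
    · rintro ⟨k, hk, hk2⟩
      refine ⟨k, ?_, ?_⟩
      · have h2 : (n : ℝ) ≤ F.toFun k := by
          have := Int.floor_le (F.toFun k)
          rw [← hk2] at this; exact_mod_cast this
        have := hm.monotoneOn (mem_Ici.2 hn.le) (mem_Ici.2 (hn.le.trans h2)) h2
        rw [hφ₁ k hk] at this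
        exact_mod_cast this
      · have h2 : F.toFun k < (n : ℝ) + 1 := by
          have := Int.lt_floor_add_one (F.toFun k)
          rw [← hk2] at this; exact_mod_cast this
        have h3 : F.toFun F.x₀ ≤ F.toFun k := by
          have := Int.floor_le (F.toFun k)
          rw [← hk2] at this
          have : (n : ℝ) ≤ F.toFun k := by exact_mod_cast this
          linarith
        have := hm (mem_Ici.2 h3) (mem_Ici.2 (by linarith)) h2
        rw [hφ₁ k hk] at this
        exact_mod_cast this
    · rintro ⟨k, hk1, hk2⟩
      have hk0 : (0 : ℤ) ≤ k := by
        have : (0 : ℝ) ≤ k := by linarith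
        exact_mod_cast this
      lift k to ℕ using hk0
      have hk1 : φ n ≤ (k : ℝ) := by exact_mod_cast hk1
      have hk2 : (k : ℝ) < φ ((n : ℝ) + 1) := by exact_mod_cast hk2
      have hkx : F.x₀ ≤ (k : ℝ) := hx0.trans hk1
      refine ⟨k, hkx, ?_⟩
      symm
      rw [Int.floor_eq_iff]
      have hsm := F.strictMono
      have h2 := hsm.monotoneOn (mem_Ici.2 hx0) (mem_Ici.2 hkx) hk1
      have h3 := hsm (mem_Ici.2 hkx) (mem_Ici.2 (hφ₃ _ (by linarith))) hk2
      rw [hφ₂ _ hn.le] at h2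
      rw [hφ₂ _ (by linarith)] at h3
      exact ⟨by exact_mod_cast h2, by exact_mod_cast h3⟩
  have hs : (φ ((n : ℝ) + 1) - φ n) + (saw (-φ ((n : ℝ) + 1)) - saw (-φ n))
      = ((⌈φ ((n : ℝ) + 1)⌉ - ⌈φ n⌉ : ℤ) : ℝ) := by
    simp only [saw, Int.fract, Int.floor_neg]
    push_cast; ring
  rw [hs]
  have c1 := Int.le_ceil (φ n)
  have c2 := Int.ceil_lt_add_one (φ n)
  have c3 := Int.le_ceil (φ ((n : ℝ) + 1))
  have c4 := Int.ceil_lt_add_one (φ ((n : ℝ) + 1))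
  have hmn : ⌈φ n⌉ ≤ ⌈φ ((n : ℝ) + 1)⌉ := Int.ceil_mono hlt.le
  have hmx : ⌈φ ((n : ℝ) + 1)⌉ ≤ ⌈φ n⌉ + 1 := by
    rw [Int.ceil_le]; push_cast; linarith
  by_cases hI : ∃ k : ℤ, φ n ≤ k ∧ (k : ℝ) < φ ((n : ℝ) + 1)
  · rw [if_pos (key.2 hI)]
    obtain ⟨k, hk1, hk2⟩ := hI
    have d1 : ⌈φ n⌉ ≤ k := Int.ceil_le.2 hk1
    have d2 : k < ⌈φ ((n : ℝ) + 1)⌉ := Int.lt_ceil.2 hk2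
    have : ⌈φ ((n : ℝ) + 1)⌉ - ⌈φ n⌉ = 1 := by omega
    rw [this]; simp
  · rw [if_neg (fun h => hI (key.1 h))]
    have : ⌈φ ((n : ℝ) + 1)⌉ ≤ ⌈φ n⌉ := by
      by_contra h
      exact hI ⟨⌈φ n⌉, c1, Int.lt_ceil.1 (by omega)⟩
    have : ⌈φ ((n : ℝ) + 1)⌉ - ⌈φ n⌉ = 0 := by omega
    rw [this]; simp

lemma norm_e_le (t : ℝ) : ‖e t‖ ≤ 1 := by
  have : e t = Complex.exp (((2 * Real.pi * t : ℝ) : ℂ) * Complex.I) := by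
    simp only [e]; congr 1; push_cast; ring
  rw [this, Complex.norm_exp_ofReal_mul_I]

/-- **Lemma 1.4 of the paper.** For `c ∈ [1, 16/15)`, `h ∈ F_c` with inverse `φ`,
`γ = 1/c`, `(a, q) = 1` and `χ > 0` with `16(1-γ) + 28χ < 1`, there is `χ' > 0` such
that uniformly in `ξ ∈ [0,1]` and `N`,
`∑_{p ∈ P_{h,N}, p ≡ a (q)} φ'(p)⁻¹ log p · e(ξp)
  = ∑_{p ∈ P_N, p ≡ a (q)} log p · e(ξp) + O(N^{1-χ-χ'})`. -/
theorem exponential_sum_formula {c : ℝ} (hc₁ : 1 ≤ c) (hc₂ : c < 16 / 15)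
    (F : Fc c) (γ : ℝ) (hγ : γ = 1 / c)
    (φ : ℝ → ℝ) (hφ₁ : ∀ x ≥ F.x₀, φ (F.toFun x) = x)
    (hφ₂ : ∀ y ≥ F.toFun F.x₀, F.toFun (φ y) = y)
    (hφ₃ : ∀ y ≥ F.toFun F.x₀, F.x₀ ≤ φ y)
    (q : ℕ) (hq : 1 ≤ q) (a : ℕ) (ha : a ≤ q - 1) (hgcd : Nat.gcd a q = 1)
    (χ : ℝ) (hχ : 0 < χ) (hχ' : 16 * (1 - γ) + 28 * χ < 1) :
    ∃ χ' > 0, ∃ C > 0, ∀ N : ℕ, ∀ ξ ∈ Set.Icc (0:ℝ) 1,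
      ‖(∑ p ∈ Finset.Icc 1 N, if p ∈ Ph F ∧ p % q = a then
            (((deriv φ (p : ℝ))⁻¹ * Real.log p : ℝ) : ℂ) * e (ξ * p) else 0)
        - (∑ p ∈ Finset.Icc 1 N, if p.Prime ∧ p % q = a then
            ((Real.log p : ℝ) : ℂ) * e (ξ * p) else 0)‖
      ≤ C * (N : ℝ) ^ (1 - χ - χ') := by
  obtain ⟨φ1, B, B1, y0, hy0, G⟩ := exists_good hc₁ hc₂ F γ hγ φ hφ₁ hφ₂ hφ₃
  have hc0 : 0 < c := by linarith
  have hγ1 : γ ≤ 1 := by rw [hγ, div_le_one hc0]; exact hc₁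
  set ε : ℝ := (1 - 16 * (1 - γ) - 28 * χ) / 1000 with hε
  have hε0 : 0 < ε := by rw [hε]; apply div_pos <;> linarith
  have hθ : 0 < 1 - χ - ε := by rw [hε]; linarith
  have haq : a < q := by omega
  obtain ⟨C1, hC1, P0, hP0⟩ := block_final G χ ε hχ hε0 hγ1 (by rw [hε]; linarith)
    (fun n => ∃ k : ℕ, F.x₀ ≤ (k : ℝ) ∧ (n : ℤ) = ⌊F.toFun k⌋)
    (fun n hn => indicator_saw F φ hφ₁ hφ₂ hφ₃ n (lt_of_lt_of_le hy0 hn)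
      ((G.delta hn).2.trans (G.p1 _ hn))) q a haq
  set P1 : ℕ := max P0 ⌈y0⌉₊ with hP1
  set K : ℝ := ∑ n ∈ Finset.Ioc 0 (2 * P1 + 2), (|(deriv φ (n : ℝ))⁻¹ * Real.log n| + |Real.log n|) with hK
  have hK0 : 0 ≤ K := Finset.sum_nonneg fun n _ => by positivity
  have h2θ : (1 : ℝ) < 2 ^ (1 - χ - ε) := Real.one_lt_rpow (by norm_num) hθ
  have hfr : 0 < C1 / ((2 : ℝ) ^ (1 - χ - ε) - 1) := div_pos hC1 (by linarith)
  refine ⟨ε, hε0, K + C1 / ((2 : ℝ) ^ (1 - χ - ε) - 1), by linarith, fun N ξ _ => ?_⟩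
  rw [← Finset.sum_sub_distrib]
  have hIcc : Finset.Icc 1 N = Finset.Ioc 0 N := by
    ext n; simp only [Finset.mem_Icc, Finset.mem_Ioc]; omega
  rw [hIcc]
  refine dyadic (1 - χ - ε) C1 K hθ hC1.le P1 _ ?_ ?_ N
  · intro P hP Q hPQ hQ
    refine le_trans (le_of_eq ?_) (hP0 P ((le_max_left _ _).trans hP) Q hPQ hQ ξ)
    congr 1
    refine Finset.sum_congr rfl fun n hn => ?_
    rw [Finset.mem_Ioc] at hn
    have hyn : y0 ≤ (n : ℝ) := by
      have h1 : ⌈y0⌉₊ ≤ n := ((le_max_right P0 _).trans hP).trans hn.1.le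
      exact (Nat.le_ceil y0).trans (by exact_mod_cast h1)
    rw [(G.d1 n hyn).deriv]
    congr 1
    exact if_congr Iff.rfl rfl rfl
  · rw [hK]
    refine Finset.sum_le_sum fun n _ => ?_
    refine (norm_sub_le _ _).trans (add_le_add ?_ ?_)
    · split_ifs
      · rw [norm_mul, Complex.norm_real, Real.norm_eq_abs]
        exact mul_le_of_le_one_right (abs_nonneg _) (norm_e_le _)
      · rw [norm_zero]; exact abs_nonneg _
    · split_ifs
      · rw [norm_mul, Complex.norm_real, Real.norm_eq_abs]
        exact mul_le_of_le_one_right (abs_nonneg _) (norm_e_le _)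
      · rw [norm_zero]; exact abs_nonneg _
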